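/- Let F be an algebraically closed field of characteristic p ≥ 3. Then for every n ≥ 1, the group algebra F[S_n] of the symmetric group S_n is Schurian-finite if and only if n < 2p. -/

import Mathlib

noncomputable section

/-- A module `M` over the `F`-algebra `A` is *Schurian* if it is finite-dimensional over `F`
and its endomorphism algebra `End_A(M)` is isomorphic to `F` as an `F`-algebra. -/
def IsSchurian (F : Type) [Field F] (A : Type) [Ring A] [Algebra F A]
    (M : Type) [AddCommGroup M] [Module F M] [Module A M]
    [IsScalarTower F A M] [SMulCommClass A F M] : Prop :=
  FiniteDimensional F M ∧ Nonempty (Module.End A M ≃ₐ[F] F)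

/-- The `F`-algebra `A` is *Schurian-finite* if there are only finitely many isomorphism
classes of Schurian `A`-modules. -/
def IsSchurianFinite (F : Type) [Field F] (A : Type) [Ring A] [Algebra F A] : Prop :=
  ∃ (k : ℕ) (N : Fin k → ModuleCat.{0} A),
    ∀ (M : Type) [AddCommGroup M] [Module F M] [Module A M]
      [IsScalarTower F A M] [SMulCommClass A F M],
      IsSchurian F A M → ∃ j : Fin k, Nonempty (M ≃ₗ[A] N j)

section Orthogonal

variable {F A : Type} [Field F] [Ring A] [Algebra F A]

theorem exists_isSchurian_quotient_submodule [IsAlgClosed F] (M : Type) [AddCommGroup M]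
    [Module F M] [Module A M] [IsScalarTower F A M] [FiniteDimensional F M] [Nontrivial M] :
    ∃ (N : Submodule A M) (π : M →ₗ[A] N), Function.Surjective π ∧ Nontrivial N ∧
      IsSchurian F A N := by
  obtain ⟨f, hf, hmin⟩ := WellFounded.has_min
    (measure fun f : M →ₗ[A] M => Module.finrank F (LinearMap.range f)).wf
    {f | f ≠ 0} ⟨LinearMap.id, fun h => by
      obtain ⟨x, hx⟩ := exists_ne (0 : M)
      exact hx (by simpa using congrArg (fun g => g x) h)⟩
  have hsurj : Function.Surjective f.rangeRestrict := f.surjective_rangeRestrict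
  have hfin : FiniteDimensional F (LinearMap.range f) :=
    Module.Finite.of_surjective (f.rangeRestrict.restrictScalars F) hsurj
  have hnt : Nontrivial (LinearMap.range f) := by
    rw [Submodule.nontrivial_iff_ne_bot]
    intro h
    exact hf (LinearMap.range_eq_bot.mp h)
  have hinj : ∀ g : Module.End A (LinearMap.range f), g ≠ 0 → Function.Injective g := by
    intro g hg
    have hne : (LinearMap.range f).subtype ∘ₗ g ∘ₗ f.rangeRestrict ≠ 0 := by
      intro h
      apply hg
      ext x
      obtain ⟨y, rfl⟩ := hsurj x
      simpa using congrArg (fun u => u y) h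
    have hle : Module.finrank F (LinearMap.range f) ≤ Module.finrank F (LinearMap.range
        ((LinearMap.range f).subtype ∘ₗ g ∘ₗ f.rangeRestrict)) := not_lt.mp (hmin _ hne)
    have hr : (LinearMap.range ((LinearMap.range f).subtype ∘ₗ g ∘ₗ f.rangeRestrict)) =
        (LinearMap.range g).map (LinearMap.range f).subtype := by
      rw [LinearMap.range_comp, LinearMap.range_comp_of_range_eq_top _
        (LinearMap.range_eq_top.mpr hsurj)]
    rw [hr] at hle
    let gF : LinearMap.range f →ₗ[F] LinearMap.range f := g.restrictScalars F
    have e : Module.finrank F ((LinearMap.range g).map (LinearMap.range f).subtype) =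
        Module.finrank F (LinearMap.range gF) :=
      (((LinearMap.range g).equivMapOfInjective (LinearMap.range f).subtype
        Subtype.val_injective).restrictScalars F).finrank_eq.symm
    have hle' : Module.finrank F (LinearMap.range f) ≤ Module.finrank F (LinearMap.range gF) := by
      rw [← e]; exact hle
    have htop : LinearMap.range gF = ⊤ :=
      Submodule.eq_top_of_finrank_eq (le_antisymm (Submodule.finrank_le _) hle')
    exact LinearMap.injective_iff_surjective.mpr (LinearMap.range_eq_top.mp htop)
  refine ⟨LinearMap.range f, f.rangeRestrict, hsurj, hnt, inferInstance, ?_⟩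
  refine ⟨(AlgEquiv.ofBijective (Algebra.ofId F _) ⟨(Algebra.ofId F _).injective, ?_⟩).symm⟩
  intro g
  obtain ⟨c, hc⟩ := Module.End.exists_eigenvalue (K := F) (g.restrictScalars F)
  obtain ⟨v, hv⟩ := hc.exists_hasEigenvector
  refine ⟨c, ?_⟩
  by_contra hne
  have hne' : g - algebraMap F (Module.End A (LinearMap.range f)) c ≠ 0 := by
    intro h
    exact hne (sub_eq_zero.mp h).symm
  refine hv.2 (hinj _ hne' ?_)
  have h2 : g v = c • v := hv.apply_eq_smul
  simp [h2, Module.algebraMap_end_apply]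

theorem not_isSchurianFinite_of_orthogonal [IsAlgClosed F] (M : F → Type)
    [∀ τ, AddCommGroup (M τ)] [∀ τ, Module F (M τ)] [∀ τ, Module A (M τ)]
    [∀ τ, IsScalarTower F A (M τ)] [∀ τ, FiniteDimensional F (M τ)] [∀ τ, Nontrivial (M τ)]
    (h : ∀ σ τ, σ ≠ τ → ∀ f : M σ →ₗ[A] M τ, f = 0) : ¬ IsSchurianFinite F A := by
  rintro ⟨k, N, hN⟩
  choose I π hsurj hnt hS using fun τ =>
    exists_isSchurian_quotient_submodule (F := F) (A := A) (M τ)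
  choose j e using fun τ => hN (I τ) (hS τ)
  have : Infinite F := IsAlgClosed.instInfinite
  obtain ⟨σ, τ, hne, hj⟩ := Finite.exists_ne_map_eq_of_infinite j
  obtain ⟨e₁⟩ := e σ
  have e₂ : I τ ≃ₗ[A] N (j σ) := by rw [hj]; exact (e τ).some
  have h0 := h σ τ hne ((I τ).subtype ∘ₗ (e₁.trans e₂.symm).toLinearMap ∘ₗ π σ)
  obtain ⟨x, hx⟩ := exists_ne (0 : I σ)
  obtain ⟨y, rfl⟩ := hsurj σ x
  apply hx
  simpa using congrArg (fun u => u y) h0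

end Orthogonal

section Retracts

variable {F A : Type} [Field F] [Ring A] [Algebra F A]

/-- A nonzero module all of whose endomorphisms are multiplications by elements of `F`. -/
def IsScalarBrick (F A : Type) [Field F] [Ring A] [Algebra F A]
    (N : Type) [AddCommGroup N] [Module A N] : Prop :=
  Nontrivial N ∧ ∀ f : N →ₗ[A] N, ∃ c : F, ∀ x, f x = algebraMap F A c • x

theorem IsScalarBrick.of_equiv {M N : Type} [AddCommGroup M] [Module A M] [AddCommGroup N]
    [Module A N] (h : IsScalarBrick F A M) (e : M ≃ₗ[A] N) : IsScalarBrick F A N := by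
  refine ⟨@Equiv.nontrivial _ _ e.symm.toEquiv h.1, fun f => ?_⟩
  obtain ⟨c, hc⟩ := h.2 (e.symm.toLinearMap ∘ₗ f ∘ₗ e.toLinearMap)
  refine ⟨c, fun x => ?_⟩
  have := congrArg e (hc (e.symm x))
  simpa using this

theorem IsSchurian.isScalarBrick {M : Type} [AddCommGroup M] [Module F M] [Module A M]
    [IsScalarTower F A M] [SMulCommClass A F M] (h : IsSchurian F A M) :
    IsScalarBrick F A M := by
  obtain ⟨-, ⟨e⟩⟩ := h
  refine ⟨?_, fun f => ⟨e f, fun x => ?_⟩⟩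
  · by_contra hn
    rw [not_nontrivial_iff_subsingleton] at hn
    have : (1 : Module.End A M) = 0 := Subsingleton.elim _ _
    exact one_ne_zero (by rw [← map_one e, this, map_zero] : (1 : F) = 0)
  · have : f = algebraMap F (Module.End A M) (e f) := by
      apply e.injective
      rw [AlgEquiv.commutes]
      rfl
    conv_lhs => rw [this]
    rw [Module.algebraMap_end_apply, algebraMap_smul]

/-- Two bricks connected by maps with nonzero composite are isomorphic. -/
theorem IsScalarBrick.nonempty_equiv {M N : Type} [AddCommGroup M] [Module A M]
    [AddCommGroup N] [Module A N] (hM : IsScalarBrick F A M) (hN : IsScalarBrick F A N)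
    (u : M →ₗ[A] N) (v : N →ₗ[A] M) (h : v ∘ₗ u ≠ 0) : Nonempty (M ≃ₗ[A] N) := by
  obtain ⟨c, hc⟩ := hM.2 (v ∘ₗ u)
  obtain ⟨d, hd⟩ := hN.2 (u ∘ₗ v)
  have hc0 : c ≠ 0 := by
    rintro rfl
    exact h (LinearMap.ext fun x => by simpa using hc x)
  have hd0 : d ≠ 0 := by
    rintro rfl
    apply h
    ext x
    have h1 : algebraMap F A c • (v (u x)) = 0 := by
      rw [← hc (v (u x))]
      have := hd (u x)
      simp only [LinearMap.comp_apply] at this ⊢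
      rw [this]
      simp
    have h2 := congrArg (fun y => algebraMap F A c⁻¹ • y) h1
    simpa [smul_smul, ← map_mul, inv_mul_cancel₀ hc0] using h2
  have hcc : ∀ x : M, algebraMap F A c⁻¹ • v (u x) = x := fun x => by
    have := hc x
    simp only [LinearMap.comp_apply] at this
    rw [this, smul_smul, ← map_mul, inv_mul_cancel₀ hc0, map_one, one_smul]
  refine ⟨LinearEquiv.ofBijective u ⟨?_, ?_⟩⟩
  · intro x y hxy
    rw [← hcc x, ← hcc y, hxy]
  · intro y
    refine ⟨v (algebraMap F A d⁻¹ • y), ?_⟩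
    have := hd (algebraMap F A d⁻¹ • y)
    simp only [LinearMap.comp_apply] at this
    rw [this, smul_smul, ← map_mul, mul_inv_cancel₀ hd0, map_one, one_smul]

/-- If every Schurian module is a retract of one finite-dimensional module, there are only
finitely many of them. -/
theorem isSchurianFinite_of_retracts (W : Type) [AddCommGroup W] [Module F W] [Module A W]
    [IsScalarTower F A W] [FiniteDimensional F W]
    (h : ∀ (M : Type) [AddCommGroup M] [Module F M] [Module A M] [IsScalarTower F A M]
      [SMulCommClass A F M], IsSchurian F A M →
      ∃ (i : M →ₗ[A] W) (π : W →ₗ[A] M), π ∘ₗ i = LinearMap.id) :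
    IsSchurianFinite F A := by
  let Q := {E : W →ₗ[A] W // E ∘ₗ E = E ∧ IsScalarBrick F A (LinearMap.range E)}
  let s : Setoid Q :=
    { r := fun E E' => Nonempty (LinearMap.range E.1 ≃ₗ[A] LinearMap.range E'.1)
      iseqv := ⟨fun _ => ⟨LinearEquiv.refl _ _⟩, fun ⟨e⟩ => ⟨e.symm⟩,
        fun ⟨e⟩ ⟨e'⟩ => ⟨e.trans e'⟩⟩ }
  let E : Quotient s → W →ₗ[A] W := fun j => j.out.1
  have hidem : ∀ j x, E j (E j x) = E j x := fun j x =>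
    congrArg (fun f => f x) j.out.2.1
  have hbrick : ∀ j, IsScalarBrick F A (LinearMap.range (E j)) := fun j => j.out.2.2
  have hzero : ∀ j k, j ≠ k → ∀ x, E k (E j (E k x)) = 0 := by
    intro j k hjk x
    by_contra hx
    apply hjk
    have hiso : Nonempty (LinearMap.range (E k) ≃ₗ[A] LinearMap.range (E j)) := by
      refine (hbrick k).nonempty_equiv (hbrick j)
        ((E j).rangeRestrict ∘ₗ (LinearMap.range (E k)).subtype)
        ((E k).rangeRestrict ∘ₗ (LinearMap.range (E j)).subtype) fun h0 => hx ?_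
      have := congrArg (fun f => (f ⟨E k x, ⟨x, rfl⟩⟩ : W)) h0
      simpa using this
    obtain ⟨e⟩ := hiso
    have : Quotient.mk s j.out = Quotient.mk s k.out := Quotient.sound ⟨e.symm⟩
    simpa using this
  have hli : LinearIndependent F (fun j => (E j).restrictScalars F) := by
    rw [linearIndependent_iff']
    intro t g hg k hk
    obtain ⟨⟨y, x, rfl⟩, hy⟩ := @exists_ne _ (hbrick k).1 0
    have hy' : E k x ≠ 0 := fun h0 => hy (Subtype.ext h0)
    have h1 : E k ((∑ j ∈ t, g j • (E j).restrictScalars F) (E k x)) = 0 := by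
      rw [hg]; simp
    rw [LinearMap.sum_apply, map_sum, Finset.sum_eq_single k] at h1
    · rw [LinearMap.smul_apply, LinearMap.restrictScalars_apply, hidem,
        LinearMap.map_smul_of_tower, hidem] at h1
      exact (smul_eq_zero.mp h1).resolve_right hy'
    · intro j _ hjk
      rw [LinearMap.smul_apply, LinearMap.restrictScalars_apply,
        LinearMap.map_smul_of_tower, hzero j k hjk, smul_zero]
    · exact fun h => absurd hk h
  have : Finite (Quotient s) := hli.finite
  obtain ⟨n, ⟨φ⟩⟩ := Finite.exists_equiv_fin (Quotient s)
  refine ⟨n, fun j => ModuleCat.of A (LinearMap.range (E (φ.symm j))), ?_⟩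
  intro M _ _ _ _ _ hM
  obtain ⟨i, π, hπ⟩ := h M hM
  have hπ' : ∀ x, π (i x) = x := fun x => congrArg (fun f => f x) hπ
  have e : M ≃ₗ[A] LinearMap.range (i ∘ₗ π) :=
    LinearEquiv.ofBijective
      (LinearMap.codRestrict (LinearMap.range (i ∘ₗ π)) i fun x => ⟨i x, by simp [hπ']⟩)
      ⟨fun x y hxy => by
        have h1 : i x = i y := congrArg Subtype.val hxy
        rw [← hπ' x, h1, hπ'], by
        rintro ⟨_, y, rfl⟩
        exact ⟨π y, rfl⟩⟩
  let q : Q := ⟨i ∘ₗ π, by ext x; simp [hπ'], hM.isScalarBrick.of_equiv e⟩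
  refine ⟨φ (Quotient.mk s q), ?_⟩
  obtain ⟨e'⟩ : (Quotient.mk s q).out ≈ q := Quotient.mk_out q
  have key : ∀ j, j = Quotient.mk s q → Nonempty (M ≃ₗ[A] LinearMap.range (E j)) := by
    rintro _ rfl
    exact ⟨e.trans e'.symm⟩
  exact key _ (φ.symm_apply_apply _)

end Retracts

section RelativeTrace

variable {F G : Type} [Field F] [Group G]
variable {M N : Type} [AddCommGroup M] [Module F M] [Module (MonoidAlgebra F G) M]
  [IsScalarTower F (MonoidAlgebra F G) M] [AddCommGroup N] [Module F N]
  [Module (MonoidAlgebra F G) N] [IsScalarTower F (MonoidAlgebra F G) N]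

open MonoidAlgebra in
/-- The conjugate `x φ x⁻¹` of a linear map between two representations. -/
def conjMap (φ : M →ₗ[F] N) (x : G) : M →ₗ[F] N where
  toFun m := single x (1 : F) • φ (single x⁻¹ (1 : F) • m)
  map_add' a b := by simp
  map_smul' a b := by simp [smul_comm _ a]

open MonoidAlgebra in
theorem conjMap_apply (φ : M →ₗ[F] N) (x : G) (m : M) :
    conjMap φ x m = single x (1 : F) • φ (single x⁻¹ (1 : F) • m) := rfl

open MonoidAlgebra in
theorem conjMap_smul (φ : M →ₗ[F] N) (h x : G) (m : M) :
    conjMap φ (h * x) (single h (1 : F) • m) = single h (1 : F) • conjMap φ x m := by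
  simp [conjMap_apply, smul_smul, single_mul_single, mul_assoc]

open MonoidAlgebra in
theorem conjMap_mul_of_mem {C : Subgroup G} (φ : M →ₗ[F] N)
    (hφ : ∀ c ∈ C, ∀ m, φ (single c (1 : F) • m) = single c (1 : F) • φ m) (x c : G)
    (hc : c ∈ C) (m : M) : conjMap φ (x * c) m = conjMap φ x m := by
  have := hφ c⁻¹ (inv_mem hc) (single x⁻¹ (1 : F) • m)
  simp only [conjMap_apply, mul_inv_rev]
  rw [← one_mul (1 : F), ← single_mul_single, mul_smul, one_mul, ← one_mul (1 : F),
    ← single_mul_single, mul_smul, one_mul, this, smul_smul (single c _), single_mul_single]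
  simp [← one_def]

open MonoidAlgebra in
/-- The relative trace of a `C`-equivariant linear map. -/
def relTrace [Finite G] (C : Subgroup G) (φ : M →ₗ[F] N)
    (hφ : ∀ c ∈ C, ∀ m, φ (single c (1 : F) • m) = single c (1 : F) • φ m) :
    M →ₗ[MonoidAlgebra F G] N :=
  equivariantOfLinearOfComm
    (∑ᶠ q : G ⧸ C, conjMap φ q.out) (by
    classical
    have := Fintype.ofFinite (G ⧸ C)
    intro h v
    simp only [finsum_eq_sum_of_fintype, LinearMap.sum_apply, Finset.smul_sum]
    refine (Fintype.sum_equiv (MulAction.toPerm h) _ _ fun q => ?_).symm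
    rw [← conjMap_smul]
    have hq : ((h * q.out : G) : G ⧸ C) = h • q := by
      conv_rhs => rw [← QuotientGroup.out_eq' q]
      rfl
    obtain ⟨c, hc⟩ := QuotientGroup.mk_out_eq_mul C (h * q.out)
    rw [hq] at hc
    rw [MulAction.toPerm_apply, hc, conjMap_mul_of_mem φ hφ _ _ c.2])

open MonoidAlgebra in
theorem relTrace_apply [Finite G] (C : Subgroup G) [Fintype (G ⧸ C)] (φ : M →ₗ[F] N)
    (hφ : ∀ c ∈ C, ∀ m, φ (single c (1 : F) • m) = single c (1 : F) • φ m) (m : M) :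
    relTrace C φ hφ m = ∑ q : G ⧸ C, conjMap φ q.out m := by
  simp [relTrace, finsum_eq_sum_of_fintype]

end RelativeTrace

section JordanDecomposition

open Polynomial

variable {F A : Type} [Field F] [Ring A] [Algebra F A]

/-- A module on which the unipotent element `a` acts decomposes, as a module over `F[a]`, into
pieces that factor through the modules `A ⧸ A (a - 1) ^ k`. -/
theorem exists_factor_through_cyclic {a : A} {p : ℕ} (ha : (a - 1) ^ p = 0) (M : Type)
    [AddCommGroup M] [Module F M] [Module A M] [IsScalarTower F A M] [FiniteDimensional F M] :
    ∃ (d : ℕ) (k : Fin d → ℕ) (ψ : ∀ i, (A ⧸ Submodule.span A {(a - 1) ^ k i}) →ₗ[A] M)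
      (ρ : ∀ i, M →ₗ[F] (A ⧸ Submodule.span A {(a - 1) ^ k i})),
      (∀ i, k i ≤ p) ∧ (∀ i m, ρ i (a • m) = a • ρ i m) ∧ ∀ m, ∑ i, ψ i (ρ i m) = m := by
  have haev : ∀ e : ℕ, aeval a ((X - C (1 : F)) ^ e) = (a - 1) ^ e := fun e => by simp
  have htors : Module.IsTorsion' (Module.AEval F M a) (Submonoid.powers (X - C (1 : F))) := by
    intro x
    obtain ⟨m, rfl⟩ := (Module.AEval.of F M a).surjective x
    refine ⟨⟨_, p, rfl⟩, ?_⟩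
    change ((X - C (1 : F)) ^ p) • Module.AEval.of F M a m = 0
    rw [← Module.AEval.of_aeval_smul, haev, ha, zero_smul, map_zero]
  obtain ⟨d, k, ⟨e⟩⟩ := Module.torsion_by_prime_power_decomposition
    (irreducible_X_sub_C (1 : F)) htors
  let one' : ∀ i, F[X] ⧸ Submodule.span F[X] {(X - C (1 : F)) ^ k i} := fun i =>
    Submodule.Quotient.mk 1
  have hmk : ∀ i (h : F[X]), (Submodule.Quotient.mk h :
      F[X] ⧸ Submodule.span F[X] {(X - C (1 : F)) ^ k i}) = h • one' i := fun i h => by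
    rw [← Submodule.Quotient.mk_smul, smul_eq_mul, mul_one]
  let v : Fin d → M := fun i =>
    (Module.AEval.of F M a).symm (e.symm (DirectSum.lof F[X] (Fin d) _ i (one' i)))
  have hv : ∀ i (h : F[X]), aeval a h • v i =
      (Module.AEval.of F M a).symm (e.symm (DirectSum.lof F[X] (Fin d) _ i
        (Submodule.Quotient.mk h))) := fun i h => by
    rw [LinearEquiv.eq_symm_apply, Module.AEval.of_aeval_smul, hmk]
    simp [v]
  have hkill : ∀ i, (a - 1) ^ k i • v i = 0 := fun i => by
    rw [← haev, hv, (Submodule.Quotient.mk_eq_zero _).mpr (Submodule.mem_span_singleton_self _)]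
    simp
  have hk : ∀ i, k i ≤ p := fun i => by
    have h0 : aeval a ((X - C (1 : F)) ^ p) • v i = 0 := by rw [haev, ha, zero_smul]
    rw [hv, LinearEquiv.map_eq_zero_iff, LinearEquiv.map_eq_zero_iff] at h0
    have h1 := congrArg (DirectSum.component F[X] (Fin d) _ i) h0
    rw [DirectSum.component.lof_self, map_zero, Submodule.Quotient.mk_eq_zero,
      Submodule.mem_span_singleton] at h1
    obtain ⟨c, hc⟩ := h1
    have hdvd : (X - C (1 : F)) ^ k i ∣ (X - C (1 : F)) ^ p := ⟨c, by
      rw [← hc, smul_eq_mul, mul_comm]⟩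
    exact (pow_dvd_pow_iff (X_sub_C_ne_zero _) (irreducible_X_sub_C (1 : F)).not_isUnit).mp hdvd
  let σ : ∀ i, (F[X] ⧸ Submodule.span F[X] {(X - C (1 : F)) ^ k i}) →ₗ[F[X]]
      Module.AEval F (A ⧸ Submodule.span A {(a - 1) ^ k i}) a := fun i =>
    Submodule.liftQSpanSingleton _ (LinearMap.toSpanSingleton F[X] _
      (Module.AEval.of F (A ⧸ Submodule.span A {(a - 1) ^ k i}) a (Submodule.Quotient.mk 1))) (by
      rw [LinearMap.toSpanSingleton_apply, ← Module.AEval.of_aeval_smul, haev,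
        ← Submodule.Quotient.mk_smul, smul_eq_mul, mul_one,
        (Submodule.Quotient.mk_eq_zero _).mpr (Submodule.mem_span_singleton_self _), map_zero])
  have hσ : ∀ i (h : F[X]), σ i (Submodule.Quotient.mk h) =
      Module.AEval.of F (A ⧸ Submodule.span A {(a - 1) ^ k i}) a
        (aeval a h • Submodule.Quotient.mk 1) := fun i h => by
    rw [Module.AEval.of_aeval_smul]
    rfl
  let τ : ∀ i, Module.AEval F M a →ₗ[F[X]]
      Module.AEval F (A ⧸ Submodule.span A {(a - 1) ^ k i}) a := fun i =>
    σ i ∘ₗ DirectSum.component F[X] (Fin d) _ i ∘ₗ e.toLinearMap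
  let ψ : ∀ i, (A ⧸ Submodule.span A {(a - 1) ^ k i}) →ₗ[A] M := fun i =>
    Submodule.liftQSpanSingleton _ (LinearMap.toSpanSingleton A M (v i)) (hkill i)
  have hψ : ∀ i, ψ i (Submodule.Quotient.mk 1) = v i := fun i => by
    change (LinearMap.toSpanSingleton A M (v i)) 1 = v i
    simp
  refine ⟨d, k, ψ, fun i => (Module.AEval.of F _ a).symm.toLinearMap ∘ₗ
    (τ i).restrictScalars F ∘ₗ (Module.AEval.of F M a).toLinearMap, hk, ?_, ?_⟩
  · intro i m
    simp only [LinearMap.comp_apply, LinearEquiv.coe_coe, LinearMap.restrictScalars_apply]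
    rw [LinearEquiv.symm_apply_eq, ← Module.AEval.X_smul_of, map_smul, ← Module.AEval.X_smul_of,
      LinearEquiv.apply_symm_apply]
  · intro m
    have hterm : ∀ i, ψ i ((Module.AEval.of F _ a).symm (τ i (Module.AEval.of F M a m))) =
        (Module.AEval.of F M a).symm (e.symm (DirectSum.lof F[X] (Fin d) _ i
          (e (Module.AEval.of F M a m) i))) := fun i => by
      obtain ⟨h, hh⟩ := Submodule.Quotient.mk_surjective _ (e (Module.AEval.of F M a m) i)
      have : τ i (Module.AEval.of F M a m) = σ i (e (Module.AEval.of F M a m) i) := rfl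
      rw [this, ← hh, hσ, LinearEquiv.symm_apply_apply, map_smul, hψ, hv]
    simp only [LinearMap.comp_apply, LinearEquiv.coe_coe, LinearMap.restrictScalars_apply]
    rw [Finset.sum_congr rfl fun i _ => hterm i, ← map_sum, ← map_sum, LinearEquiv.symm_apply_eq,
      LinearEquiv.symm_apply_eq]
    exact DirectSum.sum_univ_of _

end JordanDecomposition

section FiniteType

open MonoidAlgebra

/-- If `G` has a cyclic subgroup of exponent `p = char F` whose index is prime to `p`, then
`F[G]` has finitely many Schurian modules. -/
theorem isSchurianFinite_of_zpowers {F G : Type} [Field F] [Group G] [Finite G] (p : ℕ)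
    [Fact p.Prime] [CharP F p] (g : G) (hg : g ^ p = 1)
    (hindex : ¬ p ∣ (Subgroup.zpowers g).index) : IsSchurianFinite F (MonoidAlgebra F G) := by
  classical
  have ha : (single g (1 : F) - 1) ^ p = 0 := by
    have : CharP (MonoidAlgebra F G) p := charP_of_injective_algebraMap
      (algebraMap F (MonoidAlgebra F G)).injective p
    rw [sub_pow_char_of_commute p (Commute.one_right _), single_pow, hg, one_pow, one_pow,
      ← one_def, sub_self]
  let U : ℕ → Submodule (MonoidAlgebra F G) (MonoidAlgebra F G) := fun e =>
    Submodule.span (MonoidAlgebra F G) {(single g (1 : F) - 1) ^ e}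
  refine isSchurianFinite_of_retracts (F := F) (A := MonoidAlgebra F G)
    (∀ e : Fin (p + 1), MonoidAlgebra F G ⧸ U e) ?_
  intro M _ _ _ _ _ hM
  have : FiniteDimensional F M := hM.1
  obtain ⟨d, k, ψ, ρ, hk, hρ, hsum⟩ := exists_factor_through_cyclic (F := F) ha M
  have := Fintype.ofFinite (G ⧸ Subgroup.zpowers g)
  have hρ' : ∀ i, ∀ c ∈ Subgroup.zpowers g, ∀ m, ρ i (single c (1 : F) • m) =
      single c (1 : F) • ρ i m := by
    intro i c hc m
    obtain ⟨n, rfl⟩ := (isOfFinOrder_of_finite g).mem_powers_iff_mem_zpowers.mpr hc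
    have hs : ∀ n : ℕ, single (g ^ n) (1 : F) = single g (1 : F) ^ n := fun n => by
      rw [single_pow, one_pow]
    simp only [hs]
    clear hc
    induction n generalizing m with
    | zero => simp
    | succ n ih => rw [pow_succ, mul_smul, ih, hρ, mul_smul]
  let θ : Fin d → M →ₗ[MonoidAlgebra F G] M := fun i =>
    ψ i ∘ₗ relTrace (Subgroup.zpowers g) (ρ i) (hρ' i)
  have hθ : ∀ m, ∑ i, θ i m = ((Subgroup.zpowers g).index : F) • m := by
    intro m
    simp only [θ, LinearMap.comp_apply, relTrace_apply, conjMap_apply, map_sum, map_smul]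
    rw [Finset.sum_comm]
    simp only [← Finset.smul_sum, hsum, smul_smul, single_mul_single, mul_inv_cancel, mul_one,
      ← one_def, one_smul]
    rw [Finset.sum_const, Finset.card_univ, Subgroup.index, Nat.card_eq_fintype_card,
      Nat.cast_smul_eq_nsmul]
  obtain ⟨hnt, hscal⟩ := hM.isScalarBrick
  choose c hc using fun i => hscal (θ i)
  have hne : ∃ i, c i ≠ 0 := by
    by_contra! h0
    obtain ⟨m, hm⟩ := exists_ne (0 : M)
    have := hθ m
    rw [Finset.sum_eq_zero fun i _ => by rw [hc, h0, map_zero, zero_smul]] at this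
    rcases smul_eq_zero.mp this.symm with h | h
    · exact hindex ((CharP.cast_eq_zero_iff F p _).mp h)
    · exact hm h
  obtain ⟨i, hi⟩ := hne
  let j : Fin (p + 1) := ⟨k i, Nat.lt_succ_of_le (hk i)⟩
  refine ⟨LinearMap.single (MonoidAlgebra F G) (fun e : Fin (p + 1) => MonoidAlgebra F G ⧸ U e) j ∘ₗ
    relTrace (Subgroup.zpowers g) (ρ i) (hρ' i),
    (LinearMap.lsmul F (M →ₗ[MonoidAlgebra F G] M) (c i)⁻¹ LinearMap.id) ∘ₗ ψ i ∘ₗ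
      LinearMap.proj (R := MonoidAlgebra F G) (φ := fun e : Fin (p + 1) => MonoidAlgebra F G ⧸ U e) j, ?_⟩
  ext m
  have h1 := hc i m
  simp only [θ, LinearMap.comp_apply] at h1
  simp only [LinearMap.comp_apply, LinearMap.coe_proj, Function.eval, LinearMap.coe_single,
    Pi.single_eq_same, LinearMap.id_apply, LinearMap.lsmul_apply, LinearMap.smul_apply]
  erw [h1]
  rw [algebraMap_smul, smul_smul, inv_mul_cancel₀ hi, one_smul]

theorem isSchurianFinite_perm_of_lt {F : Type} [Field F] (p : ℕ) [hp : Fact p.Prime] [CharP F p]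
    {n : ℕ} (hn : n < 2 * p) : IsSchurianFinite F (MonoidAlgebra F (Equiv.Perm (Fin n))) := by
  have hcard : Fintype.card (Equiv.Perm (Fin n)) = n.factorial := by
    rw [Fintype.card_perm, Fintype.card_fin]
  rcases lt_or_ge n p with h | h
  · refine isSchurianFinite_of_zpowers p 1 (one_pow _) ?_
    rw [Subgroup.zpowers_one_eq_bot, Subgroup.index_bot, Nat.card_eq_fintype_card, hcard]
    exact fun hd => absurd ((Nat.Prime.dvd_factorial hp.out).mp hd) (by omega)
  · obtain ⟨g, hg⟩ := exists_prime_orderOf_dvd_card p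
      (by rw [hcard]; exact (Nat.Prime.dvd_factorial hp.out).mpr h)
    refine isSchurianFinite_of_zpowers p g (by rw [← hg, pow_orderOf_eq_one]) fun hd => ?_
    have hmul := (Subgroup.zpowers g).card_mul_index
    rw [Nat.card_zpowers, hg, Nat.card_eq_fintype_card, hcard] at hmul
    have h2 : p ^ 2 ∣ n.factorial := by
      rw [← hmul, sq]
      exact mul_dvd_mul_left p hd
    have h3 : ∀ m, m < 2 * p → ¬ p ^ 2 ∣ m.factorial := by
      intro m
      induction m with
      | zero =>
        intro _ h
        have := Nat.le_of_dvd (by simp) h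
        have := hp.out.two_le
        simp at *
        nlinarith
      | succ m ih =>
        intro hm hdvd
        rw [Nat.factorial_succ] at hdvd
        by_cases hpm : p ∣ m + 1
        · obtain ⟨c, hc⟩ := hpm
          have hc1 : c = 1 := by
            have : c < 2 := by
              by_contra! h2
              nlinarith
            interval_cases c <;> omega
          rw [hc, hc1, mul_one, sq] at hdvd
          have := (Nat.Prime.dvd_factorial hp.out).mp
            (Nat.dvd_of_mul_dvd_mul_left hp.out.pos hdvd)
          subst hc1
          omega
        · exact ih (by omega) ((Nat.Coprime.pow_left 2
            ((Nat.Prime.coprime_iff_not_dvd hp.out).mpr hpm)).dvd_of_dvd_mul_left hdvd)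
    exact h3 n hn h2

end FiniteType

section Killing

variable {ι R : Type} [DecidableEq ι] [CommRing R]

/-- Difference operator exchanging `a` and `b` in the first argument. -/
def pairDiff (a b : ι) (t : Finset ι → Finset ι → R) : Finset ι → Finset ι → R :=
  fun S Z => t (insert a S) Z - t (insert b S) Z

/-- Add `u` and `v` to the first argument and take the difference for the second one. -/
def flagDiff (u v : ι) (t : Finset ι → Finset ι → R) : Finset ι → Finset ι → R :=
  fun S Z => t (insert u (insert v S)) (insert v Z) - t (insert u (insert v S)) (insert u Z)

/-- Cyclic sum of `flagDiff` over a triple of points. -/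
def tripleDiff (a b c : ι) (t : Finset ι → Finset ι → R) : Finset ι → Finset ι → R :=
  fun S Z => flagDiff b c t S Z + flagDiff c a t S Z + flagDiff a b t S Z

/-- `t` is annihilated by all products of `k` triple differences on disjoint triples in `X`. -/
def KilledByTriples : ℕ → Finset ι → (Finset ι → Finset ι → R) → Prop
  | 0, _, t => t ∅ ∅ = 0
  | k + 1, X, t => ∀ a ∈ X, ∀ b ∈ X, ∀ c ∈ X, a ≠ b → a ≠ c → b ≠ c →
      KilledByTriples k (((X.erase a).erase b).erase c) (tripleDiff a b c t)

/-- `t` is annihilated by all products of `m` pair differences and `k` triple differences on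
disjoint subsets of `X`. -/
def Killed : ℕ → ℕ → Finset ι → (Finset ι → Finset ι → R) → Prop
  | 0, k, X, t => KilledByTriples k X t
  | m + 1, k, X, t => ∀ a ∈ X, ∀ b ∈ X, a ≠ b →
      Killed m k ((X.erase a).erase b) (pairDiff a b t)

/-- Functions of the flag `(S, Z)` which are sums over proper subsets of `Z`. -/
def properSubsetSum (f : Finset ι → Finset ι → R) : Finset ι → Finset ι → R :=
  fun S Z => ∑ Y ∈ Z.powerset, f S Y - f S Z

/-- Functions of the flag `(S, Z)` which are sums over sets `K` with `Z ⊆ K ⊂ S`. -/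
def intermediateSum (y : Finset ι → Finset ι → R) : Finset ι → Finset ι → R :=
  fun S Z => ∑ K ∈ S.powerset, (if Z ⊆ K then y K Z else 0) - y S Z

/-- `t` and `t'` agree on flags `Z ⊆ S ⊆ X` with `|S| = q` and `|Z| = k`. -/
def AgreeOn (q k : ℕ) (X : Finset ι) (t t' : Finset ι → Finset ι → R) : Prop :=
  ∀ S Z, S ⊆ X → S.card = q → Z ⊆ S → Z.card = k → t S Z = t' S Z

theorem pairDiff_agreeOn {q k : ℕ} {X : Finset ι} {t t' : Finset ι → Finset ι → R}
    (h : AgreeOn (q + 1) k X t t') {a b : ι} (ha : a ∈ X) (hb : b ∈ X) :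
    AgreeOn q k ((X.erase a).erase b) (pairDiff a b t) (pairDiff a b t') := by
  intro S Z hS hq hZ hk
  have haS : a ∉ S := fun h' => by simpa using hS h'
  have hbS : b ∉ S := fun h' => by simpa using hS h'
  have hSX : S ⊆ X := hS.trans ((Finset.erase_subset _ _).trans (Finset.erase_subset _ _))
  unfold pairDiff
  rw [h (insert a S) Z (Finset.insert_subset ha hSX) (by rw [Finset.card_insert_of_notMem haS, hq])
      (hZ.trans (Finset.subset_insert _ _)) hk,
    h (insert b S) Z (Finset.insert_subset hb hSX) (by rw [Finset.card_insert_of_notMem hbS, hq])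
      (hZ.trans (Finset.subset_insert _ _)) hk]

theorem flagDiff_congr {q k : ℕ} {X : Finset ι} {t t' : Finset ι → Finset ι → R}
    (h : AgreeOn (q + 2) (k + 1) X t t') {u v : ι} (hu : u ∈ X) (hv : v ∈ X) (huv : u ≠ v)
    {S Z : Finset ι} (hS : S ⊆ X) (huS : u ∉ S) (hvS : v ∉ S) (hq : S.card = q) (hZ : Z ⊆ S)
    (hk : Z.card = k) : flagDiff u v t S Z = flagDiff u v t' S Z := by
  have h1 : insert u (insert v S) ⊆ X := Finset.insert_subset hu (Finset.insert_subset hv hS)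
  have h2 : (insert u (insert v S)).card = q + 2 := by
    rw [Finset.card_insert_of_notMem (by simp [huv, huS]), Finset.card_insert_of_notMem hvS, hq]
  have hZu : u ∉ Z := fun h => huS (hZ h)
  have hZv : v ∉ Z := fun h => hvS (hZ h)
  unfold flagDiff
  rw [h _ (insert v Z) h1 h2 ((Finset.insert_subset_insert v hZ).trans (Finset.subset_insert _ _))
      (by rw [Finset.card_insert_of_notMem hZv, hk]),
    h _ (insert u Z) h1 h2
      (Finset.insert_subset_insert u (hZ.trans (Finset.subset_insert _ _)))
      (by rw [Finset.card_insert_of_notMem hZu, hk])]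

theorem tripleDiff_agreeOn {q k : ℕ} {X : Finset ι} {t t' : Finset ι → Finset ι → R}
    (h : AgreeOn (q + 2) (k + 1) X t t') {a b c : ι} (ha : a ∈ X) (hb : b ∈ X) (hc : c ∈ X)
    (hab : a ≠ b) (hac : a ≠ c) (hbc : b ≠ c) :
    AgreeOn q k (((X.erase a).erase b).erase c) (tripleDiff a b c t) (tripleDiff a b c t') := by
  intro S Z hS hq hZ hk
  have haS : a ∉ S := fun h' => by simpa using hS h'
  have hbS : b ∉ S := fun h' => by simpa using hS h'
  have hcS : c ∉ S := fun h' => by simpa using hS h'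
  have hSX : S ⊆ X := hS.trans ((Finset.erase_subset _ _).trans
    ((Finset.erase_subset _ _).trans (Finset.erase_subset _ _)))
  unfold tripleDiff
  rw [flagDiff_congr h hb hc hbc hSX hbS hcS hq hZ hk,
    flagDiff_congr h hc ha hac.symm hSX hcS haS hq hZ hk,
    flagDiff_congr h ha hb hab hSX haS hbS hq hZ hk]

theorem KilledByTriples.congr {k : ℕ} : ∀ {X : Finset ι} {t t' : Finset ι → Finset ι → R},
    AgreeOn (2 * k) k X t t' → KilledByTriples k X t → KilledByTriples k X t' := by
  induction k with
  | zero =>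
    intro X t t' h ht
    unfold KilledByTriples at ht ⊢
    rw [← ht]
    exact (h ∅ ∅ (by simp) (by simp) (by simp) (by simp)).symm
  | succ k ih =>
    intro X t t' h ht a ha b hb c hc hab hac hbc
    exact ih (tripleDiff_agreeOn (q := 2 * k) h ha hb hc hab hac hbc)
      (ht a ha b hb c hc hab hac hbc)

theorem Killed.congr {m k : ℕ} : ∀ {X : Finset ι} {t t' : Finset ι → Finset ι → R},
    AgreeOn (m + 2 * k) k X t t' → Killed m k X t → Killed m k X t' := by
  induction m with
  | zero =>
    intro X t t' h ht
    rw [zero_add] at h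
    exact KilledByTriples.congr h ht
  | succ m ih =>
    intro X t t' h ht a ha b hb hab
    rw [add_right_comm] at h
    exact ih (pairDiff_agreeOn h ha hb) (ht a ha b hb hab)

theorem pairDiff_sub (a b : ι) (t t' : Finset ι → Finset ι → R) :
    pairDiff a b (t - t') = pairDiff a b t - pairDiff a b t' := by
  funext S Z
  simp only [pairDiff, Pi.sub_apply]
  ring

theorem tripleDiff_sub (a b c : ι) (t t' : Finset ι → Finset ι → R) :
    tripleDiff a b c (t - t') = tripleDiff a b c t - tripleDiff a b c t' := by
  funext S Z
  simp only [tripleDiff, flagDiff, Pi.sub_apply]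
  ring

theorem KilledByTriples.sub {k : ℕ} : ∀ {X : Finset ι} {t t' : Finset ι → Finset ι → R},
    KilledByTriples k X t → KilledByTriples k X t' → KilledByTriples k X (t - t') := by
  induction k with
  | zero =>
    intro X t t' h h'
    unfold KilledByTriples at *
    simp [h, h']
  | succ k ih =>
    intro X t t' h h' a ha b hb c hc hab hac hbc
    rw [tripleDiff_sub]
    exact ih (h a ha b hb c hc hab hac hbc) (h' a ha b hb c hc hab hac hbc)

theorem Killed.sub {m k : ℕ} : ∀ {X : Finset ι} {t t' : Finset ι → Finset ι → R},
    Killed m k X t → Killed m k X t' → Killed m k X (t - t') := by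
  induction m with
  | zero => exact KilledByTriples.sub
  | succ m ih =>
    intro X t t' h h' a ha b hb hab
    rw [pairDiff_sub]
    exact ih (h a ha b hb hab) (h' a ha b hb hab)

theorem KilledByTriples.mono {k : ℕ} : ∀ {X Y : Finset ι} {t : Finset ι → Finset ι → R},
    Y ⊆ X → KilledByTriples k X t → KilledByTriples k Y t := by
  induction k with
  | zero => exact fun _ h => h
  | succ k ih =>
    intro X Y t hY h a ha b hb c hc hab hac hbc
    exact ih (Finset.erase_subset_erase _ (Finset.erase_subset_erase _
      (Finset.erase_subset_erase _ hY))) (h a (hY ha) b (hY hb) c (hY hc) hab hac hbc)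

theorem Killed.mono {m k : ℕ} : ∀ {X Y : Finset ι} {t : Finset ι → Finset ι → R},
    Y ⊆ X → Killed m k X t → Killed m k Y t := by
  induction m with
  | zero => exact KilledByTriples.mono
  | succ m ih =>
    intro X Y t hY h a ha b hb hab
    exact ih (Finset.erase_subset_erase _ (Finset.erase_subset_erase _ hY))
      (h a (hY ha) b (hY hb) hab)

theorem pairDiff_tripleDiff (a b c a' b' : ι) (t : Finset ι → Finset ι → R) :
    pairDiff a' b' (tripleDiff a b c t) = tripleDiff a b c (pairDiff a' b' t) := by
  funext S Z
  simp only [tripleDiff, flagDiff, pairDiff]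
  have h : ∀ x u v : ι, insert u (insert v (insert x S)) = insert x (insert u (insert v S)) :=
    fun x u v => by rw [Finset.insert_comm v x, Finset.insert_comm u x]
  simp only [h a', h b']
  ring

theorem Killed.triple {m k : ℕ} : ∀ {X : Finset ι} {t : Finset ι → Finset ι → R},
    Killed m (k + 1) X t → ∀ {a b c : ι}, a ∈ X → b ∈ X → c ∈ X → a ≠ b → a ≠ c → b ≠ c →
      Killed m k (((X.erase a).erase b).erase c) (tripleDiff a b c t) := by
  induction m with
  | zero => exact fun h _ _ _ ha hb hc hab hac hbc => h _ ha _ hb _ hc hab hac hbc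
  | succ m ih =>
    intro X t h a b c ha hb hc hab hac hbc a' ha' b' hb' hab'
    simp only [Finset.mem_erase] at ha' hb'
    rw [pairDiff_tripleDiff]
    have := ih (h a' ha'.2.2.2 b' hb'.2.2.2 hab') (a := a) (b := b) (c := c)
      (by simp [ha, ha'.2.2.1.symm, hb'.2.2.1.symm])
      (by simp [hb, ha'.2.1.symm, hb'.2.1.symm]) (by simp [hc, ha'.1.symm, hb'.1.symm])
      hab hac hbc
    convert this using 1
    ext x
    simp only [Finset.mem_erase]
    tauto

theorem KilledByTriples.of_erase {k : ℕ} : ∀ {X : Finset ι} {t : Finset ι → Finset ι → R},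
    3 * k < X.card → (∀ b ∈ X, KilledByTriples k (X.erase b) t) → KilledByTriples k X t := by
  induction k with
  | zero =>
    intro X t hX h
    obtain ⟨b, hb⟩ := Finset.card_pos.mp hX
    exact h b hb
  | succ k ih =>
    intro X t hX h a ha b hb c hc hab hac hbc
    refine ih ?_ fun d hd => ?_
    · rw [Finset.card_erase_of_mem (by simp [hc, hac.symm, hbc.symm]),
        Finset.card_erase_of_mem (by simp [hb, hab.symm]), Finset.card_erase_of_mem ha]
      omega
    · simp only [Finset.mem_erase] at hd
      have := h d hd.2.2.2 a (by simp [ha, hd.2.2.1.symm]) b (by simp [hb, hd.2.1.symm])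
        c (by simp [hc, hd.1.symm]) hab hac hbc
      convert this using 1
      ext x
      simp only [Finset.mem_erase]
      tauto

theorem Killed.of_erase {m k : ℕ} : ∀ {X : Finset ι} {t : Finset ι → Finset ι → R},
    2 * m + 3 * k < X.card → (∀ b ∈ X, Killed m k (X.erase b) t) → Killed m k X t := by
  induction m with
  | zero =>
    intro X t hX h
    exact KilledByTriples.of_erase (by omega) h
  | succ m ih =>
    intro X t hX h a ha b hb hab
    refine ih ?_ fun d hd => ?_
    · rw [Finset.card_erase_of_mem (by simp [hb, hab.symm]), Finset.card_erase_of_mem ha]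
      omega
    · simp only [Finset.mem_erase] at hd
      have := h d hd.2.2 a (by simp [ha, hd.2.1.symm]) b (by simp [hb, hd.1.symm]) hab
      convert this using 1
      ext x
      simp only [Finset.mem_erase]
      tauto

theorem pairDiff_properSubsetSum (a b : ι) (f : Finset ι → Finset ι → R) :
    pairDiff a b (properSubsetSum f) = properSubsetSum (pairDiff a b f) := by
  funext S Z
  simp only [pairDiff, properSubsetSum, Finset.sum_sub_distrib]
  ring

theorem flagDiff_properSubsetSum {u v : ι} (f : Finset ι → Finset ι → R) {S Z : Finset ι}
    (hu : u ∉ Z) (hv : v ∉ Z) :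
    flagDiff u v (properSubsetSum f) S Z = properSubsetSum (flagDiff u v f) S Z := by
  simp only [flagDiff, properSubsetSum, Finset.sum_sub_distrib, Finset.sum_powerset_insert hu,
    Finset.sum_powerset_insert hv]
  ring

theorem tripleDiff_properSubsetSum {a b c : ι} (f : Finset ι → Finset ι → R) {S Z : Finset ι}
    (ha : a ∉ Z) (hb : b ∉ Z) (hc : c ∉ Z) :
    tripleDiff a b c (properSubsetSum f) S Z = properSubsetSum (tripleDiff a b c f) S Z := by
  simp only [tripleDiff, flagDiff_properSubsetSum f hb hc, flagDiff_properSubsetSum f hc ha,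
    flagDiff_properSubsetSum f ha hb]
  simp only [properSubsetSum, tripleDiff, Finset.sum_add_distrib]
  ring

theorem pairDiff_intermediateSum {a b : ι} (y : Finset ι → Finset ι → R) {S Z : Finset ι}
    (ha : a ∉ S) (hb : b ∉ S) (hZ : Z ⊆ S) :
    pairDiff a b (intermediateSum y) S Z = intermediateSum (pairDiff a b y) S Z := by
  have h : ∀ x ∉ S, ∀ K : Finset ι, Z ⊆ insert x K ↔ Z ⊆ K := fun x hx K =>
    Finset.subset_insert_iff_of_notMem fun h => hx (hZ h)
  have e : ∀ K, (if Z ⊆ K then y (insert a K) Z - y (insert b K) Z else 0) =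
      (if Z ⊆ K then y (insert a K) Z else 0) - (if Z ⊆ K then y (insert b K) Z else 0) :=
    fun K => by split_ifs <;> simp
  simp only [pairDiff, intermediateSum, Finset.sum_powerset_insert ha,
    Finset.sum_powerset_insert hb, h a ha, h b hb, e, Finset.sum_sub_distrib]
  ring

theorem flagDiff_intermediateSum {u v : ι} (y : Finset ι → Finset ι → R) {S Z : Finset ι}
    (hu : u ∉ S) (hv : v ∉ S) (huv : u ≠ v) (hZ : Z ⊆ S) :
    flagDiff u v (intermediateSum y) S Z = intermediateSum (flagDiff u v y) S Z +
      (∑ K ∈ S.powerset, (if Z ⊆ K then y (insert v K) (insert v Z) else 0) -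
       ∑ K ∈ S.powerset, (if Z ⊆ K then y (insert u K) (insert u Z) else 0)) := by
  have h1 : ∀ x ∉ S, ∀ K ∈ S.powerset, ¬ insert x Z ⊆ K := fun x hx K hK h =>
    hx (Finset.mem_powerset.mp hK (h (Finset.mem_insert_self _ _)))
  have h2 : ∀ x ∉ S, ∀ K, insert x Z ⊆ insert x K ↔ Z ⊆ K := fun x hx K => by
    rw [Finset.insert_subset_iff, Finset.subset_insert_iff_of_notMem fun h => hx (hZ h)]
    simp
  have h3 : insert u (insert v S) = insert v (insert u S) := Finset.insert_comm _ _ _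
  have h4 : ∀ x ∉ S, ∀ z ∉ S, z ≠ x → ∀ K ∈ S.powerset, ¬ insert x Z ⊆ insert z K := by
    intro x hx z hz hzx K hK h
    have := h (Finset.mem_insert_self x Z)
    rw [Finset.mem_insert] at this
    rcases this with h | h
    · exact hzx h.symm
    · exact hx (Finset.mem_powerset.mp hK h)
  have h5 : ∀ x ∉ S, ∀ z ∉ S, z ≠ x → ∀ K, insert x Z ⊆ insert z (insert x K) ↔ Z ⊆ K := by
    intro x hx z hz hzx K
    rw [Finset.subset_insert_iff_of_notMem, h2 x hx]
    rw [Finset.mem_insert]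
    rintro (h | h)
    · exact hzx h
    · exact hz (hZ h)
  have key : ∀ x ∉ S, ∀ z ∉ S, z ≠ x →
      intermediateSum y (insert z (insert x S)) (insert x Z) =
      ∑ K ∈ S.powerset, (if Z ⊆ K then y (insert x K) (insert x Z) else 0) +
      ∑ K ∈ S.powerset, (if Z ⊆ K then y (insert z (insert x K)) (insert x Z) else 0) -
      y (insert z (insert x S)) (insert x Z) := by
    intro x hx z hz hzx
    unfold intermediateSum
    rw [Finset.sum_powerset_insert (by simp [hzx, hz]), Finset.sum_powerset_insert hx,
      Finset.sum_powerset_insert hx]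
    rw [Finset.sum_eq_zero (s := S.powerset) (f := fun K => if insert x Z ⊆ K then _ else _)
        (fun K hK => if_neg (h1 x hx K hK)),
      Finset.sum_eq_zero (s := S.powerset) (f := fun K => if insert x Z ⊆ insert z K then _ else _)
        (fun K hK => if_neg (h4 x hx z hz hzx K hK))]
    simp only [h2 x hx, h5 x hx z hz hzx, zero_add]
  have e : ∀ K, (if Z ⊆ K then flagDiff u v y K Z else 0) =
      (if Z ⊆ K then y (insert u (insert v K)) (insert v Z) else 0) -
      (if Z ⊆ K then y (insert v (insert u K)) (insert u Z) else 0) :=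
    fun K => by
      rw [Finset.insert_comm v u]
      split_ifs <;> simp [flagDiff]
  have lhs : flagDiff u v (intermediateSum y) S Z =
      intermediateSum y (insert u (insert v S)) (insert v Z) -
      intermediateSum y (insert v (insert u S)) (insert u Z) := by
    rw [← h3]; rfl
  have rhs : intermediateSum (flagDiff u v y) S Z =
      ∑ K ∈ S.powerset, (if Z ⊆ K then flagDiff u v y K Z else 0) -
      (y (insert u (insert v S)) (insert v Z) - y (insert v (insert u S)) (insert u Z)) := by
    rw [← h3]; rfl
  rw [lhs, rhs, key v hv u hu huv, key u hu v hv huv.symm]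
  simp only [e, Finset.sum_sub_distrib]
  ring

theorem tripleDiff_intermediateSum {a b c : ι} (y : Finset ι → Finset ι → R) {S Z : Finset ι}
    (ha : a ∉ S) (hb : b ∉ S) (hc : c ∉ S) (hab : a ≠ b) (hac : a ≠ c) (hbc : b ≠ c)
    (hZ : Z ⊆ S) :
    tripleDiff a b c (intermediateSum y) S Z = intermediateSum (tripleDiff a b c y) S Z := by
  have e : ∀ K, (if Z ⊆ K then tripleDiff a b c y K Z else 0) =
      (if Z ⊆ K then flagDiff b c y K Z else 0) + (if Z ⊆ K then flagDiff c a y K Z else 0) +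
      (if Z ⊆ K then flagDiff a b y K Z else 0) := fun K => by
    split_ifs <;> simp [tripleDiff]
  have h : intermediateSum (tripleDiff a b c y) S Z = intermediateSum (flagDiff b c y) S Z +
      intermediateSum (flagDiff c a y) S Z + intermediateSum (flagDiff a b y) S Z := by
    unfold intermediateSum
    simp only [e, Finset.sum_add_distrib]
    simp only [tripleDiff]
    ring
  rw [h]
  simp only [tripleDiff, flagDiff_intermediateSum y hb hc hbc hZ,
    flagDiff_intermediateSum y hc ha hac.symm hZ, flagDiff_intermediateSum y ha hb hab hZ]
  ring

theorem killedByTriples_properSubsetSum {k : ℕ} :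
    ∀ (X : Finset ι) (f : Finset ι → Finset ι → R), KilledByTriples k X (properSubsetSum f) := by
  induction k with
  | zero =>
    intro X f
    simp [KilledByTriples, properSubsetSum]
  | succ k ih =>
    intro X f a ha b hb c hc hab hac hbc
    refine (ih _ (tripleDiff a b c f)).congr fun S Z hS _ hZ _ => ?_
    exact (tripleDiff_properSubsetSum f (fun h => by simpa using hS (hZ h))
      (fun h => by simpa using hS (hZ h)) (fun h => by simpa using hS (hZ h))).symm

theorem killed_properSubsetSum {m k : ℕ} :
    ∀ (X : Finset ι) (f : Finset ι → Finset ι → R), Killed m k X (properSubsetSum f) := by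
  induction m with
  | zero => exact killedByTriples_properSubsetSum
  | succ m ih =>
    intro X f a ha b hb hab
    rw [pairDiff_properSubsetSum]
    exact ih _ _

theorem killedByTriples_intermediateSum {k : ℕ} :
    ∀ (X : Finset ι) (y : Finset ι → Finset ι → R), KilledByTriples k X (intermediateSum y) := by
  induction k with
  | zero =>
    intro X f
    simp [KilledByTriples, intermediateSum]
  | succ k ih =>
    intro X f a ha b hb c hc hab hac hbc
    refine (ih _ (tripleDiff a b c f)).congr fun S Z hS _ hZ _ => ?_
    exact (tripleDiff_intermediateSum f (fun h => by simpa using hS h)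
      (fun h => by simpa using hS h) (fun h => by simpa using hS h) hab hac hbc hZ).symm

theorem killed_intermediateSum {m k : ℕ} :
    ∀ (X : Finset ι) (y : Finset ι → Finset ι → R), Killed m k X (intermediateSum y) := by
  induction m with
  | zero => exact killedByTriples_intermediateSum
  | succ m ih =>
    intro X f a ha b hb hab
    refine (ih _ (pairDiff a b f)).congr fun S Z hS _ hZ _ => ?_
    exact (pairDiff_intermediateSum f (fun h => by simpa using hS h)
      (fun h => by simpa using hS h) hZ).symm

end Killing

section Representable

variable {ι R : Type} [CommRing R]

theorem properSubsetSum_add (f g : Finset ι → Finset ι → R) :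
    properSubsetSum (f + g) = properSubsetSum f + properSubsetSum g := by
  funext S Z
  simp only [properSubsetSum, Pi.add_apply, Finset.sum_add_distrib]
  ring

theorem properSubsetSum_eq_zero {f : Finset ι → Finset ι → R} {S : Finset ι} (h : ∀ Y, f S Y = 0)
    (Z : Finset ι) : properSubsetSum f S Z = 0 := by
  simp [properSubsetSum, h]

variable [DecidableEq ι]

theorem intermediateSum_add (y z : Finset ι → Finset ι → R) :
    intermediateSum (y + z) = intermediateSum y + intermediateSum z := by
  funext S Z
  have e : ∀ K, (if Z ⊆ K then y K Z + z K Z else 0) =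
      (if Z ⊆ K then y K Z else 0) + (if Z ⊆ K then z K Z else 0) := fun K => by
    split_ifs <;> simp
  simp only [intermediateSum, Pi.add_apply, e, Finset.sum_add_distrib]
  ring

/-- On flags `Z ⊆ S ⊆ X` with `|S| = q`, `|Z| = k`, the function `t` is a combination of a
`properSubsetSum` and an `intermediateSum`. -/
def Representable (q k : ℕ) (X : Finset ι) (t : Finset ι → Finset ι → R) : Prop :=
  ∃ f y : Finset ι → Finset ι → R, AgreeOn q k X t (properSubsetSum f + intermediateSum y)

theorem Representable.of_sub {q k : ℕ} {X : Finset ι} {t : Finset ι → Finset ι → R}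
    (f y : Finset ι → Finset ι → R)
    (h : Representable q k X (t - properSubsetSum f - intermediateSum y)) :
    Representable q k X t := by
  obtain ⟨f', y', h⟩ := h
  refine ⟨f' + f, y' + y, fun S Z hS hq hZ hk => ?_⟩
  have := h S Z hS hq hZ hk
  rw [properSubsetSum_add, intermediateSum_add]
  simp only [Pi.sub_apply, Pi.add_apply] at this ⊢
  linear_combination this

theorem representable_of_eq_zero {q k : ℕ} {X : Finset ι} {t : Finset ι → Finset ι → R}
    (h : ∀ S Z, S ⊆ X → S.card = q → Z ⊆ S → Z.card = k → t S Z = 0) :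
    Representable q k X t :=
  ⟨0, 0, fun S Z hS hq hZ hk => by
    simp [h S Z hS hq hZ hk, properSubsetSum, intermediateSum]⟩

theorem sum_powerset_ite_disjoint (Z Z₀ : Finset ι) :
    ∑ Y ∈ Z.powerset, (if Disjoint Y Z₀ then (-1 : R) ^ Y.card else 0) =
      if Z ⊆ Z₀ then 1 else 0 := by
  rw [← Finset.sum_filter]
  have : Z.powerset.filter (fun Y => Disjoint Y Z₀) = (Z \ Z₀).powerset := by
    ext Y
    simp only [Finset.mem_filter, Finset.mem_powerset, Finset.subset_sdiff]
  rw [this]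
  have := congrArg (Int.cast : ℤ → R) (Finset.sum_powerset_neg_one_pow_card (x := Z \ Z₀))
  simp only [Finset.sdiff_eq_empty_iff_subset] at this
  push_cast at this
  rw [this]

theorem sum_powerset_ite_inter (S S₀ Z : Finset ι) (hZ : Z ⊆ S) (hZ₀ : Z ⊆ S₀) :
    ∑ K ∈ S.powerset, (if Z ⊆ K then if K ∩ S₀ ⊆ Z then (-1 : R) ^ (K \ Z).card else 0 else 0) =
      if S ⊆ S₀ then 1 else 0 := by
  have h := sum_powerset_ite_disjoint (R := R) S S₀
  rw [← h, ← Finset.sum_filter, ← Finset.sum_filter, ← Finset.sum_filter, Finset.filter_filter]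
  refine Finset.sum_bij' (fun K _ => K \ Z) (fun Y _ => Z ∪ Y) ?_ ?_ ?_ ?_ ?_
  · intro K hK
    simp only [Finset.mem_filter, Finset.mem_powerset] at hK ⊢
    refine ⟨Finset.sdiff_subset.trans hK.1, Finset.disjoint_left.mpr fun x hx hx₀ => ?_⟩
    rw [Finset.mem_sdiff] at hx
    exact hx.2 (hK.2.2 (Finset.mem_inter.mpr ⟨hx.1, hx₀⟩))
  · intro Y hY
    simp only [Finset.mem_filter, Finset.mem_powerset] at hY ⊢
    refine ⟨Finset.union_subset hZ hY.1, Finset.subset_union_left, fun x hx => ?_⟩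
    rw [Finset.mem_inter, Finset.mem_union] at hx
    exact hx.1.resolve_right fun h => Finset.disjoint_left.mp hY.2 h hx.2
  · intro K hK
    simp only [Finset.mem_filter, Finset.mem_powerset] at hK
    exact Finset.union_sdiff_of_subset hK.2.1
  · intro Y hY
    simp only [Finset.mem_filter, Finset.mem_powerset] at hY
    rw [Finset.union_sdiff_left, Finset.sdiff_eq_self_of_disjoint]
    exact hY.2.mono_right hZ₀
  · intro K hK
    rfl

theorem exists_agreeOn_intermediateSum {q k : ℕ} {X : Finset ι} (hX : X.card + k < 2 * q)
    (t : Finset ι → Finset ι → R) : ∃ y, AgreeOn q k X t (intermediateSum y) := by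
  refine ⟨fun K Z => ∑ S₀ ∈ X.powersetCard q, if Z ⊆ S₀ then
    (if K ∩ S₀ ⊆ Z then (-1 : R) ^ (K \ Z).card else 0) * t S₀ Z else 0, ?_⟩
  intro S Z hS hq hZ hk
  unfold intermediateSum
  dsimp only
  rw [Finset.sum_eq_zero (s := X.powersetCard q), sub_zero]
  · have e : ∀ K, (if Z ⊆ K then ∑ S₀ ∈ X.powersetCard q, (if Z ⊆ S₀ then
        (if K ∩ S₀ ⊆ Z then (-1 : R) ^ (K \ Z).card else 0) * t S₀ Z else 0) else 0) =
        ∑ S₀ ∈ X.powersetCard q, (if Z ⊆ S₀ then (if Z ⊆ K then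
        (if K ∩ S₀ ⊆ Z then (-1 : R) ^ (K \ Z).card else 0) else 0) * t S₀ Z else 0) := fun K => by
      split_ifs
      · rfl
      · simp
    simp only [e]
    rw [Finset.sum_comm, Finset.sum_eq_single S]
    · simp only [if_pos hZ]
      rw [← Finset.sum_mul, sum_powerset_ite_inter S S Z hZ hZ]
      simp
    · intro S₀ hS₀ hne
      by_cases hZ₀ : Z ⊆ S₀
      · simp only [if_pos hZ₀]
        rw [← Finset.sum_mul, sum_powerset_ite_inter S S₀ Z hZ hZ₀, if_neg, zero_mul]
        intro h
        rw [Finset.mem_powersetCard] at hS₀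
        exact hne (Finset.eq_of_subset_of_card_le h (by omega)).symm
      · simp [hZ₀]
    · intro h
      exact absurd (Finset.mem_powersetCard.mpr ⟨hS, hq⟩) h
  · intro S₀ hS₀
    rw [Finset.mem_powersetCard] at hS₀
    have : ¬ S ∩ S₀ ⊆ Z := fun h => by
      have h1 := Finset.card_le_card h
      have h2 := Finset.card_union_add_card_inter S S₀
      have h3 := Finset.card_le_card (Finset.union_subset hS hS₀.1)
      omega
    simp [this]

theorem exists_eq_properSubsetSum (k : ℕ) (h : Finset ι → Finset ι → R) :
    ∃ f : Finset ι → Finset ι → R, ∀ S Z, S.card < 2 * k → Z ⊆ S → Z.card = k →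
      h S Z = properSubsetSum f S Z := by
  refine ⟨fun S Y => ∑ Z₀ ∈ S.powersetCard k,
    (if Disjoint Y Z₀ then (-1 : R) ^ Y.card else 0) * h S Z₀, ?_⟩
  intro S Z hS hZ hk
  unfold properSubsetSum
  dsimp only
  rw [Finset.sum_eq_zero (s := S.powersetCard k), sub_zero]
  · rw [Finset.sum_comm, Finset.sum_eq_single Z]
    · rw [← Finset.sum_mul, sum_powerset_ite_disjoint]
      simp
    · intro Z₀ hZ₀ hne
      rw [← Finset.sum_mul, sum_powerset_ite_disjoint, if_neg, zero_mul]
      intro h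
      rw [Finset.mem_powersetCard] at hZ₀
      exact hne (Finset.eq_of_subset_of_card_le h (by omega)).symm
    · intro h
      exact absurd (Finset.mem_powersetCard.mpr ⟨hZ, hk⟩) h
  · intro Z₀ hZ₀
    rw [Finset.mem_powersetCard] at hZ₀
    rw [if_neg, zero_mul]
    intro hd
    have h1 := Finset.card_union_of_disjoint hd
    have h2 := Finset.card_le_card (Finset.union_subset hZ hZ₀.1)
    omega

theorem intermediateSum_eq_zero {y : Finset ι → Finset ι → R} {S Z : Finset ι}
    (h : ∀ K ⊆ S, y K Z = 0) : intermediateSum y S Z = 0 := by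
  unfold intermediateSum
  rw [h S (Finset.Subset.refl S), Finset.sum_eq_zero, sub_zero]
  intro K hK
  rw [h K (Finset.mem_powerset.mp hK), ite_self]

theorem flag_subset_insert {a : ι} {X S : Finset ι} (hS : S ⊆ insert a X) :
    S ⊆ X ∨ ∃ S', a ∉ S' ∧ S' ⊆ X ∧ S = insert a S' := by
  by_cases ha : a ∈ S
  · refine Or.inr ⟨S.erase a, Finset.notMem_erase _ _, ?_, (Finset.insert_erase ha).symm⟩
    rw [← Finset.subset_insert_iff]
    exact hS
  · exact Or.inl ((Finset.subset_insert_iff_of_notMem ha).mp hS)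

/-- A killed function on flags is a combination of a `properSubsetSum` and an
`intermediateSum`. -/
theorem Killed.representable (X : Finset ι) : ∀ (m k : ℕ) (t : Finset ι → Finset ι → R),
    Killed m k X t → Representable (m + 2 * k) k X t := by
  induction X using Finset.induction_on with
  | empty =>
    intro m k t ht
    refine representable_of_eq_zero fun S Z hS hq hZ hk => ?_
    rw [Finset.subset_empty] at hS
    subst hS
    rw [Finset.subset_empty] at hZ
    subst hZ
    rw [Finset.card_empty] at hq
    obtain ⟨rfl, rfl⟩ : m = 0 ∧ k = 0 := by omega
    exact ht
  | insert a X haX ih =>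
    intro m k t ht
    by_cases hsmall : (insert a X).card + k < 2 * (m + 2 * k)
    · obtain ⟨y, hy⟩ := exists_agreeOn_intermediateSum hsmall t
      exact ⟨0, y, fun S Z hS hq hZ hk => by
        rw [hy S Z hS hq hZ hk]; simp [properSubsetSum]⟩
    rw [Finset.card_insert_of_notMem haX] at hsmall
    -- remove the part away from `a`
    obtain ⟨f₁, y₁, h₁⟩ := ih m k t (ht.mono (Finset.subset_insert _ _))
    refine Representable.of_sub (fun S Y => if a ∈ S then 0 else f₁ S Y)
      (fun K Z => if a ∈ K then 0 else y₁ K Z) ?_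
    have ht₁ := (ht.sub (killed_properSubsetSum _ fun S Y => if a ∈ S then 0 else f₁ S Y)).sub
      (killed_intermediateSum _ fun K Z => if a ∈ K then 0 else y₁ K Z)
    have hv₁ : ∀ S Z, S ⊆ X → S.card = m + 2 * k → Z ⊆ S → Z.card = k →
        (t - properSubsetSum (fun S Y => if a ∈ S then 0 else f₁ S Y) -
          intermediateSum (fun K Z => if a ∈ K then 0 else y₁ K Z)) S Z = 0 := by
      intro S Z hS hq hZ hk
      have haS : a ∉ S := fun h => haX (hS h)
      simp only [Pi.sub_apply, h₁ S Z hS hq hZ hk, Pi.add_apply]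
      have e₁ : properSubsetSum (fun S Y => if a ∈ S then 0 else f₁ S Y) S Z =
          properSubsetSum f₁ S Z := by simp [properSubsetSum, haS]
      have e₂ : intermediateSum (fun K Z => if a ∈ K then 0 else y₁ K Z) S Z =
          intermediateSum y₁ S Z := by
        unfold intermediateSum
        dsimp only
        rw [if_neg haS]
        congr 1
        refine Finset.sum_congr rfl fun K hK => ?_
        rw [if_neg (fun h => haS (Finset.mem_powerset.mp hK h))]
      rw [e₁, e₂]
      ring
    generalize t - properSubsetSum (fun S Y => if a ∈ S then 0 else f₁ S Y) -
      intermediateSum (fun K Z => if a ∈ K then 0 else y₁ K Z) = t₁ at ht₁ hv₁ ⊢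
    -- remove the flags `(S, Z)` with `a ∈ S`, `a ∉ Z`
    obtain ⟨f₂, y₂, h₂⟩ : ∃ f₂ y₂ : Finset ι → Finset ι → R, ∀ S Z, S ⊆ X →
        S.card + 1 = m + 2 * k → Z ⊆ S → Z.card = k →
        t₁ (insert a S) Z = properSubsetSum f₂ S Z + intermediateSum y₂ S Z := by
      rcases m with _ | m
      · obtain ⟨f, hf⟩ := exists_eq_properSubsetSum k fun S Z => t₁ (insert a S) Z
        refine ⟨f, 0, fun S Z _ hq hZ hk => ?_⟩
        rw [hf S Z (by omega) hZ hk]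
        simp [intermediateSum]
      · obtain ⟨f, y, hfy⟩ := ih m k (fun S Z => t₁ (insert a S) Z) (by
          refine Killed.of_erase (by omega) fun b hb => ?_
          have hab : a ≠ b := fun h => haX (h ▸ hb)
          have := ht₁ a (Finset.mem_insert_self _ _) b (Finset.mem_insert_of_mem hb) hab
          rw [Finset.erase_insert haX] at this
          refine this.congr fun S Z hS hq hZ hk => ?_
          have hbS : b ∉ S := fun h => by simpa using hS h
          unfold pairDiff
          rw [hv₁ (insert b S) Z (Finset.insert_subset hb (hS.trans (Finset.erase_subset _ _)))
            (by rw [Finset.card_insert_of_notMem hbS]; omega)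
            (hZ.trans (Finset.subset_insert _ _)) hk, sub_zero])
        exact ⟨f, y, fun S Z hS hq hZ hk => hfy S Z hS (by omega) hZ hk⟩
    refine Representable.of_sub
      (fun S Y => if a ∈ S ∧ a ∉ Y then f₂ (S.erase a) Y else 0)
      (fun K Z => if a ∈ K ∧ a ∉ Z then y₂ (K.erase a) Z else 0) ?_
    have ht₂ := (ht₁.sub (killed_properSubsetSum _
        fun S Y => if a ∈ S ∧ a ∉ Y then f₂ (S.erase a) Y else 0)).sub
      (killed_intermediateSum _ fun K Z => if a ∈ K ∧ a ∉ Z then y₂ (K.erase a) Z else 0)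
    have hv₂ : ∀ S Z, S ⊆ insert a X → S.card = m + 2 * k → Z ⊆ S → Z.card = k → a ∉ Z →
        (t₁ - properSubsetSum (fun S Y => if a ∈ S ∧ a ∉ Y then f₂ (S.erase a) Y else 0) -
          intermediateSum (fun K Z => if a ∈ K ∧ a ∉ Z then y₂ (K.erase a) Z else 0)) S Z =
          0 := by
      intro S Z hS hq hZ hk haZ
      rcases flag_subset_insert hS with hS | ⟨S', haS', hS', rfl⟩
      · have haS : a ∉ S := fun h => haX (hS h)
        simp only [Pi.sub_apply]
        rw [hv₁ S Z hS hq hZ hk, properSubsetSum_eq_zero (by simp [haS]),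
          intermediateSum_eq_zero (by intro K hK; exact if_neg fun h => haS (hK h.1))]
        simp
      · have hZ' : Z ⊆ S' := (Finset.subset_insert_iff_of_notMem haZ).mp hZ
        rw [Finset.card_insert_of_notMem haS'] at hq
        simp only [Pi.sub_apply]
        rw [h₂ S' Z hS' hq hZ' hk]
        have e₁ : properSubsetSum (fun S Y => if a ∈ S ∧ a ∉ Y then f₂ (S.erase a) Y else 0)
            (insert a S') Z = properSubsetSum f₂ S' Z := by
          unfold properSubsetSum
          simp only [Finset.mem_insert_self, true_and, Finset.erase_insert haS', haZ,
            not_false_eq_true, if_true]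
          congr 1
          refine Finset.sum_congr rfl fun Y hY => ?_
          rw [if_pos fun h => haZ (Finset.mem_powerset.mp hY h)]
        have e₂ : intermediateSum (fun K Z => if a ∈ K ∧ a ∉ Z then y₂ (K.erase a) Z else 0)
            (insert a S') Z = intermediateSum y₂ S' Z := by
          unfold intermediateSum
          rw [Finset.sum_powerset_insert haS', Finset.sum_eq_zero, zero_add]
          · simp only [Finset.mem_insert_self, true_and, Finset.erase_insert haS', haZ,
              not_false_eq_true, if_true, Finset.subset_insert_iff_of_notMem haZ]
            congr 1
            refine Finset.sum_congr rfl fun K hK => ?_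
            rw [Finset.erase_insert fun h => haS' (Finset.mem_powerset.mp hK h)]
          · intro K hK
            dsimp only
            rw [if_neg (fun h : a ∈ K ∧ a ∉ Z => haS' (Finset.mem_powerset.mp hK h.1)), ite_self]
        rw [e₁, e₂]
        ring
    generalize t₁ - properSubsetSum (fun S Y => if a ∈ S ∧ a ∉ Y then f₂ (S.erase a) Y else 0) -
      intermediateSum (fun K Z => if a ∈ K ∧ a ∉ Z then y₂ (K.erase a) Z else 0) = t₂ at ht₂ hv₂ ⊢
    -- what remains is supported on flags with `a ∈ Z`
    rcases k with _ | k
    · refine representable_of_eq_zero fun S Z hS hq hZ hk => hv₂ S Z hS hq hZ hk ?_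
      rw [Finset.card_eq_zero] at hk
      simp [hk]
    · obtain ⟨f₃, y₃, h₃⟩ := ih (m + 1) k (fun S Z => t₂ (insert a S) (insert a Z)) (by
        intro c hc b hb hcb
        have hab : a ≠ b := fun h => haX (h ▸ hb)
        have hac : a ≠ c := fun h => haX (h ▸ hc)
        have := ht₂.triple (Finset.mem_insert_self _ _) (Finset.mem_insert_of_mem hb)
          (Finset.mem_insert_of_mem hc) hab hac hcb.symm
        rw [Finset.erase_insert haX, Finset.erase_right_comm] at this
        refine this.congr fun S Z hS hq hZ hk => ?_
        have hbS : b ∉ S := fun h => by simpa using hS h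
        have hcS : c ∉ S := fun h => by simpa using hS h
        have hSX : S ⊆ X := hS.trans ((Finset.erase_subset _ _).trans (Finset.erase_subset _ _))
        have haS : a ∉ S := fun h => haX (hSX h)
        have haZ : a ∉ Z := fun h => haS (hZ h)
        have hbZ : b ∉ Z := fun h => hbS (hZ h)
        have hcZ : c ∉ Z := fun h => hcS (hZ h)
        have v : ∀ u v w, u ∈ insert a X → v ∈ insert a X → u ∉ S → v ∉ S → u ≠ v → w ∉ Z →
            w ∈ insert u (insert v S) → a ≠ w → t₂ (insert u (insert v S)) (insert w Z) = 0 := by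
          intro u v w hu hv huS hvS huv hwZ hw haw
          refine hv₂ _ _ ?_ ?_ ?_ ?_ ?_
          · exact Finset.insert_subset hu (Finset.insert_subset hv
              (hSX.trans (Finset.subset_insert _ _)))
          · rw [Finset.card_insert_of_notMem (by simp [huv, huS]),
              Finset.card_insert_of_notMem hvS]
            omega
          · exact Finset.insert_subset hw (hZ.trans ((Finset.subset_insert _ _).trans
              (Finset.subset_insert _ _)))
          · rw [Finset.card_insert_of_notMem hwZ, hk]
          · simp [haw, haZ]
        have ha' : a ∈ insert a X := Finset.mem_insert_self _ _
        have hb' : b ∈ insert a X := Finset.mem_insert_of_mem hb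
        have hc' : c ∈ insert a X := Finset.mem_insert_of_mem hc
        unfold tripleDiff flagDiff pairDiff
        rw [v b c c hb' hc' hbS hcS hcb.symm hcZ (by simp) hac,
          v b c b hb' hc' hbS hcS hcb.symm hbZ (by simp) hab,
          v c a c hc' ha' hcS haS hac.symm hcZ (by simp) hac,
          v a b b ha' hb' haS hbS hab hbZ (by simp) hab, Finset.insert_comm c a S]
        ring)
      refine ⟨fun S Y => if a ∈ Y ∧ a ∈ S then f₃ (S.erase a) (Y.erase a) else 0,
        fun K Z => if a ∈ Z ∧ a ∈ K then y₃ (K.erase a) (Z.erase a) else 0, ?_⟩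
      intro S Z hS hq hZ hk
      simp only [Pi.add_apply]
      by_cases haZ : a ∈ Z
      · obtain ⟨S', haS', rfl⟩ : ∃ S', a ∉ S' ∧ S = insert a S' :=
          ⟨S.erase a, Finset.notMem_erase _ _, (Finset.insert_erase (hZ haZ)).symm⟩
        obtain ⟨Z', haZ', rfl⟩ : ∃ Z', a ∉ Z' ∧ Z = insert a Z' :=
          ⟨Z.erase a, Finset.notMem_erase _ _, (Finset.insert_erase haZ).symm⟩
        have hS' : S' ⊆ X := by
          intro x hx
          have := hS (Finset.mem_insert_of_mem hx)
          rw [Finset.mem_insert] at this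
          exact this.resolve_left fun h => haS' (h ▸ hx)
        have hZ' : Z' ⊆ S' := by
          intro x hx
          have := hZ (Finset.mem_insert_of_mem hx)
          rw [Finset.mem_insert] at this
          exact this.resolve_left fun h => haZ' (h ▸ hx)
        rw [Finset.card_insert_of_notMem haS'] at hq
        rw [Finset.card_insert_of_notMem haZ'] at hk
        refine (h₃ S' Z' hS' (by omega) hZ' (by omega)).trans ?_
        simp only [Pi.add_apply]
        congr 1
        · unfold properSubsetSum
          rw [Finset.sum_powerset_insert haZ', Finset.sum_eq_zero (s := Z'.powerset)
            (f := fun Y => if a ∈ Y ∧ a ∈ insert a S' then _ else _), zero_add]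
          · simp only [Finset.mem_insert_self, and_self, if_true, Finset.erase_insert haS',
              Finset.erase_insert haZ']
            congr 1
            refine Finset.sum_congr rfl fun Y hY => ?_
            rw [Finset.erase_insert fun h => haZ' (Finset.mem_powerset.mp hY h)]
          · intro Y hY
            exact if_neg fun h => haZ' (Finset.mem_powerset.mp hY h.1)
        · unfold intermediateSum
          rw [Finset.sum_powerset_insert haS', Finset.sum_eq_zero (s := S'.powerset)
            (f := fun K => if insert a Z' ⊆ K then _ else _), zero_add]
          · simp only [Finset.mem_insert_self, and_self, if_true, Finset.erase_insert haS',
              Finset.erase_insert haZ']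
            congr 1
            refine Finset.sum_congr rfl fun K hK => ?_
            have haK : a ∉ K := fun h => haS' (Finset.mem_powerset.mp hK h)
            rw [Finset.erase_insert haK]
            refine if_congr ?_ rfl rfl
            rw [Finset.insert_subset_iff, Finset.subset_insert_iff_of_notMem haZ']
            simp
          · intro K hK
            exact if_neg fun h => haS' (Finset.mem_powerset.mp hK (h (Finset.mem_insert_self _ _)))
      · rw [hv₂ S Z hS hq hZ hk haZ]
        rw [intermediateSum_eq_zero (by intro K _; exact if_neg fun h => haZ h.1)]
        unfold properSubsetSum
        dsimp only
        rw [if_neg (fun h => haZ h.1), Finset.sum_eq_zero]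
        · simp
        · intro Y hY
          exact if_neg fun h => haZ (Finset.mem_powerset.mp hY h.1)

end Representable

section Family

variable {F A V : Type} [Field F] [Ring A] [Algebra F A] [AddCommGroup V] [Module F V]
  [Module A V] [IsScalarTower F A V]

/-- The data from which a one-parameter family of pairwise orthogonal modules is built: two
cyclic submodules `M = A • P` and `T = A • δ` of `V`, a submodule `I` of `M`, an embedding `ι` of
`M` into `V` and an endomorphism `θ` of `M`. -/
structure GluingData (F A V : Type) [Field F] [Ring A] [Algebra F A] [AddCommGroup V] [Module F V]
    [Module A V] where
  M : Submodule A V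
  T : Submodule A V
  I : Submodule A V
  ι : V →ₗ[A] V
  θ : V →ₗ[A] V
  P : V
  δ : V
  I_le : I ≤ M
  P_mem : P ∈ M
  δ_mem : δ ∈ T
  M_le : M ≤ Submodule.span A {P}
  T_le : T ≤ Submodule.span A {δ}
  θ_mem : ∀ w ∈ M, θ w ∈ M
  ι_inj : ∀ w ∈ M, ι w = 0 → w = 0

namespace GluingData

variable (D : GluingData F A V)

/-- The relations identifying `ι w ∈ T` with `w + τ θ w`, and killing `I`. -/
def relations (τ : F) : Submodule A (V × V) where
  carrier := {z | ∃ i ∈ D.I, ∃ w ∈ D.M, D.ι w ∈ D.T ∧ z = (i + w + τ • D.θ w, -D.ι w)}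
  add_mem' := by
    rintro _ _ ⟨i, hi, w, hw, hT, rfl⟩ ⟨i', hi', w', hw', hT', rfl⟩
    refine ⟨i + i', add_mem hi hi', w + w', add_mem hw hw', ?_, ?_⟩
    · rw [map_add]
      exact add_mem hT hT'
    · ext
      · simp only [Prod.mk_add_mk, map_add, smul_add]
        abel
      · simp only [Prod.mk_add_mk, map_add]
        abel
  zero_mem' := ⟨0, zero_mem _, 0, zero_mem _, by simp, by simp; rfl⟩
  smul_mem' := by
    rintro a _ ⟨i, hi, w, hw, hT, rfl⟩
    refine ⟨a • i, D.I.smul_mem a hi, a • w, D.M.smul_mem a hw, ?_, ?_⟩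
    · rw [map_smul]
      exact D.T.smul_mem a hT
    · ext
      · simp only [Prod.smul_mk, map_smul, smul_add, smul_comm τ a]
      · simp only [Prod.smul_mk, map_smul, smul_neg]

/-- The glued module with parameter `τ`. -/
def family (τ : F) : Submodule A ((V × V) ⧸ D.relations τ) :=
  (D.M.prod D.T).map (D.relations τ).mkQ

variable {D} {σ τ : F}

/-- The class of a pair in the glued module. -/
def pair (τ : F) {m t : V} (hm : m ∈ D.M) (ht : t ∈ D.T) : D.family τ :=
  ⟨(D.relations τ).mkQ (m, t), Submodule.mem_map_of_mem ⟨hm, ht⟩⟩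

theorem exists_eq_pair (x : D.family τ) : ∃ (m t : V) (hm : m ∈ D.M) (ht : t ∈ D.T),
    x = pair τ hm ht := by
  obtain ⟨x, hx⟩ := x
  obtain ⟨⟨m, t⟩, ⟨hm, ht⟩, rfl⟩ := hx
  exact ⟨m, t, hm, ht, rfl⟩

theorem pair_eq_iff {m t m' t' : V} {hm : m ∈ D.M} {ht : t ∈ D.T} {hm' : m' ∈ D.M}
    {ht' : t' ∈ D.T} : pair τ hm ht = pair τ hm' ht' ↔
      ∃ i ∈ D.I, ∃ w ∈ D.M, D.ι w ∈ D.T ∧ m - m' = i + w + τ • D.θ w ∧ t - t' = -D.ι w := by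
  refine Subtype.ext_iff.trans ?_
  change (D.relations τ).mkQ (m, t) = (D.relations τ).mkQ (m', t') ↔ _
  rw [Submodule.mkQ_apply, Submodule.mkQ_apply, Submodule.Quotient.eq]
  simp only [relations, Submodule.mem_mk, AddSubmonoid.mem_mk, AddSubsemigroup.mem_mk,
    Set.mem_ofPred_eq, Prod.mk_sub_mk, Prod.mk.injEq]

theorem smul_pair (a : A) {m t : V} (hm : m ∈ D.M) (ht : t ∈ D.T) :
    a • pair τ hm ht = pair τ (D.M.smul_mem a hm) (D.T.smul_mem a ht) := rfl

theorem scalar_smul_pair (c : F) {m t : V} (hm : m ∈ D.M) (ht : t ∈ D.T) :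
    c • pair τ hm ht = pair τ (D.M.smul_of_tower_mem c hm) (D.T.smul_of_tower_mem c ht) := rfl

theorem pair_add_pair {m t m' t' : V} (hm : m ∈ D.M) (ht : t ∈ D.T) (hm' : m' ∈ D.M)
    (ht' : t' ∈ D.T) :
    pair τ hm ht + pair τ hm' ht' = pair τ (add_mem hm hm') (add_mem ht ht') := rfl

theorem pair_eq_zero_iff {m : V} {hm : m ∈ D.M} :
    pair τ hm D.T.zero_mem = 0 ↔ m ∈ D.I := by
  have h0 : (0 : D.family τ) = pair τ D.M.zero_mem D.T.zero_mem := rfl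
  rw [h0, pair_eq_iff]
  constructor
  · rintro ⟨i, hi, w, hw, -, h1, h2⟩
    have hw0 : w = 0 := D.ι_inj w hw (by simpa using h2.symm)
    rw [hw0] at h1
    simp only [sub_zero, add_zero, map_zero, smul_zero] at h1
    rwa [h1]
  · intro h
    exact ⟨m, h, 0, D.M.zero_mem, by simp, by simp, by simp⟩

theorem pair_ι (w : V) (hw : w ∈ D.M) (hT : D.ι w ∈ D.T) : pair τ D.M.zero_mem hT =
    pair τ (add_mem hw (D.M.smul_of_tower_mem τ (D.θ_mem w hw))) D.T.zero_mem := by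
  rw [pair_eq_iff]
  refine ⟨0, D.I.zero_mem, -w, neg_mem hw, ?_, ?_, ?_⟩
  · rw [map_neg]
    exact neg_mem hT
  · simp only [map_neg, smul_neg]
    abel
  · simp

/-- Conditions on gluing data making the glued modules pairwise orthogonal. -/
structure IsRigid (D : GluingData F A V) (K : Set A) (r π : A) (e v : V) : Prop where
  fixes : ∀ k ∈ K, k • D.P = D.P
  mem_range : ∀ t ∈ D.T, (∀ k ∈ K, ∃ w ∈ D.M, k • t - t = D.ι w) → ∃ w ∈ D.M, t = D.ι w
  smul_P_mem : r • D.P ∈ D.I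
  eq_smul_P : ∀ z ∈ D.M, (∀ k ∈ K, k • z - z ∈ D.I) → r • z ∈ D.I → ∃ c : F, z - c • D.P ∈ D.I
  smul_δ : π • D.δ = D.δ
  smul_M : ∀ m ∈ D.M, π • m = 0
  smul_T : ∀ t ∈ D.T, ∃ x : F, π • t = x • D.δ
  e_mem : e ∈ D.M
  ι_e_mem : D.ι e ∈ D.T
  θ_e : D.θ e = 0
  e_notMem : e ∉ D.I
  v_mem : v ∈ D.M
  ι_v_mem : D.ι v ∈ D.T
  θ_v_notMem : D.θ v ∉ D.I

namespace IsRigid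

variable {K : Set A} {r π : A} {e v : V}

theorem exists_map_P (h : IsRigid D K r π e v) (f : D.family σ →ₗ[A] D.family τ) :
    ∃ c : F, f (pair σ D.P_mem D.T.zero_mem) = c • pair τ D.P_mem D.T.zero_mem := by
  obtain ⟨m, t, hm, ht, hf⟩ := exists_eq_pair (f (pair σ D.P_mem D.T.zero_mem))
  have hfix : ∀ k ∈ K, k • f (pair σ D.P_mem D.T.zero_mem) = f (pair σ D.P_mem D.T.zero_mem) := by
    intro k hk
    rw [← map_smul, smul_pair]
    congr 1
    rw [pair_eq_iff]
    refine ⟨0, D.I.zero_mem, 0, D.M.zero_mem, by simp, ?_, ?_⟩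
    · simp [h.fixes k hk]
    · simp
  obtain ⟨w, hw, rfl⟩ := h.mem_range t ht fun k hk => by
    have := hfix k hk
    rw [hf, smul_pair, pair_eq_iff] at this
    obtain ⟨i, -, w, hw, -, -, h2⟩ := this
    exact ⟨-w, neg_mem hw, by rw [h2, map_neg]⟩
  obtain ⟨z, hz, hf⟩ : ∃ (z : V) (hz : z ∈ D.M),
      f (pair σ D.P_mem D.T.zero_mem) = pair τ hz D.T.zero_mem := by
    refine ⟨m + (w + τ • D.θ w),
      add_mem hm (add_mem hw (D.M.smul_of_tower_mem τ (D.θ_mem w hw))), ?_⟩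
    rw [hf, pair_eq_iff]
    refine ⟨0, D.I.zero_mem, -w, neg_mem hw, ?_, ?_, ?_⟩
    · rw [map_neg]
      exact neg_mem ht
    · simp only [map_neg, smul_neg]
      abel
    · simp
  obtain ⟨c, hc⟩ := h.eq_smul_P z hz (fun k hk => by
    have := hfix k hk
    rw [hf, smul_pair, pair_eq_iff] at this
    obtain ⟨i, hi, w, hw, -, h1, h2⟩ := this
    have hw0 : w = 0 := D.ι_inj w hw (by simpa using h2.symm)
    rw [h1, hw0]
    simpa using hi) (by
    have h1 : r • pair σ D.P_mem D.T.zero_mem = 0 := by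
      have := (pair_eq_zero_iff (τ := σ) (hm := D.M.smul_mem r D.P_mem)).mpr h.smul_P_mem
      rw [← this, smul_pair, pair_eq_iff]
      exact ⟨0, D.I.zero_mem, 0, D.M.zero_mem, by simp, by simp, by simp⟩
    have h2 := map_smul f r (pair σ D.P_mem D.T.zero_mem)
    rw [h1, map_zero, hf, smul_pair] at h2
    have := (pair_eq_zero_iff (τ := τ) (hm := D.M.smul_mem r hz)).mp (by
      rw [h2, pair_eq_iff]
      exact ⟨0, D.I.zero_mem, 0, D.M.zero_mem, by simp, by simp, by simp⟩)
    exact this)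
  refine ⟨c, ?_⟩
  rw [hf, scalar_smul_pair, pair_eq_iff]
  exact ⟨_, hc, 0, D.M.zero_mem, by simp, by simp, by simp⟩

theorem exists_map_M (h : IsRigid D K r π e v) (f : D.family σ →ₗ[A] D.family τ) :
    ∃ c : F, ∀ (m : V) (hm : m ∈ D.M),
      f (pair σ hm D.T.zero_mem) = c • pair τ hm D.T.zero_mem := by
  obtain ⟨c, hc⟩ := h.exists_map_P f
  refine ⟨c, fun m hm => ?_⟩
  obtain ⟨a, rfl⟩ := Submodule.mem_span_singleton.mp (D.M_le hm)
  have e : ∀ ρ : F, pair ρ hm D.T.zero_mem = a • pair ρ D.P_mem D.T.zero_mem := fun ρ => by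
    rw [smul_pair, pair_eq_iff]
    exact ⟨0, D.I.zero_mem, 0, D.M.zero_mem, by simp, by simp, by simp⟩
  rw [e, e, map_smul, hc, smul_comm]

theorem exists_map_T (h : IsRigid D K r π e v) (f : D.family σ →ₗ[A] D.family τ) :
    ∃ x : F, ∀ (t : V) (ht : t ∈ D.T),
      f (pair σ D.M.zero_mem ht) = x • pair τ D.M.zero_mem ht := by
  obtain ⟨m, t, hm, ht, hf⟩ := exists_eq_pair (f (pair σ D.M.zero_mem D.δ_mem))
  obtain ⟨x, hx⟩ := h.smul_T t ht
  have hδ : f (pair σ D.M.zero_mem D.δ_mem) = x • pair τ D.M.zero_mem D.δ_mem := by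
    have : π • pair σ D.M.zero_mem D.δ_mem = pair σ D.M.zero_mem D.δ_mem := by
      rw [smul_pair, pair_eq_iff]
      exact ⟨0, D.I.zero_mem, 0, D.M.zero_mem, by simp, by simp, by simp [h.smul_δ]⟩
    rw [← this, map_smul, hf, smul_pair, scalar_smul_pair, pair_eq_iff]
    exact ⟨0, D.I.zero_mem, 0, D.M.zero_mem, by simp, by simp [h.smul_M m hm], by simp [hx]⟩
  refine ⟨x, fun t ht => ?_⟩
  obtain ⟨a, rfl⟩ := Submodule.mem_span_singleton.mp (D.T_le ht)
  have e : ∀ ρ : F, pair ρ D.M.zero_mem ht = a • pair ρ D.M.zero_mem D.δ_mem := fun ρ => by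
    rw [smul_pair, pair_eq_iff]
    exact ⟨0, D.I.zero_mem, 0, D.M.zero_mem, by simp, by simp, by simp⟩
  rw [e, e, map_smul, hδ, smul_comm]

theorem eq_zero (h : IsRigid D K r π e v) (hne : σ ≠ τ)
    (f : D.family σ →ₗ[A] D.family τ) : f = 0 := by
  obtain ⟨c, hc⟩ := h.exists_map_M f
  obtain ⟨x, hx⟩ := h.exists_map_T f
  have key : ∀ w ∈ D.M, D.ι w ∈ D.T →
      (x - c) • w + (x * τ - c * σ) • D.θ w ∈ D.I := by
    intro w hw hT
    have h1 := hx _ hT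
    have h2 := D.M.smul_of_tower_mem σ (D.θ_mem w hw)
    have h3 := D.M.smul_of_tower_mem τ (D.θ_mem w hw)
    rw [pair_ι w hw, pair_ι w hw, hc, scalar_smul_pair, scalar_smul_pair, pair_eq_iff] at h1
    obtain ⟨i, hi, w', hw', -, h4, h5⟩ := h1
    have hw0 : w' = 0 := D.ι_inj w' hw' (by simpa using h5.symm)
    rw [hw0] at h4
    simp only [add_zero, map_zero, smul_zero] at h4
    have : (x - c) • w + (x * τ - c * σ) • D.θ w = -i := by
      rw [← h4]
      simp only [smul_add, sub_smul, mul_smul]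
      abel
    rw [this]
    exact neg_mem hi
  have hxc : x = c := by
    by_contra hne'
    have h1 := key e h.e_mem h.ι_e_mem
    rw [h.θ_e, smul_zero, add_zero] at h1
    have h2 := D.I.smul_of_tower_mem (x - c)⁻¹ h1
    rw [smul_smul, inv_mul_cancel₀ (sub_ne_zero.mpr hne'), one_smul] at h2
    exact h.e_notMem h2
  have hc0 : c = 0 := by
    by_contra hne'
    have h1 := key v h.v_mem h.ι_v_mem
    rw [hxc, sub_self, zero_smul, zero_add, ← mul_sub] at h1
    have h2 := D.I.smul_of_tower_mem (c * (τ - σ))⁻¹ h1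
    rw [smul_smul, inv_mul_cancel₀ (mul_ne_zero hne' (sub_ne_zero.mpr hne.symm)), one_smul] at h2
    exact h.θ_v_notMem h2
  refine LinearMap.ext fun y => ?_
  obtain ⟨m, t, hm, ht, rfl⟩ := exists_eq_pair y
  have e : pair σ hm ht = pair σ hm D.T.zero_mem + pair σ D.M.zero_mem ht := by
    rw [pair_add_pair, pair_eq_iff]
    exact ⟨0, D.I.zero_mem, 0, D.M.zero_mem, by simp, by simp, by simp⟩
  rw [e, map_add, hc, hx, hxc, hc0, zero_smul, zero_smul, add_zero, LinearMap.zero_apply]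

theorem nontrivial (h : IsRigid D K r π e v) (τ : F) : Nontrivial (D.family τ) :=
  nontrivial_of_ne (pair τ h.e_mem D.T.zero_mem) 0 fun h0 =>
    h.e_notMem (pair_eq_zero_iff.mp h0)

theorem not_isSchurianFinite (h : IsRigid D K r π e v) [IsAlgClosed F]
    [FiniteDimensional F V] :
    ¬ IsSchurianFinite F A := by
  have := h.nontrivial
  have : ∀ τ, FiniteDimensional F (D.family τ) := fun τ =>
    FiniteDimensional.finiteDimensional_submodule ((D.family τ).restrictScalars F)
  exact not_isSchurianFinite_of_orthogonal (F := F) (A := A) (fun τ => D.family τ)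
    fun σ τ hne f => h.eq_zero hne f

end IsRigid

end GluingData

end Family

section FlagSpace

open scoped Pointwise
open MonoidAlgebra (single)

variable {F ι : Type} [Field F]

/-- The space of functions of two finite subsets of `ι`. -/
abbrev FlagSpace (F ι : Type) := Finset ι → Finset ι → F

section Pairing

variable [Fintype ι]

/-- The standard symmetric bilinear form on `FlagSpace F ι`. -/
def flagPairing : FlagSpace F ι →ₗ[F] FlagSpace F ι →ₗ[F] F :=
  LinearMap.mk₂ F (fun t s => ∑ S, ∑ Z, t S Z * s S Z)
    (fun t t' s => by simp [add_mul, Finset.sum_add_distrib])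
    (fun c t s => by simp [Finset.mul_sum, mul_assoc])
    (fun t s s' => by simp [mul_add, Finset.sum_add_distrib])
    (fun c t s => by simp [Finset.mul_sum, mul_left_comm])

theorem flagPairing_apply (t s : FlagSpace F ι) :
    flagPairing t s = ∑ S, ∑ Z, t S Z * s S Z := rfl

theorem flagPairing_comm (t s : FlagSpace F ι) : flagPairing t s = flagPairing s t := by
  simp only [flagPairing_apply, mul_comm]

end Pairing

variable [DecidableEq ι]

/-- The permutation representation on functions of pairs of subsets. -/
def flagRep (F ι : Type) [Field F] [DecidableEq ι] :
    Representation F (Equiv.Perm ι) (FlagSpace F ι) where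
  toFun g :=
    { toFun := fun t S Z => t (g⁻¹ • S) (g⁻¹ • Z)
      map_add' := fun _ _ => rfl
      map_smul' := fun _ _ => rfl }
  map_one' := by
    ext t S Z
    simp
  map_mul' g h := by
    ext t S Z
    simp [mul_smul]

theorem flagRep_apply (g : Equiv.Perm ι) (t : FlagSpace F ι) (S Z : Finset ι) :
    flagRep F ι g t S Z = t (g⁻¹ • S) (g⁻¹ • Z) := rfl

theorem flagRep_smul_smul (g : Equiv.Perm ι) (t : FlagSpace F ι) (S Z : Finset ι) :
    flagRep F ι g t (g • S) (g • Z) = t S Z := by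
  rw [flagRep_apply, inv_smul_smul, inv_smul_smul]

instance flagModule : Module (MonoidAlgebra F (Equiv.Perm ι)) (FlagSpace F ι) :=
  Module.compHom _ (flagRep F ι).asAlgebraHom.toRingHom

theorem flagModule_smul_def (a : MonoidAlgebra F (Equiv.Perm ι)) (t : FlagSpace F ι) :
    a • t = (flagRep F ι).asAlgebraHom a t := rfl

theorem single_smul_flag (g : Equiv.Perm ι) (c : F) (t : FlagSpace F ι) :
    single g c • t = c • flagRep F ι g t := by
  rw [flagModule_smul_def, Representation.asAlgebraHom_single]
  rfl

instance : IsScalarTower F (MonoidAlgebra F (Equiv.Perm ι)) (FlagSpace F ι) where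
  smul_assoc c a t := by
    rw [flagModule_smul_def, flagModule_smul_def, map_smul]
    rfl

/-- A linear map commuting with all permutations, as a module homomorphism. -/
def flagHom (φ : FlagSpace F ι →ₗ[F] FlagSpace F ι)
    (h : ∀ g t, φ (flagRep F ι g t) = flagRep F ι g (φ t)) :
    FlagSpace F ι →ₗ[MonoidAlgebra F (Equiv.Perm ι)] FlagSpace F ι where
  toFun := φ
  map_add' := φ.map_add
  map_smul' a t := by
    rw [RingHom.id_apply]
    induction a using MonoidAlgebra.induction_linear with
    | zero => simp
    | add x y hx hy => rw [add_smul, map_add, hx, hy, add_smul]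
    | single g c => rw [single_smul_flag, single_smul_flag, map_smul, h]

/-- A subspace stable under all permutations, as a submodule. -/
def flagSubmodule (N : Submodule F (FlagSpace F ι)) (h : ∀ g, ∀ t ∈ N, flagRep F ι g t ∈ N) :
    Submodule (MonoidAlgebra F (Equiv.Perm ι)) (FlagSpace F ι) where
  carrier := N
  add_mem' := N.add_mem
  zero_mem' := N.zero_mem
  smul_mem' a t ht := by
    induction a using MonoidAlgebra.induction_linear with
    | zero => simp
    | add x y hx hy =>
      rw [add_smul]
      exact N.add_mem hx hy
    | single g c =>
      rw [single_smul_flag]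
      exact N.smul_mem c (h g t ht)

/-- The indicator function of a pair of subsets. -/
def flagSingle (S Z : Finset ι) : FlagSpace F ι := fun S' Z' => if S' = S ∧ Z' = Z then 1 else 0

theorem flagRep_flagSingle (g : Equiv.Perm ι) (S Z : Finset ι) :
    flagRep F ι g (flagSingle S Z) = flagSingle (g • S) (g • Z) := by
  funext S' Z'
  simp only [flagRep_apply, flagSingle, inv_smul_eq_iff]

variable [Fintype ι]

theorem flagPairing_flagRep (g : Equiv.Perm ι) (t s : FlagSpace F ι) :
    flagPairing (flagRep F ι g t) (flagRep F ι g s) = flagPairing t s := by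
  simp only [flagPairing_apply, flagRep_apply]
  refine Fintype.sum_equiv (MulAction.toPerm g⁻¹) _ _ fun S => ?_
  exact Fintype.sum_equiv (MulAction.toPerm g⁻¹) _ _ fun Z => rfl

theorem flagPairing_flagSingle (t : FlagSpace F ι) (S Z : Finset ι) :
    flagPairing t (flagSingle S Z) = t S Z := by
  rw [flagPairing_apply, Finset.sum_eq_single S, Finset.sum_eq_single Z]
  · simp [flagSingle]
  · intro Z' _ h
    simp [flagSingle, h]
  · simp
  · intro S' _ h
    simp [flagSingle, h]
  · simp

theorem sum_smul_flagSingle (t : FlagSpace F ι) :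
    t = ∑ S, ∑ Z, t S Z • flagSingle S Z := by
  funext S Z
  simp only [Finset.sum_apply, Pi.smul_apply, flagSingle, smul_eq_mul]
  rw [Finset.sum_eq_single S, Finset.sum_eq_single Z]
  · simp
  · intro Z' _ h
    simp [Ne.symm h]
  · simp
  · intro S' _ h
    simp [Ne.symm h]
  · simp

theorem eq_flagPairing (φ : FlagSpace F ι →ₗ[F] F) :
    φ = flagPairing fun S Z => φ (flagSingle S Z) := by
  refine LinearMap.ext fun t => ?_
  conv_lhs => rw [sum_smul_flagSingle t]
  simp only [map_sum, map_smul, smul_eq_mul, flagPairing_apply, mul_comm]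

end FlagSpace

section FlagRing

open scoped Pointwise
open MonoidAlgebra (single)

/-- Pairs of subsets of `ι`, with union as multiplication. -/
@[ext]
structure SubsetPair (ι : Type) where
  fst : Finset ι
  snd : Finset ι

instance {ι : Type} [DecidableEq ι] : DecidableEq (SubsetPair ι) := fun _ _ =>
  decidable_of_iff _ SubsetPair.ext_iff.symm

variable {F ι : Type} [Field F]

variable (F ι) in
/-- The space of formal combinations of pairs of subsets. -/
abbrev FlagRing := MonoidAlgebra F (SubsetPair ι)

/-- Elements of the flag ring as functions. -/
def flagCoeff : FlagRing F ι →ₗ[F] FlagSpace F ι where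
  toFun r S Z := r.coeff ⟨S, Z⟩
  map_add' _ _ := rfl
  map_smul' _ _ := rfl

theorem flagCoeff_apply (r : FlagRing F ι) (S Z : Finset ι) : flagCoeff r S Z = r.coeff ⟨S, Z⟩ :=
  rfl

variable [DecidableEq ι]

instance : CommMonoid (SubsetPair ι) where
  mul a b := ⟨a.fst ∪ b.fst, a.snd ∪ b.snd⟩
  one := ⟨∅, ∅⟩
  mul_assoc a b c := SubsetPair.ext (Finset.union_assoc _ _ _) (Finset.union_assoc _ _ _)
  one_mul a := SubsetPair.ext (Finset.empty_union _) (Finset.empty_union _)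
  mul_one a := SubsetPair.ext (Finset.union_empty _) (Finset.union_empty _)
  mul_comm a b := SubsetPair.ext (Finset.union_comm _ _) (Finset.union_comm _ _)

theorem SubsetPair.mk_mul_mk (S Z S' Z' : Finset ι) :
    (⟨S, Z⟩ : SubsetPair ι) * ⟨S', Z'⟩ = ⟨S ∪ S', Z ∪ Z'⟩ := rfl

theorem SubsetPair.one_def : (1 : SubsetPair ι) = ⟨∅, ∅⟩ := rfl

/-- A permutation acting on pairs of subsets. -/
def SubsetPair.permHom (g : Equiv.Perm ι) : SubsetPair ι →* SubsetPair ι where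
  toFun a := ⟨g • a.fst, g • a.snd⟩
  map_one' := SubsetPair.ext (Finset.smul_finset_empty g) (Finset.smul_finset_empty g)
  map_mul' _ _ := SubsetPair.ext Finset.smul_finset_union Finset.smul_finset_union

/-- The action of a permutation on the flag ring. -/
def flagRingHom (g : Equiv.Perm ι) : FlagRing F ι →+* FlagRing F ι :=
  MonoidAlgebra.mapDomainRingHom F (SubsetPair.permHom g)

theorem flagRingHom_single (g : Equiv.Perm ι) (S Z : Finset ι) (c : F) :
    flagRingHom g (single ⟨S, Z⟩ c) = single ⟨g • S, g • Z⟩ c := by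
  simp [flagRingHom, SubsetPair.permHom]

theorem flagCoeff_single (S Z : Finset ι) (c : F) :
    flagCoeff (single ⟨S, Z⟩ c) = c • flagSingle S Z := by
  funext S' Z'
  rw [flagCoeff_apply, MonoidAlgebra.coeff_single, Finsupp.single_apply]
  simp only [SubsetPair.mk.injEq, Pi.smul_apply, flagSingle, smul_eq_mul, mul_ite, mul_one,
    mul_zero, eq_comm]

theorem flagCoeff_flagRingHom (g : Equiv.Perm ι) (r : FlagRing F ι) :
    flagCoeff (flagRingHom g r) = flagRep F ι g (flagCoeff r) := by
  induction r using MonoidAlgebra.induction_linear with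
  | zero => simp
  | add x y hx hy => simp only [map_add, hx, hy]
  | single f c =>
    obtain ⟨S, Z⟩ := f
    rw [flagRingHom_single, flagCoeff_single, flagCoeff_single, map_smul, flagRep_flagSingle]

end FlagRing

section FlagElements

open scoped Pointwise
open MonoidAlgebra (single)

variable {F ι : Type} [Field F] [DecidableEq ι]

/-- The element of the flag ring given by a point, not selected in the second subset. -/
def flagX (F : Type) [Field F] (a : ι) : FlagRing F ι := single ⟨{a}, ∅⟩ 1

/-- The element of the flag ring given by a point, selected in the second subset. -/
def flagY (F : Type) [Field F] (a : ι) : FlagRing F ι := single ⟨{a}, {a}⟩ 1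

/-- The difference of two points. -/
def pairElt (F : Type) [Field F] (a b : ι) : FlagRing F ι := flagX F a - flagX F b

/-- The exterior product of `flagX F a - flagX F b` and `flagX F c - flagX F d`. -/
def blockElt (F : Type) [Field F] (a b c d : ι) : FlagRing F ι :=
  (flagX F d - flagX F c) * (flagY F b - flagY F a)
    - (flagX F b - flagX F a) * (flagY F d - flagY F c)

/-- The element of the flag ring inducing `tripleDiff`. -/
def tripleElt (F : Type) [Field F] (a b c : ι) : FlagRing F ι :=
  (flagX F b * flagY F c - flagX F c * flagY F b)
    + (flagX F c * flagY F a - flagX F a * flagY F c)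
    + (flagX F a * flagY F b - flagX F b * flagY F a)

theorem blockElt_eq (a b c d : ι) :
    blockElt F a b c d = tripleElt F c d b - tripleElt F c d a := by
  unfold blockElt tripleElt
  ring

theorem two_mul_tripleElt (a b c d : ι) :
    2 * tripleElt F a b c =
      blockElt F b d a c - blockElt F c d a b - blockElt F c b a d := by
  unfold blockElt tripleElt
  ring

theorem flagRingHom_flagX (g : Equiv.Perm ι) (a : ι) :
    flagRingHom g (flagX F a) = flagX F (g a) := by
  simp [flagX, flagRingHom_single, Finset.smul_finset_singleton]

theorem flagRingHom_flagY (g : Equiv.Perm ι) (a : ι) :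
    flagRingHom g (flagY F a) = flagY F (g a) := by
  simp [flagY, flagRingHom_single, Finset.smul_finset_singleton]

/-- The product of `m` pair differences and `k` exterior products of pair differences. -/
def polytabloid (F : Type) [Field F] : ℕ → ℕ → (ℕ → ι) → FlagRing F ι
  | 0, 0, _ => 1
  | 0, k + 1, u => blockElt F (u 0) (u 1) (u 2) (u 3) * polytabloid F 0 k fun i => u (i + 4)
  | m + 1, k, u => pairElt F (u 0) (u 1) * polytabloid F m k fun i => u (i + 2)

theorem flagRingHom_polytabloid (g : Equiv.Perm ι) (m k : ℕ) (u : ℕ → ι) :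
    flagRingHom g (polytabloid F m k u) = polytabloid F m k fun i => g (u i) := by
  induction m, k, u using polytabloid.induct with
  | case1 => simp [polytabloid]
  | case2 k u ih =>
    simp only [polytabloid, map_mul, ih, blockElt, map_sub, flagRingHom_flagX, flagRingHom_flagY]
  | case3 m k u ih =>
    simp only [polytabloid, map_mul, ih, pairElt, map_sub, flagRingHom_flagX]

theorem polytabloid_congr {m k : ℕ} {u v : ℕ → ι} (h : ∀ i < 2 * m + 4 * k, u i = v i) :
    polytabloid F m k u = polytabloid F m k v := by
  induction m, k, u using polytabloid.induct generalizing v with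
  | case1 => simp [polytabloid]
  | case2 k u ih =>
    simp only [polytabloid]
    rw [h 0 (by omega), h 1 (by omega), h 2 (by omega), h 3 (by omega),
      ih fun i hi => h (i + 4) (by omega)]
  | case3 m k u ih =>
    simp only [polytabloid]
    rw [h 0 (by omega), h 1 (by omega), ih fun i hi => h (i + 2) (by omega)]

/-- Exchanging the two points of a pair changes the sign of the polytabloid. -/
theorem polytabloid_swap {m k i : ℕ} (hi : i < m + 2 * k) (u : ℕ → ι) :
    (polytabloid F m k fun j => u (Equiv.swap (2 * i) (2 * i + 1) j)) = -polytabloid F m k u := by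
  induction m, k, u using polytabloid.induct generalizing i with
  | case1 => omega
  | case2 k u ih =>
    rcases i with _ | _ | i
    · simp only [polytabloid, blockElt, Equiv.swap_apply_def]
      simp
      ring
    · simp only [polytabloid, blockElt, Equiv.swap_apply_def]
      simp
      ring
    · have h := ih (i := i) (by omega)
      simp only [polytabloid]
      rw [← mul_neg, ← h]
      simp only [Equiv.swap_apply_def]
      congr 2
      all_goals grind
  | case3 m k u ih =>
    rcases i with _ | i
    · simp only [polytabloid, pairElt, Equiv.swap_apply_def]
      simp
      ring
    · have h := ih (i := i) (by omega)
      simp only [polytabloid]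
      rw [← mul_neg, ← h]
      simp only [Equiv.swap_apply_def]
      congr 2
      all_goals grind

/-- Exchanging the two pairs of a block changes the sign of the polytabloid. -/
theorem polytabloid_blockSwap {m k j : ℕ} (hj : j < k) (u : ℕ → ι) :
    (polytabloid F m k fun i => u (Equiv.swap (2 * m + 4 * j) (2 * m + 4 * j + 2)
      (Equiv.swap (2 * m + 4 * j + 1) (2 * m + 4 * j + 3) i))) = -polytabloid F m k u := by
  induction m, k, u using polytabloid.induct generalizing j with
  | case1 => omega
  | case2 k u ih =>
    rcases j with _ | j
    · simp only [polytabloid, blockElt, Equiv.swap_apply_def]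
      simp
      ring
    · have h := ih (j := j) (by omega)
      simp only [polytabloid]
      rw [← mul_neg, ← h]
      simp only [Equiv.swap_apply_def]
      congr 2
      all_goals grind
  | case3 m k u ih =>
    have h := ih (j := j) (by omega)
    simp only [polytabloid]
    rw [← mul_neg, ← h]
    simp only [Equiv.swap_apply_def]
    congr 2
    all_goals grind

end FlagElements

section FlagEval

open MonoidAlgebra (single)

/-- The first `N` values of `u` are distinct elements of `X`. -/
def IsTuple {ι : Type} (N : ℕ) (X : Finset ι) (u : ℕ → ι) : Prop :=
  Set.InjOn u (Set.Iio N) ∧ ∀ i < N, u i ∈ X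

/-- The sequence `u` with `a` added at the front. -/
def consSeq {ι : Type} (a : ι) (u : ℕ → ι) : ℕ → ι
  | 0 => a
  | i + 1 => u i

theorem IsTuple.mono {ι : Type} {N : ℕ} {X Y : Finset ι} {u : ℕ → ι} (h : IsTuple N X u)
    (hXY : X ⊆ Y) : IsTuple N Y u := ⟨h.1, fun i hi => hXY (h.2 i hi)⟩

variable {F ι : Type} [Field F] [DecidableEq ι]

theorem IsTuple.cons {N : ℕ} {X : Finset ι} {u : ℕ → ι} {a : ι} (ha : a ∈ X)
    (h : IsTuple N (X.erase a) u) : IsTuple (N + 1) X (consSeq a u) := by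
  refine ⟨?_, ?_⟩
  · rintro (_ | i) hi (_ | j) hj hij
    · rfl
    · exact absurd hij.symm (Finset.ne_of_mem_erase (h.2 j (by simpa using hj)))
    · exact absurd hij (Finset.ne_of_mem_erase (h.2 i (by simpa using hi)))
    · rw [h.1 (by simpa using hi) (by simpa using hj) hij]
  · rintro (_ | i) hi
    · exact ha
    · exact Finset.mem_of_mem_erase (h.2 i (by omega))

theorem IsTuple.tail {N : ℕ} {X : Finset ι} {u : ℕ → ι} (h : IsTuple (N + 1) X u) :
    IsTuple N (X.erase (u 0)) fun i => u (i + 1) := by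
  refine ⟨fun i hi j hj hij => ?_, fun i hi => Finset.mem_erase.2 ⟨fun h0 => ?_, h.2 _ (by omega)⟩⟩
  · have := h.1 (by simpa using hi) (by simpa using hj) hij
    omega
  · have := h.1 (by simpa using hi) (by simp) h0
    omega

theorem IsTuple.exists_erase {N : ℕ} {X : Finset ι} {u : ℕ → ι} (h : IsTuple N X u)
    (hN : N < X.card) : ∃ d ∈ X, IsTuple N (X.erase d) u := by
  obtain ⟨d, hd, hdu⟩ : ∃ d ∈ X, d ∉ (Finset.range N).image u := by
    refine Finset.exists_mem_notMem_of_card_lt_card (lt_of_le_of_lt Finset.card_image_le ?_)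
    simpa using hN
  refine ⟨d, hd, h.1, fun i hi => Finset.mem_erase.2 ⟨fun h0 => hdu ?_, h.2 i hi⟩⟩
  exact Finset.mem_image.2 ⟨i, by simpa using hi, h0⟩

variable [Fintype ι]

/-- Pairing of a function with an element of the flag ring. -/
def flagEval (t : FlagSpace F ι) : FlagRing F ι →ₗ[F] F := flagPairing t ∘ₗ flagCoeff

theorem flagEval_single (t : FlagSpace F ι) (S Z : Finset ι) (c : F) :
    flagEval t (single ⟨S, Z⟩ c) = c * t S Z := by
  rw [flagEval, LinearMap.comp_apply, flagCoeff_single, map_smul, flagPairing_flagSingle,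
    smul_eq_mul]

theorem flagEval_one (t : FlagSpace F ι) : flagEval t 1 = t ∅ ∅ := by
  rw [MonoidAlgebra.one_def, SubsetPair.one_def, flagEval_single, one_mul]

theorem flagEval_pairElt_mul (a b : ι) (t : FlagSpace F ι) (r : FlagRing F ι) :
    flagEval t (pairElt F a b * r) = flagEval (pairDiff a b t) r := by
  induction r using MonoidAlgebra.induction_linear with
  | zero => simp
  | add x y hx hy => rw [mul_add, map_add, hx, hy, map_add]
  | single f c =>
    obtain ⟨S, Z⟩ := f
    simp only [pairElt, flagX, sub_mul, MonoidAlgebra.single_mul_single, SubsetPair.mk_mul_mk,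
      map_sub, flagEval_single, pairDiff, Finset.singleton_union, Finset.empty_union]
    ring

theorem flagEval_tripleElt_mul (a b c : ι) (t : FlagSpace F ι) (r : FlagRing F ι) :
    flagEval t (tripleElt F a b c * r) = flagEval (tripleDiff a b c t) r := by
  induction r using MonoidAlgebra.induction_linear with
  | zero => simp
  | add x y hx hy => rw [mul_add, map_add, hx, hy, map_add]
  | single f e =>
    obtain ⟨S, Z⟩ := f
    have hc : ∀ u v : ι, insert v (insert u S) = insert u (insert v S) :=
      fun u v => Finset.insert_comm v u S
    simp only [tripleElt, flagX, flagY, add_mul, sub_mul, MonoidAlgebra.single_mul_single,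
      SubsetPair.mk_mul_mk, map_sub, map_add, flagEval_single, tripleDiff, flagDiff,
      Finset.singleton_union, Finset.empty_union, Finset.insert_union]
    rw [hc b c, hc a c, hc a b]
    ring

theorem flagEval_polytabloid_of_killed : ∀ {m k : ℕ} {X : Finset ι} {t : FlagSpace F ι}
    {u : ℕ → ι}, IsTuple (2 * m + 4 * k) X u → Killed m k X t →
    flagEval t (polytabloid F m k u) = 0
  | 0, 0, X, t, u, _, h => by
    rw [polytabloid, flagEval_one]
    exact h
  | 0, k + 1, X, t, u, hu, h => by
    have h1 : IsTuple (4 * k + 1 + 1 + 1 + 1) X u := by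
      convert hu using 1
      omega
    have h5 : ∀ Y, (((X.erase (u 0)).erase (u 1)).erase (u 2)).erase (u 3) ⊆ Y →
        IsTuple (2 * 0 + 4 * k) Y fun i => u (i + 4) := fun Y hY => by
      rw [Nat.mul_zero, Nat.zero_add]
      exact h1.tail.tail.tail.tail.mono hY
    have hX := fun i (hi : i < 4) => h1.2 i (by omega)
    have hne : ∀ i j, i < 4 → j < 4 → i ≠ j → u i ≠ u j := fun i j hi hj hij e =>
      hij (h1.1 (show i < _ by omega) (show j < _ by omega) e)
    have key : ∀ x, x = 0 ∨ x = 1 →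
        flagEval t (tripleElt F (u 2) (u 3) (u x) * polytabloid F 0 k fun i => u (i + 4)) = 0 := by
      intro x hx
      rw [flagEval_tripleElt_mul]
      refine flagEval_polytabloid_of_killed (h5 _ fun y => ?_) (h _ (hX 2 (by omega)) _
        (hX 3 (by omega)) _ (hX x (by omega)) (hne _ _ (by omega) (by omega) (by omega))
        (hne _ _ (by omega) (by omega) (by omega)) (hne _ _ (by omega) (by omega) (by omega)))
      rcases hx with rfl | rfl <;> simp only [Finset.mem_erase] <;> tauto
    rw [polytabloid, blockElt_eq, sub_mul, map_sub, key 1 (Or.inr rfl), key 0 (Or.inl rfl),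
      sub_zero]
  | m + 1, k, X, t, u, hu, h => by
    have h1 : IsTuple (2 * m + 4 * k + 1 + 1) X u := by
      convert hu using 1
      omega
    rw [polytabloid, flagEval_pairElt_mul]
    exact flagEval_polytabloid_of_killed h1.tail.tail (h _ (h1.2 0 (by omega)) _ (h1.2 1 (by omega))
      fun e => absurd (h1.1 (by simp) (by simp) e) (by omega))

theorem killed_of_flagEval_polytabloid [Nonempty ι] (h2 : (2 : F) ≠ 0) : ∀ {m k : ℕ} {X : Finset ι}
    {t : FlagSpace F ι}, 2 * m + 4 * k ≤ X.card →
    (∀ u, IsTuple (2 * m + 4 * k) X u → flagEval t (polytabloid F m k u) = 0) → Killed m k X t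
  | 0, 0, X, t, _, h => by
    have := h (fun _ => Classical.arbitrary ι) ⟨fun i hi => absurd hi (by simp), by simp⟩
    rwa [polytabloid, flagEval_one] at this
  | 0, k + 1, X, t, hX, h => by
    intro a ha b hb c hc hab hac hbc
    have hX' : 4 * k + 1 ≤ (((X.erase a).erase b).erase c).card := by
      rw [Finset.card_erase_of_mem (by simp [*, hac.symm, hbc.symm]),
        Finset.card_erase_of_mem (by simp [*, hab.symm]), Finset.card_erase_of_mem ha]
      omega
    refine killed_of_flagEval_polytabloid h2 (m := 0) (by omega) fun u hu => ?_
    obtain ⟨d, hd, hu'⟩ := hu.exists_erase (by omega)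
    simp only [Finset.mem_erase] at hd
    have key : ∀ x ∈ X, ∀ y ∈ X, ∀ z ∈ X, ∀ w ∈ X, x ≠ y → x ≠ z → x ≠ w → y ≠ z → y ≠ w →
        z ≠ w → (((((X.erase a).erase b).erase c).erase d) ⊆
          ((((X.erase x).erase y).erase z).erase w)) →
        flagEval t (blockElt F x y z w * polytabloid F 0 k u) = 0 := by
      intro x hx y hy z hz w hw hxy hxz hxw hyz hyw hzw hs
      have h5 := ((((hu'.mono hs).cons (a := w) (by simp [*, Ne.symm])).cons
        (a := z) (by simp [*, hxz.symm, hyz.symm])).cons (a := y) (by simp [*, hxy.symm])).cons hx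
      have h6 := h _ (by
        rw [show 2 * 0 + 4 * (k + 1) = 2 * 0 + 4 * k + 1 + 1 + 1 + 1 by ring]
        exact h5)
      rw [polytabloid] at h6
      exact h6
    rw [← flagEval_tripleElt_mul]
    have e : 2 * flagEval t (tripleElt F a b c * polytabloid F 0 k u) = 0 := by
      have : (2 : F) • (tripleElt F a b c * polytabloid F 0 k u) =
          (2 * tripleElt F a b c) * polytabloid F 0 k u := by
        rw [two_mul, two_smul, add_mul]
      rw [← smul_eq_mul, ← map_smul, this, two_mul_tripleElt a b c d, sub_mul, sub_mul, map_sub,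
        map_sub]
      rw [key, key, key]
      · simp
      all_goals grind
    exact (mul_eq_zero.1 e).resolve_left h2
  | m + 1, k, X, t, hX, h => by
    intro a ha b hb hab
    refine killed_of_flagEval_polytabloid h2 ?_ fun u hu => ?_
    · rw [Finset.card_erase_of_mem (by simp [*, hab.symm]), Finset.card_erase_of_mem ha]
      omega
    · rw [← flagEval_pairElt_mul]
      have h3 := h (consSeq a (consSeq b u)) (by
        rw [show 2 * (m + 1) + 4 * k = 2 * m + 4 * k + 1 + 1 by ring]
        exact (hu.cons (a := b) (by simp [*, hab.symm])).cons ha)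
      rw [polytabloid] at h3
      exact h3

end FlagEval

section PolytabloidFunctions

open scoped Pointwise
open MonoidAlgebra (single)

theorem exists_perm_comp {ι : Type} [Fintype ι] {N : ℕ} {u v : ℕ → ι} (hu : IsTuple N Finset.univ u)
    (hv : IsTuple N Finset.univ v) : ∃ g : Equiv.Perm ι, ∀ i < N, g (u i) = v i := by
  have hinj : ∀ w : ℕ → ι, IsTuple N Finset.univ w →
      Function.Injective fun i : Fin N => w i := fun w hw i j hij =>
    Fin.ext (hw.1 (by simp) (by simp) hij)
  have := Equiv.Perm.isMultiplyPretransitive ι N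
  obtain ⟨g, hg⟩ := MulAction.exists_smul_eq (M := Equiv.Perm ι)
    (⟨_, hinj u hu⟩ : Fin N ↪ ι) ⟨_, hinj v hv⟩
  refine ⟨g, fun i hi => ?_⟩
  exact DFunLike.congr_fun hg (⟨i, hi⟩ : Fin N)

variable {F ι : Type} [Field F] [DecidableEq ι]

/-- The character of the flag ring given by inclusion in `A` and `B`. -/
def flagChar (F : Type) [Field F] (A B : Finset ι) : FlagRing F ι →ₐ[F] F :=
  MonoidAlgebra.lift F F (SubsetPair ι)
    { toFun := fun f => if f.fst ⊆ A ∧ f.snd ⊆ B then 1 else 0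
      map_one' := by simp [SubsetPair.one_def]
      map_mul' := fun f f' => by
        obtain ⟨S, Z⟩ := f
        obtain ⟨S', Z'⟩ := f'
        simp only [SubsetPair.mk_mul_mk, Finset.union_subset_iff]
        split_ifs <;> simp <;> tauto }

theorem flagChar_single (A B S Z : Finset ι) (c : F) :
    flagChar F A B (single ⟨S, Z⟩ c) = if S ⊆ A ∧ Z ⊆ B then c else 0 := by
  simp [flagChar]

theorem flagChar_polytabloid {m k : ℕ} {u : ℕ → ι} {A B : Finset ι}
    (hA : ∀ i < m + 2 * k, u (2 * i) ∈ A) (hA' : ∀ i < m + 2 * k, u (2 * i + 1) ∉ A)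
    (hB : ∀ j < k, u (2 * m + 4 * j) ∈ B) (hB' : ∀ j < k, u (2 * m + 4 * j + 2) ∉ B) :
    flagChar F A B (polytabloid F m k u) = 1 := by
  induction m, k, u using polytabloid.induct with
  | case1 => simp [polytabloid]
  | case2 k u ih =>
    have h0 := hA 0 (by omega)
    have h1 := hA' 0 (by omega)
    have h2 := hA 1 (by omega)
    have h3 := hA' 1 (by omega)
    have h4 := hB 0 (by omega)
    have h5 := hB' 0 (by omega)
    simp only [mul_zero, zero_add, mul_one] at h0 h1 h2 h3 h4 h5
    rw [polytabloid, map_mul, ih (fun i hi => hA (i + 2) (by omega))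
      (fun i hi => hA' (i + 2) (by omega)) (fun i hi => ?_) (fun i hi => ?_)]
    · simp only [blockElt, flagX, flagY, map_sub, map_mul, flagChar_single]
      simp [h0, h1, h2, h3, h4, h5]
    · simpa only [mul_add, add_assoc] using hB (i + 1) (by omega)
    · simpa only [mul_add, add_assoc, add_comm, add_left_comm, mul_one] using hB' (i + 1) (by omega)
  | case3 m k u ih =>
    have h0 := hA 0 (by omega)
    have h1 := hA' 0 (by omega)
    simp only [mul_zero, zero_add] at h0 h1
    rw [polytabloid, map_mul, ih (fun i hi => hA (i + 1) (by omega))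
      (fun i hi => hA' (i + 1) (by omega)) (fun i hi => ?_) (fun i hi => ?_)]
    · simp only [pairElt, flagX, map_sub, flagChar_single]
      simp [h0, h1]
    · simpa only [Nat.succ_eq_add_one, mul_add, mul_one, add_right_comm] using hB i hi
    · simpa only [Nat.succ_eq_add_one, mul_add, mul_one, add_right_comm] using hB' i hi

/-- The function of flags given by `polytabloid`. -/
def polyFun (F : Type) [Field F] (m k : ℕ) (u : ℕ → ι) : FlagSpace F ι :=
  flagCoeff (polytabloid F m k u)

theorem flagRep_polyFun (g : Equiv.Perm ι) (m k : ℕ) (u : ℕ → ι) :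
    flagRep F ι g (polyFun F m k u) = polyFun F m k fun i => g (u i) := by
  rw [polyFun, ← flagCoeff_flagRingHom, flagRingHom_polytabloid, polyFun]

/-- The first points of the first `q` pairs. -/
def firstPoints (q : ℕ) (u : ℕ → ι) : Finset ι := (Finset.range q).image fun i => u (2 * i)

/-- The first points of the blocks. -/
def blockPoints (m k : ℕ) (u : ℕ → ι) : Finset ι :=
  (Finset.range k).image fun j => u (2 * m + 4 * j)

theorem card_firstPoints {q : ℕ} {X : Finset ι} {u : ℕ → ι} (hu : IsTuple (2 * q) X u) :
    (firstPoints q u).card = q := by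
  rw [firstPoints, Finset.card_image_of_injOn, Finset.card_range]
  intro i hi j hj hij
  simp only [Finset.coe_range, Set.mem_Iio] at hi hj
  have := hu.1 (show 2 * i < _ by omega) (show 2 * j < _ by omega) hij
  omega

theorem mem_firstPoints {q i : ℕ} {X : Finset ι} {u : ℕ → ι} (hu : IsTuple (2 * q) X u)
    (hi : i < 2 * q) : u i ∈ firstPoints q u ↔ Even i := by
  simp only [firstPoints, Finset.mem_image, Finset.mem_range]
  constructor
  · rintro ⟨j, hj, h⟩
    rw [← hu.1 (show 2 * j < _ by omega) (show i < _ by omega) h]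
    exact even_two_mul j
  · rintro ⟨j, rfl⟩
    exact ⟨j, by omega, by rw [two_mul]⟩

theorem mem_blockPoints {m k i : ℕ} {X : Finset ι} {u : ℕ → ι}
    (hu : IsTuple (2 * m + 4 * k) X u) (hi : i < 2 * m + 4 * k) :
    u i ∈ blockPoints m k u ↔ ∃ j < k, i = 2 * m + 4 * j := by
  simp only [blockPoints, Finset.mem_image, Finset.mem_range]
  constructor
  · rintro ⟨j, hj, h⟩
    exact ⟨j, hj, (hu.1 (show 2 * m + 4 * j < _ by omega) (show i < _ by omega) h).symm⟩
  · rintro ⟨j, hj, rfl⟩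
    exact ⟨j, hj, rfl⟩

theorem card_blockPoints {m k : ℕ} {X : Finset ι} {u : ℕ → ι}
    (hu : IsTuple (2 * m + 4 * k) X u) : (blockPoints m k u).card = k := by
  rw [blockPoints, Finset.card_image_of_injOn, Finset.card_range]
  intro i hi j hj hij
  simp only [Finset.coe_range, Set.mem_Iio] at hi hj
  have := hu.1 (show 2 * m + 4 * i < _ by omega) (show 2 * m + 4 * j < _ by omega) hij
  omega

variable [Fintype ι]

theorem flagPairing_polyFun (t : FlagSpace F ι) (m k : ℕ) (u : ℕ → ι) :
    flagPairing t (polyFun F m k u) = flagEval t (polytabloid F m k u) := rfl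

theorem flagPairing_polyFun_of_agreeOn {m k : ℕ} {u : ℕ → ι}
    (hu : IsTuple (2 * m + 4 * k) Finset.univ u) {t : FlagSpace F ι}
    (h : AgreeOn (m + 2 * k) k Finset.univ t 0) :
    flagPairing t (polyFun F m k u) = 0 := by
  refine flagEval_polytabloid_of_killed hu
    (Killed.congr (t := 0) (fun S Z h1 h2 h3 h4 => (h S Z h1 h2 h3 h4).symm) ?_)
  have h0 : properSubsetSum (0 : FlagSpace F ι) = 0 := by
    funext S Z
    simp [properSubsetSum]
  rw [← h0]
  exact killed_properSubsetSum _ _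

theorem polyFun_eq_zero {m k : ℕ} {u : ℕ → ι} (hu : IsTuple (2 * m + 4 * k) Finset.univ u)
    {S Z : Finset ι} (h : ¬(S.card = m + 2 * k ∧ Z ⊆ S ∧ Z.card = k)) :
    polyFun F m k u S Z = 0 := by
  rw [← flagPairing_flagSingle (polyFun F m k u), flagPairing_comm]
  refine flagPairing_polyFun_of_agreeOn hu fun S' Z' _ hq hZ hk => if_neg ?_
  rintro ⟨rfl, rfl⟩
  exact h ⟨hq, hZ, hk⟩

theorem flagPairing_properSubsetSum {m k : ℕ} {u : ℕ → ι}
    (hu : IsTuple (2 * m + 4 * k) Finset.univ u) (f : FlagSpace F ι) :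
    flagPairing (properSubsetSum f) (polyFun F m k u) = 0 :=
  flagEval_polytabloid_of_killed hu (killed_properSubsetSum _ _)

theorem flagPairing_intermediateSum {m k : ℕ} {u : ℕ → ι}
    (hu : IsTuple (2 * m + 4 * k) Finset.univ u) (y : FlagSpace F ι) :
    flagPairing (intermediateSum y) (polyFun F m k u) = 0 :=
  flagEval_polytabloid_of_killed hu (killed_intermediateSum _ _)

theorem polyFun_firstPoints_blockPoints {m k : ℕ} {u : ℕ → ι}
    (hu : IsTuple (2 * m + 4 * k) Finset.univ u) :
    polyFun F m k u (firstPoints (m + 2 * k) u) (blockPoints m k u) = 1 := by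
  have hu' : IsTuple (2 * (m + 2 * k)) Finset.univ u := by
    convert hu using 1
    ring
  set A := firstPoints (m + 2 * k) u with hA
  set B := blockPoints m k u with hB
  have hAc : A.card = m + 2 * k := card_firstPoints hu'
  have hBc : B.card = k := card_blockPoints hu
  have h1 : flagChar F A B (polytabloid F m k u) = 1 := by
    refine flagChar_polytabloid (fun i hi => ?_) (fun i hi => ?_) (fun j hj => ?_) fun j hj => ?_
    · exact (mem_firstPoints hu' (by omega)).2 (even_two_mul i)
    · rw [hA, mem_firstPoints hu' (by omega)]
      simp
    · exact (mem_blockPoints hu (by omega)).2 ⟨j, hj, rfl⟩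
    · rw [hB, mem_blockPoints hu (by omega)]
      rintro ⟨i, hi, h⟩
      omega
  have h2 : ∀ r : FlagRing F ι, flagChar F A B r =
      flagPairing (fun S Z => if S ⊆ A ∧ Z ⊆ B then 1 else 0) (flagCoeff r) := by
    intro r
    induction r using MonoidAlgebra.induction_linear with
    | zero => simp
    | add x y hx hy => simp only [map_add, hx, hy]
    | single f c =>
      obtain ⟨S, Z⟩ := f
      rw [flagChar_single, flagCoeff_single, map_smul, flagPairing_flagSingle]
      simp
  have h3 : flagPairing ((fun S Z => if S ⊆ A ∧ Z ⊆ B then 1 else 0) - flagSingle A B)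
      (polyFun F m k u) = 0 := by
    refine flagPairing_polyFun_of_agreeOn hu fun S Z _ hS hZ hk => ?_
    have e1 : S ⊆ A ↔ S = A :=
      ⟨fun h => Finset.eq_of_subset_of_card_le h (by omega), fun h => h.subset⟩
    have e2 : Z ⊆ B ↔ Z = B :=
      ⟨fun h => Finset.eq_of_subset_of_card_le h (by omega), fun h => h.subset⟩
    simp [flagSingle, e1, e2]
  rw [map_sub, LinearMap.sub_apply, polyFun, ← h2, h1, sub_eq_zero, flagPairing_comm,
    flagPairing_flagSingle] at h3
  exact h3.symm

end PolytabloidFunctions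

section SignProjection

open scoped Pointwise
open MonoidAlgebra (single)

/-- A property of `q`-subsets which can be moved along the exchanges `y i ↦ x i` and which holds
for subsets missing some pair and for the set of all `x i` holds for all `q`-subsets. -/
theorem forall_of_pairs {ι : Type} [DecidableEq ι] {q : ℕ} {x y : ℕ → ι}
    (hx : Set.InjOn x (Set.Iio q)) (hy : Set.InjOn y (Set.Iio q))
    (hxy : ∀ i < q, ∀ j < q, x i ≠ y j) {N : Finset ι → Prop}
    (h1 : ∀ S : Finset ι, S.card = q → ∀ i < q, x i ∉ S → y i ∉ S → N S)
    (h2 : ∀ S : Finset ι, S.card = q → ∀ i < q, x i ∉ S → y i ∈ S →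
      N (insert (x i) (S.erase (y i))) → N S)
    (h3 : N ((Finset.range q).image x)) (S : Finset ι) (hS : S.card = q) : N S := by
  induction hn : ((Finset.range q).filter fun i => y i ∈ S).card using Nat.strong_induction_on
    generalizing S with
  | _ n ih =>
  by_cases hm : ∃ i < q, x i ∉ S ∧ y i ∉ S
  · obtain ⟨i, hi, hxi, hyi⟩ := hm
    exact h1 S hS i hi hxi hyi
  push Not at hm
  have himage : (Finset.range q).image (fun i => if x i ∈ S then x i else y i) = S := by
    refine Finset.eq_of_subset_of_card_le (fun z hz => ?_) ?_
    · obtain ⟨i, hi, rfl⟩ := Finset.mem_image.1 hz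
      have := hm i (by simpa using hi)
      split_ifs <;> tauto
    · rw [Finset.card_image_of_injOn, hS, Finset.card_range]
      intro i hi j hj hij
      simp only [Finset.coe_range, Set.mem_Iio] at hi hj
      dsimp only at hij
      split_ifs at hij
      · exact hx hi hj hij
      · exact absurd hij (hxy i hi j hj)
      · exact absurd hij.symm (hxy j hj i hi)
      · exact hy hi hj hij
  by_cases hex : ∃ i < q, y i ∈ S
  · obtain ⟨i, hi, hyi⟩ := hex
    have hxi : x i ∉ S := by
      intro hxi
      rw [← himage] at hyi
      obtain ⟨j, hj, hj'⟩ := Finset.mem_image.1 hyi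
      simp only [Finset.mem_range] at hj
      split_ifs at hj' with hxj
      · exact hxy j hj i hi hj'
      · exact hxj (by rwa [hy hj hi hj'])
    refine h2 S hS i hi hxi hyi (ih _ ?_ _ ?_ rfl)
    · rw [← hn]
      refine Finset.card_lt_card (Finset.ssubset_iff_of_subset (fun j => ?_) |>.2 ⟨i, ?_, ?_⟩)
      · simp only [Finset.mem_filter, Finset.mem_range, Finset.mem_insert, Finset.mem_erase]
        rintro ⟨hj, h | h⟩
        · exact absurd h.symm (hxy i hi j hj)
        · exact ⟨hj, h.2⟩
      · simpa using ⟨hi, hyi⟩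
      · simpa using fun _ h => hxy i hi i hi h.symm
    · rw [Finset.card_insert_of_notMem (by simp [hxi]), Finset.card_erase_of_mem hyi, hS]
      omega
  · push Not at hex
    have : (Finset.range q).image x = S := by
      conv_rhs => rw [← himage]
      refine Finset.image_congr fun i hi => ?_
      have hi' : i < q := by simpa using hi
      have := hm i hi'
      rw [if_pos (by by_contra h; exact hex i hi' (this h))]
    rwa [← this]

variable {F ι : Type} [Field F] [DecidableEq ι]

/-- `Γ` acts on `t` by the sign `-1`. -/
def IsSign (Γ : Set (Equiv.Perm ι)) (t : FlagSpace F ι) : Prop :=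
  ∀ g ∈ Γ, flagRep F ι g t = -t

/-- There is an element of the group algebra projecting onto the functions with `IsSign Γ`. -/
def HasSignProjection (F : Type) [Field F] (Γ : Set (Equiv.Perm ι)) : Prop :=
  ∃ π : MonoidAlgebra F (Equiv.Perm ι), (∀ t : FlagSpace F ι, IsSign Γ t → π • t = t) ∧
    ∀ t : FlagSpace F ι, IsSign Γ (π • t)

theorem hasSignProjection_empty : HasSignProjection F (∅ : Set (Equiv.Perm ι)) :=
  ⟨1, fun t _ => one_smul _ t, fun _ _ h => absurd h (Set.notMem_empty _)⟩

theorem HasSignProjection.insert (h2 : (2 : F) ≠ 0) {Γ : Set (Equiv.Perm ι)}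
    (h : HasSignProjection F Γ) {g : Equiv.Perm ι} (hg : g * g = 1)
    (hΓ : ∀ γ ∈ Γ, g * γ * g ∈ Γ) : HasSignProjection F (insert g Γ) := by
  obtain ⟨π, hπ, hπ'⟩ := h
  have key : ∀ t : FlagSpace F ι, ((2⁻¹ : F) • (1 - single g 1) * π) • t =
      (2⁻¹ : F) • (π • t - flagRep F ι g (π • t)) := by
    intro t
    rw [mul_smul, smul_assoc, sub_smul, one_smul, single_smul_flag, one_smul]
  have hgg : ∀ t : FlagSpace F ι, flagRep F ι g (flagRep F ι g t) = t := by
    intro t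
    rw [← Module.End.mul_apply, ← map_mul, hg, map_one, Module.End.one_apply]
  refine ⟨(2⁻¹ : F) • (1 - single g 1) * π, fun t ht => ?_, fun t => ?_⟩
  · have h1 : π • t = t := hπ t fun γ hγ => ht γ (Set.mem_insert_of_mem _ hγ)
    rw [key, h1, ht g (Set.mem_insert _ _), sub_neg_eq_add, ← two_smul F t, smul_smul,
      inv_mul_cancel₀ h2, one_smul]
  · intro γ hγ
    rw [key, map_smul, map_sub, ← smul_neg, neg_sub]
    rcases Set.mem_insert_iff.1 hγ with rfl | hγ
    · rw [hgg]
    · have h1 := hπ' t _ (hΓ γ hγ)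
      have h3 : flagRep F ι γ (flagRep F ι g (π • t)) = flagRep F ι g (-(π • t)) := by
        rw [← h1, ← Module.End.mul_apply, ← Module.End.mul_apply, ← map_mul, ← map_mul,
          ← mul_assoc, ← mul_assoc, hg, one_mul]
      rw [h3, hπ' t γ hγ, map_neg]
      abel_nf

/-- The exchange of the points of the `i`-th pair. -/
def pairSwap (u : ℕ → ι) (i : ℕ) : Equiv.Perm ι := Equiv.swap (u (2 * i)) (u (2 * i + 1))

/-- The exchange of the two pairs of a block starting at index `c`. -/
def blockSwap (u : ℕ → ι) (c : ℕ) : Equiv.Perm ι :=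
  Equiv.swap (u c) (u (c + 2)) * Equiv.swap (u (c + 1)) (u (c + 3))

/-- All exchanges of pairs and in blocks. -/
def signSet (m k : ℕ) (u : ℕ → ι) : Set (Equiv.Perm ι) :=
  {g | (∃ i < m + 2 * k, g = pairSwap u i) ∨ ∃ j < k, g = blockSwap u (2 * m + 4 * j)}

theorem swap_tuple {N a b i : ℕ} {u : ℕ → ι} (hu : Set.InjOn u (Set.Iio N)) (ha : a < N)
    (hb : b < N) (hi : i < N) : Equiv.swap (u a) (u b) (u i) = u (Equiv.swap a b i) := by
  simp only [Equiv.swap_apply_def]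
  have h1 : u i = u a ↔ i = a := hu.eq_iff hi ha
  have h2 : u i = u b ↔ i = b := hu.eq_iff hi hb
  simp only [h1, h2]
  split_ifs <;> rfl

theorem blockSwap_tuple {N c i : ℕ} {u : ℕ → ι} (hu : Set.InjOn u (Set.Iio N)) (hc : c + 3 < N)
    (hi : i < N) : blockSwap u c (u i) =
      u (Equiv.swap c (c + 2) (Equiv.swap (c + 1) (c + 3) i)) := by
  rw [blockSwap, Equiv.Perm.mul_apply, swap_tuple hu (by omega) (by omega) hi,
    swap_tuple hu (by omega) (by omega)]
  rw [Equiv.swap_apply_def]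
  split_ifs <;> omega

theorem conj_swap {g : Equiv.Perm ι} (hg : g * g = 1) (a b : ι) :
    g * Equiv.swap a b * g = Equiv.swap (g a) (g b) := by
  rw [Equiv.swap_apply_apply, inv_eq_of_mul_eq_one_right hg]

theorem pairSwap_mul_self (u : ℕ → ι) (i : ℕ) : pairSwap u i * pairSwap u i = 1 :=
  Equiv.swap_mul_self _ _

theorem blockSwap_mul_self {N c : ℕ} {u : ℕ → ι} (hu : Set.InjOn u (Set.Iio N))
    (hc : c + 3 < N) : blockSwap u c * blockSwap u c = 1 := by
  have h := conj_swap (Equiv.swap_mul_self (u (c + 1)) (u (c + 3))) (u c) (u (c + 2))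
  rw [swap_tuple hu (by omega) (by omega) (by omega),
    swap_tuple hu (by omega) (by omega) (by omega),
    Equiv.swap_apply_of_ne_of_ne (by omega) (by omega),
    Equiv.swap_apply_of_ne_of_ne (by omega) (by omega)] at h
  rw [blockSwap, mul_assoc, ← mul_assoc (Equiv.swap (u (c + 1)) (u (c + 3))), h,
    Equiv.swap_mul_self]

theorem hasSignProjection_signSet (h2 : (2 : F) ≠ 0) {m k : ℕ} {u : ℕ → ι}
    (hu : Set.InjOn u (Set.Iio (2 * m + 4 * k))) : HasSignProjection F (signSet m k u) := by
  have hpair : ∀ l ≤ m + 2 * k, HasSignProjection F {g | ∃ i < l, g = pairSwap u i} := by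
    intro l hl
    induction l with
    | zero => simpa using hasSignProjection_empty
    | succ l ih =>
      have : {g | ∃ i < l + 1, g = pairSwap u i} =
          insert (pairSwap u l) {g | ∃ i < l, g = pairSwap u i} := by
        ext g
        simp only [Set.mem_ofPred_eq, Set.mem_insert_iff, Nat.lt_succ_iff_lt_or_eq]
        grind
      rw [this]
      refine (ih (by omega)).insert h2 (pairSwap_mul_self u l) ?_
      rintro _ ⟨i, hi, rfl⟩
      refine ⟨i, hi, ?_⟩
      rw [pairSwap, pairSwap, conj_swap (Equiv.swap_mul_self _ _),
        swap_tuple hu (by omega) (by omega) (by omega),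
        swap_tuple hu (by omega) (by omega) (by omega),
        Equiv.swap_apply_of_ne_of_ne (by omega) (by omega),
        Equiv.swap_apply_of_ne_of_ne (by omega) (by omega)]
  have hblock : ∀ l ≤ k, HasSignProjection F {g | (∃ i < m + 2 * k, g = pairSwap u i) ∨
      ∃ j < l, g = blockSwap u (2 * m + 4 * j)} := by
    intro l hl
    induction l with
    | zero => simpa using hpair _ le_rfl
    | succ l ih =>
      have : {g | (∃ i < m + 2 * k, g = pairSwap u i) ∨
          ∃ j < l + 1, g = blockSwap u (2 * m + 4 * j)} = insert (blockSwap u (2 * m + 4 * l))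
          {g | (∃ i < m + 2 * k, g = pairSwap u i) ∨
            ∃ j < l, g = blockSwap u (2 * m + 4 * j)} := by
        ext g
        simp only [Set.mem_ofPred_eq, Set.mem_insert_iff, Nat.lt_succ_iff_lt_or_eq]
        grind
      rw [this]
      have hsq := blockSwap_mul_self (c := 2 * m + 4 * l) hu (by omega)
      refine (ih (by omega)).insert h2 hsq ?_
      rintro _ (⟨i, hi, rfl⟩ | ⟨j, hj, rfl⟩)
      · left
        rw [pairSwap, conj_swap hsq, blockSwap_tuple hu (by omega) (by omega),
          blockSwap_tuple hu (by omega) (by omega)]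
        by_cases e1 : i = m + 2 * l
        · refine ⟨i + 1, by omega, ?_⟩
          rw [pairSwap]
          simp only [Equiv.swap_apply_def]
          grind
        by_cases e3 : i = m + 2 * l + 1
        · refine ⟨i - 1, by omega, ?_⟩
          rw [pairSwap]
          congr 2
          all_goals
            simp only [Equiv.swap_apply_def]
            split_ifs <;> omega
        · refine ⟨i, by omega, ?_⟩
          rw [pairSwap]
          simp only [Equiv.swap_apply_def]
          grind
      · right
        refine ⟨j, hj, ?_⟩
        generalize hg : blockSwap u (2 * m + 4 * l) = g at hsq
        have hfix : ∀ x < 2 * m + 4 * l, g (u x) = u x := by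
          intro x hx
          rw [← hg, blockSwap_tuple hu (by omega) (by omega)]
          simp only [Equiv.swap_apply_def]
          congr 1
          split_ifs <;> omega
        have hmul : ∀ a b : Equiv.Perm ι, g * (a * b) * g = g * a * g * (g * b * g) := by
          intro a b
          simp only [mul_assoc]
          rw [← mul_assoc g g, hsq, one_mul]
        rw [blockSwap, hmul, conj_swap hsq, conj_swap hsq, hfix _ (by omega), hfix _ (by omega),
          hfix _ (by omega), hfix _ (by omega)]
  exact hblock k le_rfl

end SignProjection

section SignFunctions

open scoped Pointwise
open MonoidAlgebra (single)

variable {F ι : Type} [Field F] [DecidableEq ι]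

theorem swap_smul_of_notMem {x y : ι} {S : Finset ι} (hx : x ∉ S) (hy : y ∉ S) :
    Equiv.swap x y • S = S := by
  ext z
  rw [← Finset.inv_smul_mem_iff, Equiv.swap_inv, Equiv.Perm.smul_def, Equiv.swap_apply_def]
  grind

theorem swap_smul_of_mem {x y : ι} {S : Finset ι} (hx : x ∈ S) (hy : y ∈ S) :
    Equiv.swap x y • S = S := by
  ext z
  rw [← Finset.inv_smul_mem_iff, Equiv.swap_inv, Equiv.Perm.smul_def, Equiv.swap_apply_def]
  grind

theorem swap_smul_of_notMem_of_mem {x y : ι} {S : Finset ι} (hx : x ∉ S) (hy : y ∈ S) :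
    Equiv.swap x y • S = insert x (S.erase y) := by
  ext z
  rw [← Finset.inv_smul_mem_iff, Equiv.swap_inv, Equiv.Perm.smul_def, Equiv.swap_apply_def]
  grind

theorem IsSign.apply_smul {Γ : Set (Equiv.Perm ι)} {t : FlagSpace F ι} (h : IsSign Γ t)
    {g : Equiv.Perm ι} (hg : g ∈ Γ) (S Z : Finset ι) : t (g • S) (g • Z) = -t S Z := by
  have h1 := flagRep_smul_smul g t S Z
  rw [h g hg] at h1
  rw [← h1, Pi.neg_apply, Pi.neg_apply, neg_neg]

theorem IsSign.apply_eq_zero (h2 : (2 : F) ≠ 0) {Γ : Set (Equiv.Perm ι)} {t : FlagSpace F ι}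
    (h : IsSign Γ t) {g : Equiv.Perm ι} (hg : g ∈ Γ) {S Z : Finset ι} (hS : g • S = S)
    (hZ : g • Z = Z) : t S Z = 0 := by
  have h1 := h.apply_smul hg S Z
  rw [hS, hZ, eq_neg_iff_add_eq_zero, ← two_mul] at h1
  exact (mul_eq_zero.1 h1).resolve_left h2

theorem isSign_polyFun {m k : ℕ} {X : Finset ι} {u : ℕ → ι} (hu : IsTuple (2 * m + 4 * k) X u) :
    IsSign (signSet m k u) (polyFun F m k u) := by
  rintro _ (⟨i, hi, rfl⟩ | ⟨j, hj, rfl⟩)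
  · rw [flagRep_polyFun, polyFun, polyFun, ← map_neg, ← polytabloid_swap hi]
    congr 1
    refine polytabloid_congr fun l hl => ?_
    rw [pairSwap, swap_tuple hu.1 (by omega) (by omega) hl]
  · rw [flagRep_polyFun, polyFun, polyFun, ← map_neg, ← polytabloid_blockSwap hj]
    congr 1
    refine polytabloid_congr fun l hl => ?_
    rw [blockSwap_tuple hu.1 (by omega) hl]

theorem IsSign.eq_zero (h2 : (2 : F) ≠ 0) {m k : ℕ} (hk : 0 < k) {X : Finset ι} {u : ℕ → ι}
    (hu : IsTuple (2 * m + 4 * k) X u) {t : FlagSpace F ι} (ht : IsSign (signSet m k u) t)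
    (hsupp : ∀ S Z, t S Z ≠ 0 → S.card = m + 2 * k ∧ Z ⊆ S ∧ (Z.card = k ∨ Z = ∅))
    (h0 : t (firstPoints (m + 2 * k) u) (blockPoints m k u) = 0) : t = 0 := by
  have hu' : IsTuple (2 * (m + 2 * k)) X u := by
    convert hu using 1
    ring
  have hinj : ∀ i j, i < 2 * m + 4 * k → j < 2 * m + 4 * k → u i = u j → i = j :=
    fun i j hi hj hij => hu.1 hi hj hij
  have hpair : ∀ i < m + 2 * k, pairSwap u i ∈ signSet m k u := fun i hi => Or.inl ⟨i, hi, rfl⟩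
  have hblock : ∀ j < k, blockSwap u (2 * m + 4 * j) ∈ signSet m k u :=
    fun j hj => Or.inr ⟨j, hj, rfl⟩
  set A := firstPoints (m + 2 * k) u with hA
  have hAmem : ∀ i < 2 * m + 4 * k, (u i ∈ A ↔ Even i) := fun i hi =>
    mem_firstPoints hu' (by omega)
  have hswap : ∀ j < k, ∀ Z ⊆ A, blockSwap u (2 * m + 4 * j) • Z =
      Equiv.swap (u (2 * m + 4 * j)) (u (2 * m + 4 * j + 2)) • Z := by
    intro j hj Z hZ
    have hno : ∀ i < 2 * m + 4 * k, i % 2 = 1 → u i ∉ Z := fun i hi he h => by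
      have := Nat.even_iff.1 ((hAmem i hi).1 (hZ h))
      omega
    rw [blockSwap, mul_smul, swap_smul_of_notMem (hno _ (by omega) (by omega))
      (hno _ (by omega) (by omega))]
  have hfix : ∀ j < k, blockSwap u (2 * m + 4 * j) • A = A := by
    intro j hj
    rw [hswap j hj A Finset.Subset.rfl, swap_smul_of_mem]
    · exact (hAmem _ (by omega)).2 (by rw [Nat.even_iff]; omega)
    · exact (hAmem _ (by omega)).2 (by rw [Nat.even_iff]; omega)
  have hmiss : ∀ j < k, ∀ Z ⊆ A, u (2 * m + 4 * j) ∉ Z → u (2 * m + 4 * j + 2) ∉ Z →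
      t A Z = 0 := by
    intro j hj Z hZ hx hy
    refine ht.apply_eq_zero h2 (hblock j hj) (hfix j hj) ?_
    rw [hswap j hj Z hZ, swap_smul_of_notMem hx hy]
  have hcard : ∀ Z : Finset ι, Z.card = k → t A Z = 0 := by
    refine forall_of_pairs (x := fun j => u (2 * m + 4 * j)) (y := fun j => u (2 * m + 4 * j + 2))
      (fun i hi j hj hij => ?_) (fun i hi j hj hij => ?_) (fun i hi j hj hij => ?_) ?_ ?_ h0
    · simp only [Set.mem_Iio] at hi hj
      have := hinj _ _ (by omega) (by omega) hij
      omega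
    · simp only [Set.mem_Iio] at hi hj
      have := hinj _ _ (by omega) (by omega) hij
      omega
    · have := hinj _ _ (by omega) (by omega) hij
      omega
    · intro Z _ j hj hx hy
      by_contra hne
      exact hne (hmiss j hj Z (hsupp _ _ hne).2.1 hx hy)
    · intro Z _ j hj hx hy hZ
      by_contra hne
      have h3 := ht.apply_smul (hblock j hj) A Z
      rw [hfix j hj, hswap j hj Z (hsupp _ _ hne).2.1, swap_smul_of_notMem_of_mem hx hy, hZ] at h3
      exact hne (neg_eq_zero.1 h3.symm)
  have hbase : ∀ Z, t A Z = 0 := by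
    intro Z
    by_contra hne
    rcases (hsupp _ _ hne).2.2 with h | rfl
    · exact hne (hcard Z h)
    · exact hne (hmiss 0 hk ∅ (Finset.empty_subset _) (Finset.notMem_empty _)
        (Finset.notMem_empty _))
  have hall : ∀ S : Finset ι, S.card = m + 2 * k → ∀ Z, t S Z = 0 := by
    refine forall_of_pairs (x := fun i => u (2 * i)) (y := fun i => u (2 * i + 1))
      (fun i hi j hj hij => ?_) (fun i hi j hj hij => ?_) (fun i hi j hj hij => ?_) ?_ ?_ hbase
    · simp only [Set.mem_Iio] at hi hj
      have := hinj _ _ (by omega) (by omega) hij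
      omega
    · simp only [Set.mem_Iio] at hi hj
      have := hinj _ _ (by omega) (by omega) hij
      omega
    · have := hinj _ _ (by omega) (by omega) hij
      omega
    · intro S _ i hi hx hy Z
      by_contra hne
      have hZ := (hsupp _ _ hne).2.1
      exact hne (ht.apply_eq_zero h2 (hpair i hi) (swap_smul_of_notMem hx hy)
        (swap_smul_of_notMem (fun h => hx (hZ h)) fun h => hy (hZ h)))
    · intro S _ i hi hx hy hS Z
      have h3 := ht.apply_smul (hpair i hi) S Z
      rw [pairSwap, swap_smul_of_notMem_of_mem hx hy, hS] at h3
      exact neg_eq_zero.1 h3.symm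
  funext S Z
  by_contra hne
  exact hne (hall S (hsupp _ _ hne).1 Z)

theorem exists_smul_polyFun_eq [Fintype ι] (h2 : (2 : F) ≠ 0) {m k : ℕ} (hk : 0 < k) {u : ℕ → ι}
    (hu : IsTuple (2 * m + 4 * k) Finset.univ u) :
    ∃ π : MonoidAlgebra F (Equiv.Perm ι), π • polyFun F m k u = polyFun F m k u ∧
      (∀ t : FlagSpace F ι, (∀ S Z, (π • t) S Z ≠ 0 → S.card = m + 2 * k ∧ Z = ∅) → π • t = 0) ∧
      ∀ t : FlagSpace F ι, (∀ S Z, (π • t) S Z ≠ 0 → S.card = m + 2 * k ∧ Z ⊆ S ∧ Z.card = k) →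
        ∃ c : F, π • t = c • polyFun F m k u := by
  obtain ⟨π, hπ, hπ'⟩ := hasSignProjection_signSet h2 hu.1
  refine ⟨π, hπ _ (isSign_polyFun hu), fun t ht => ?_, fun t ht => ?_⟩
  · refine (hπ' t).eq_zero h2 hk hu (fun S Z hne => ?_) ?_
    · obtain ⟨h1, rfl⟩ := ht S Z hne
      exact ⟨h1, Finset.empty_subset _, Or.inr rfl⟩
    · by_contra hne
      have := card_blockPoints hu
      rw [(ht _ _ hne).2, Finset.card_empty] at this
      omega
  · refine ⟨(π • t) (firstPoints (m + 2 * k) u) (blockPoints m k u), sub_eq_zero.1 ?_⟩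
    generalize hc : (π • t) (firstPoints (m + 2 * k) u) (blockPoints m k u) = c
    have hsign : IsSign (signSet m k u) (π • t - c • polyFun F m k u) := by
      intro g hg
      rw [map_sub, hπ' t g hg, map_smul, isSign_polyFun hu g hg, smul_neg]
      abel
    refine hsign.eq_zero h2 hk hu (fun S Z hne => ?_) ?_
    · by_contra hcon
      have h3 : ¬(S.card = m + 2 * k ∧ Z ⊆ S ∧ Z.card = k) := by tauto
      refine hne ?_
      rw [Pi.sub_apply, Pi.sub_apply, Pi.smul_apply, Pi.smul_apply, polyFun_eq_zero hu h3,
        smul_zero, sub_zero]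
      by_contra h4
      exact h3 (ht S Z h4)
    · rw [Pi.sub_apply, Pi.sub_apply, Pi.smul_apply, Pi.smul_apply,
        polyFun_firstPoints_blockPoints hu, hc, smul_eq_mul, mul_one, sub_self]

end SignFunctions

section UpFunctions

open scoped Pointwise
open MonoidAlgebra (single)

variable {F ι : Type} [Field F] [DecidableEq ι]

/-- The indicator function of the `q`-subsets containing `K`. -/
def upFun (F : Type) [Field F] (q : ℕ) (K : Finset ι) : FlagSpace F ι :=
  fun S Z => if S.card = q ∧ Z = ∅ ∧ K ⊆ S then 1 else 0

theorem flagRep_upFun (g : Equiv.Perm ι) (q : ℕ) (K : Finset ι) :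
    flagRep F ι g (upFun F q K) = upFun F q (g • K) := by
  funext S Z
  simp only [flagRep_apply, upFun, Finset.card_smul_finset, Finset.smul_finset_eq_empty,
    Finset.subset_smul_finset_iff, inv_inv]

/-- Functions of `q`-subsets. -/
def subsetFunctions (F ι : Type) [Field F] [DecidableEq ι] (q : ℕ) :
    Submodule F (FlagSpace F ι) where
  carrier := {t | ∀ S Z, ¬(S.card = q ∧ Z = ∅) → t S Z = 0}
  add_mem' ha hb S Z h := by
    rw [Pi.add_apply, Pi.add_apply, ha S Z h, hb S Z h, add_zero]
  zero_mem' _ _ _ := rfl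
  smul_mem' c t ht S Z h := by
    rw [Pi.smul_apply, Pi.smul_apply, ht S Z h, smul_zero]

theorem flagRep_mem_subsetFunctions {q : ℕ} (g : Equiv.Perm ι) (t : FlagSpace F ι)
    (ht : t ∈ subsetFunctions F ι q) : flagRep F ι g t ∈ subsetFunctions F ι q := by
  intro S Z h
  rw [flagRep_apply]
  exact ht _ _ (by rwa [Finset.card_smul_finset, Finset.smul_finset_eq_empty])

theorem upFun_mem_subsetFunctions (q : ℕ) (K : Finset ι) :
    upFun F q K ∈ subsetFunctions F ι q :=
  fun _ _ h => if_neg fun h' => h ⟨h'.1, h'.2.1⟩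

theorem flagSingle_mem_subsetFunctions {q : ℕ} {S : Finset ι} (hS : S.card = q) :
    flagSingle S ∅ ∈ subsetFunctions F ι q :=
  fun _ _ h => if_neg fun h' => h ⟨by rw [h'.1, hS], h'.2⟩

variable (F ι) in
/-- The span of the functions `upFun F q K` with `|K| < q` and `|K| ≠ a`. -/
def upSpan (q a : ℕ) : Submodule F (FlagSpace F ι) :=
  Submodule.span F (upFun F q '' {K | K.card < q ∧ K.card ≠ a})

theorem upFun_mem_upSpan {q a : ℕ} {K : Finset ι} (h : K.card < q) (h' : K.card ≠ a) :
    upFun F q K ∈ upSpan F ι q a :=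
  Submodule.subset_span (Set.mem_image_of_mem _ ⟨h, h'⟩)

theorem upSpan_le (q a : ℕ) : upSpan F ι q a ≤ subsetFunctions F ι q := by
  rw [upSpan, Submodule.span_le]
  rintro _ ⟨K, -, rfl⟩
  exact upFun_mem_subsetFunctions q K

theorem flagRep_mem_upSpan {q a : ℕ} (g : Equiv.Perm ι) (t : FlagSpace F ι)
    (ht : t ∈ upSpan F ι q a) : flagRep F ι g t ∈ upSpan F ι q a := by
  refine Submodule.span_le (p := (upSpan F ι q a).comap (flagRep F ι g)) |>.2 ?_ ht
  rintro _ ⟨K, hK, rfl⟩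
  rw [SetLike.mem_coe, Submodule.mem_comap, flagRep_upFun]
  exact upFun_mem_upSpan (by rw [Finset.card_smul_finset]; exact hK.1)
    (by rw [Finset.card_smul_finset]; exact hK.2)

/-- The function of flags `(S, Z)` with `|Z| = k` which only depends on `S`. -/
def liftFun (k : ℕ) : FlagSpace F ι →ₗ[F] FlagSpace F ι where
  toFun t S Z := if Z ⊆ S ∧ Z.card = k then t S ∅ else 0
  map_add' t t' := by
    funext S Z
    simp only [Pi.add_apply]
    split_ifs <;> simp
  map_smul' c t := by
    funext S Z
    simp only [Pi.smul_apply]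
    split_ifs <;> simp

theorem liftFun_apply (k : ℕ) (t : FlagSpace F ι) (S Z : Finset ι) :
    liftFun k t S Z = if Z ⊆ S ∧ Z.card = k then t S ∅ else 0 := rfl

theorem liftFun_flagRep (k : ℕ) (g : Equiv.Perm ι) (t : FlagSpace F ι) :
    liftFun k (flagRep F ι g t) = flagRep F ι g (liftFun k t) := by
  funext S Z
  simp only [flagRep_apply, liftFun_apply, Finset.card_smul_finset, Finset.smul_finset_empty,
    Finset.smul_finset_subset_smul_finset_iff]

theorem eq_zero_of_liftFun_eq_zero {q k : ℕ} (hk : k ≤ q) {w : FlagSpace F ι}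
    (hw : w ∈ subsetFunctions F ι q) (h : liftFun k w = 0) : w = 0 := by
  funext S Z
  by_cases hS : S.card = q ∧ Z = ∅
  · obtain ⟨rfl, rfl⟩ := hS
    obtain ⟨Y, hY, hYk⟩ := Finset.exists_subset_card_eq hk
    have := congrFun (congrFun h S) Y
    rwa [liftFun_apply, if_pos ⟨hY, hYk⟩] at this
  · exact hw S Z hS

variable [Fintype ι]

theorem flagPairing_subsetFunctions {q : ℕ} {w : FlagSpace F ι} (hw : w ∈ subsetFunctions F ι q)
    (t : FlagSpace F ι) : flagPairing t w = ∑ S with S.card = q, t S ∅ * w S ∅ := by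
  rw [flagPairing_apply, Finset.sum_filter]
  refine Finset.sum_congr rfl fun S _ => ?_
  rw [Finset.sum_eq_single ∅ (fun Z _ hZ => by rw [hw S Z fun h => hZ h.2, mul_zero]) (by simp)]
  split_ifs with h
  · rfl
  · rw [hw S ∅ fun h' => h h'.1, mul_zero]

theorem flagPairing_upFun {q : ℕ} {w : FlagSpace F ι} (hw : w ∈ subsetFunctions F ι q)
    (K : Finset ι) : flagPairing (upFun F q K) w = ∑ S with K ⊆ S, w S ∅ := by
  rw [flagPairing_subsetFunctions hw, Finset.sum_filter, Finset.sum_filter]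
  refine Finset.sum_congr rfl fun S _ => ?_
  by_cases hS : S.card = q
  · simp [upFun, hS]
  · simp [hS, hw S ∅ fun h => hS h.1]

theorem flagPairing_polyFun_congr {m k : ℕ} {u : ℕ → ι}
    (hu : IsTuple (2 * m + 4 * k) Finset.univ u) {t t' : FlagSpace F ι}
    (h : AgreeOn (m + 2 * k) k Finset.univ t t') :
    flagPairing t (polyFun F m k u) = flagPairing t' (polyFun F m k u) := by
  have := flagPairing_polyFun_of_agreeOn (F := F) hu (t := t - t') fun S Z h1 h2 h3 h4 => by
    rw [Pi.sub_apply, Pi.sub_apply, h S Z h1 h2 h3 h4, sub_self]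
    rfl
  rwa [map_sub, LinearMap.sub_apply, sub_eq_zero] at this

theorem polyFun_mem_subsetFunctions {q : ℕ} {u : ℕ → ι} (hu : IsTuple (2 * q) Finset.univ u) :
    polyFun F q 0 u ∈ subsetFunctions F ι q :=
  fun _ _ h => polyFun_eq_zero (k := 0) hu fun h' => h ⟨h'.1, Finset.card_eq_zero.1 h'.2.2⟩

theorem flagPairing_upFun_polyFun {q : ℕ} {u : ℕ → ι} (hu : IsTuple (2 * q) Finset.univ u)
    {K : Finset ι} (hK : K.card < q) : flagPairing (upFun F q K) (polyFun F q 0 u) = 0 := by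
  rw [← flagPairing_intermediateSum (k := 0) hu fun K' Z => if K' = K then 1 else 0]
  refine flagPairing_polyFun_congr (k := 0) hu fun S Z _ hS _ hZ => ?_
  obtain rfl := Finset.card_eq_zero.1 hZ
  have hne : S ≠ K := by
    rintro rfl
    omega
  simp [upFun, intermediateSum, show S.card = q from hS, hne]

theorem flagPairing_upSpan_polyFun {q a : ℕ} {u : ℕ → ι} (hu : IsTuple (2 * q) Finset.univ u)
    {t : FlagSpace F ι} (ht : t ∈ upSpan F ι q a) : flagPairing t (polyFun F q 0 u) = 0 := by
  refine Submodule.span_le (p := LinearMap.ker (flagPairing.flip (polyFun F q 0 u))) |>.2 ?_ ht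
  rintro _ ⟨K, hK, rfl⟩
  exact flagPairing_upFun_polyFun hu hK.1

theorem exists_eq_sum_upFun (h2 : (2 : F) ≠ 0) [Nonempty ι] {q : ℕ} (hq : 2 * q ≤ Fintype.card ι)
    {w : FlagSpace F ι} (hw : w ∈ subsetFunctions F ι q)
    (h : ∀ u, IsTuple (2 * q) Finset.univ u → flagPairing w (polyFun F q 0 u) = 0) :
    ∃ y : Finset ι → F, w = ∑ K with K.card < q, y K • upFun F q K := by
  obtain ⟨f, y, hy⟩ := (killed_of_flagEval_polytabloid (m := q) (k := 0) h2 hq h).representable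
  refine ⟨fun K => y K ∅, ?_⟩
  funext S Z
  by_cases hS : S.card = q ∧ Z = ∅
  · obtain ⟨hS, rfl⟩ := hS
    rw [hy S ∅ (Finset.subset_univ _) hS (Finset.empty_subset _) rfl]
    simp only [Pi.add_apply, properSubsetSum, intermediateSum, Finset.sum_apply, Pi.smul_apply,
      Finset.powerset_empty, Finset.sum_singleton, sub_self, zero_add, Finset.empty_subset, if_true,
      upFun, hS, true_and, smul_eq_mul, mul_ite, mul_one, mul_zero]
    rw [← Finset.sum_filter, ← Finset.sum_erase_eq_sub (Finset.mem_powerset_self S)]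
    refine Finset.sum_congr (Finset.ext fun K => ?_) fun _ _ => rfl
    simp only [Finset.mem_erase, Finset.mem_powerset, Finset.mem_filter, Finset.mem_univ, true_and]
    constructor
    · rintro ⟨h1, h3⟩
      exact ⟨hS ▸ Finset.card_lt_card (h3.ssubset_of_ne h1), h3⟩
    · rintro ⟨h1, h3⟩
      refine ⟨?_, h3⟩
      rintro rfl
      omega
  · rw [hw S Z hS]
    exact ((subsetFunctions F ι q).sum_mem fun K _ => Submodule.smul_mem _ _
      (upFun_mem_subsetFunctions q K)) S Z hS |>.symm

end UpFunctions

section FlagFunctions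

open scoped Pointwise
open MonoidAlgebra (single)

theorem IsTuple.comp {ι : Type} [Fintype ι] {N : ℕ} {u : ℕ → ι}
    (hu : IsTuple N Finset.univ u) (g : Equiv.Perm ι) :
    IsTuple N Finset.univ fun i => g (u i) :=
  ⟨g.injective.comp_injOn hu.1, fun _ _ => Finset.mem_univ _⟩

theorem card_filter_superset {ι : Type} [DecidableEq ι] {K C : Finset ι} (hK : K ⊆ C)
    {p : ℕ} (hp : K.card ≤ p) :
    ((C.powersetCard p).filter fun S => K ⊆ S).card =
      (C.card - K.card).choose (p - K.card) := by
  rw [← Finset.card_sdiff_of_subset hK, ← Finset.card_powersetCard]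
  refine Finset.card_bij' (fun S _ => S \ K) (fun S _ => S ∪ K) ?_ ?_ ?_ ?_
  · intro S hS
    simp only [Finset.mem_filter, Finset.mem_powersetCard] at hS ⊢
    refine ⟨Finset.sdiff_subset_sdiff hS.1.1 subset_rfl, ?_⟩
    rw [Finset.card_sdiff_of_subset hS.2, hS.1.2]
  · intro S hS
    simp only [Finset.mem_filter, Finset.mem_powersetCard] at hS ⊢
    refine ⟨⟨Finset.union_subset (hS.1.trans Finset.sdiff_subset) hK, ?_⟩,
      Finset.subset_union_right⟩
    rw [Finset.card_union_of_disjoint (Finset.disjoint_of_subset_left hS.1 Finset.sdiff_disjoint),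
      hS.2]
    omega
  · intro S hS
    exact Finset.sdiff_union_of_subset (Finset.mem_filter.1 hS).2
  · intro S hS
    rw [Finset.union_sdiff_right]
    exact Finset.sdiff_eq_self_of_disjoint
      (Finset.disjoint_of_subset_left (Finset.mem_powersetCard.1 hS).1 Finset.sdiff_disjoint)

variable {F ι : Type} [Field F] [DecidableEq ι]

theorem firstPoints_succ (m : ℕ) (u : ℕ → ι) :
    firstPoints (m + 1) u = insert (u 0) (firstPoints m fun i => u (i + 2)) := by
  ext z
  simp only [firstPoints, Finset.mem_image, Finset.mem_range, Finset.mem_insert]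
  constructor
  · rintro ⟨_ | i, hi, rfl⟩
    · exact Or.inl rfl
    · exact Or.inr ⟨i, by omega, rfl⟩
  · rintro (rfl | ⟨i, hi, rfl⟩)
    · exact ⟨0, by omega, rfl⟩
    · exact ⟨i + 1, by omega, rfl⟩

variable [Fintype ι]

theorem flagEval_polytabloid_mul_single (t : FlagSpace F ι) (m : ℕ) :
    ∀ (u : ℕ → ι) (B : Finset ι), IsTuple (2 * m) Finset.univ u → (∀ i < 2 * m, u i ∉ B) →
    (∀ i < m, ∀ S, u (2 * i) ∉ S → u (2 * i + 1) ∉ S →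
      t (insert (u (2 * i + 1)) S) ∅ = -t (insert (u (2 * i)) S) ∅) →
    flagEval t (polytabloid F m 0 u * single ⟨B, ∅⟩ 1) = 2 ^ m * t (firstPoints m u ∪ B) ∅ := by
  induction m with
  | zero =>
    intro u B _ _ _
    rw [polytabloid, one_mul, flagEval_single]
    simp [firstPoints]
  | succ m ih =>
    intro u B hu hB ht
    have hu' : IsTuple (2 * m) Finset.univ fun i => u (i + 2) :=
      (IsTuple.tail (IsTuple.tail hu)).mono (Finset.subset_univ _)
    have hne : ∀ i < 2 * m, ∀ j < 2, u (i + 2) ≠ u j := fun i hi j hj h => by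
      have := hu.1 (show i + 2 < _ by omega) (show j < _ by omega) h
      omega
    have hnot : ∀ j < 2, u j ∉ firstPoints m (fun i => u (i + 2)) ∪ B := fun j hj h => by
      rcases Finset.mem_union.1 h with h | h
      · obtain ⟨i, hi, h⟩ := Finset.mem_image.1 h
        exact hne (2 * i) (by have := Finset.mem_range.1 hi; omega) j hj h
      · exact hB j (by omega) h
    have key : ∀ j < 2, flagEval t (polytabloid F m 0 (fun i => u (i + 2)) *
        single ⟨insert (u j) B, ∅⟩ 1) =
        2 ^ m * t (insert (u j) (firstPoints m (fun i => u (i + 2)) ∪ B)) ∅ := fun j hj => by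
      rw [ih _ (insert (u j) B) hu' (fun i hi => ?_) fun i hi => ht (i + 1) (by omega),
        Finset.union_insert]
      rw [Finset.mem_insert, not_or]
      exact ⟨hne i hi j hj, hB _ (by omega)⟩
    have hmul : polytabloid F (m + 1) 0 u * single ⟨B, ∅⟩ 1 =
        polytabloid F m 0 (fun i => u (i + 2)) * single ⟨insert (u 0) B, ∅⟩ 1 -
          polytabloid F m 0 (fun i => u (i + 2)) * single ⟨insert (u 1) B, ∅⟩ 1 := by
      have h : ∀ a : ι, (single ⟨insert a B, ∅⟩ 1 : FlagRing F ι) =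
          flagX F a * single ⟨B, ∅⟩ 1 := fun a => by
        rw [flagX, MonoidAlgebra.single_mul_single, SubsetPair.mk_mul_mk, mul_one,
          Finset.empty_union, Finset.insert_eq]
      rw [polytabloid, pairElt, h, h]
      ring
    have hsign := ht 0 (by omega) _ (hnot 0 (by omega)) (hnot 1 (by omega))
    simp only [mul_zero, zero_add] at hsign
    rw [hmul, map_sub, key 0 (by omega), key 1 (by omega), hsign, firstPoints_succ,
      Finset.insert_union]
    ring

theorem flagPairing_polyFun_self {q : ℕ} {u : ℕ → ι} (hu : IsTuple (2 * q) Finset.univ u) :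
    flagPairing (polyFun F q 0 u) (polyFun F q 0 u) = 2 ^ q := by
  have h := flagEval_polytabloid_mul_single (polyFun F q 0 u) q u ∅ hu (by simp)
      fun i hi S h h' => by
    have h1 := (isSign_polyFun (F := F) (m := q) (k := 0) hu).apply_smul
      (Or.inl ⟨i, by omega, rfl⟩ : pairSwap u i ∈ _) (insert (u (2 * i)) S) ∅
    rw [pairSwap, Equiv.swap_comm, swap_smul_of_notMem_of_mem _ (Finset.mem_insert_self _ _),
      Finset.erase_insert h, Finset.smul_finset_empty] at h1
    · exact h1
    · rw [Finset.mem_insert, not_or]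
      refine ⟨fun h => ?_, h'⟩
      have := hu.1 (show 2 * i + 1 < _ by omega) (show 2 * i < _ by omega) h
      omega
  have h1 := polyFun_firstPoints_blockPoints (F := F) (m := q) (k := 0) hu
  rw [flagPairing_polyFun]
  rw [← SubsetPair.one_def, ← MonoidAlgebra.one_def, mul_one, Finset.union_empty] at h
  rw [h]
  simp only [blockPoints, Finset.range_zero, Finset.image_empty, mul_zero, add_zero] at h1
  rw [h1, mul_one]

variable (F ι) in
/-- The span of the functions `polyFun F m k u`. -/
def polySpan (m k : ℕ) : Submodule F (FlagSpace F ι) :=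
  Submodule.span F {t | ∃ u, IsTuple (2 * m + 4 * k) Finset.univ u ∧ t = polyFun F m k u}

theorem polyFun_mem_polySpan {m k : ℕ} {u : ℕ → ι} (hu : IsTuple (2 * m + 4 * k) Finset.univ u) :
    polyFun F m k u ∈ polySpan F ι m k :=
  Submodule.subset_span ⟨u, hu, rfl⟩

theorem polySpan_induction {m k : ℕ} {p : Submodule F (FlagSpace F ι)}
    (h : ∀ u, IsTuple (2 * m + 4 * k) Finset.univ u → polyFun F m k u ∈ p) :
    polySpan F ι m k ≤ p := by
  rw [polySpan, Submodule.span_le]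
  rintro _ ⟨u, hu, rfl⟩
  exact h u hu

theorem flagRep_mem_polySpan {m k : ℕ} (g : Equiv.Perm ι) (t : FlagSpace F ι)
    (ht : t ∈ polySpan F ι m k) : flagRep F ι g t ∈ polySpan F ι m k := by
  refine polySpan_induction (p := (polySpan F ι m k).comap (flagRep F ι g)) (fun u hu => ?_) ht
  rw [Submodule.mem_comap, flagRep_polyFun]
  exact polyFun_mem_polySpan (hu.comp g)

theorem polySpan_apply_eq_zero {m k : ℕ} {t : FlagSpace F ι} (ht : t ∈ polySpan F ι m k)
    {S Z : Finset ι} (h : ¬(S.card = m + 2 * k ∧ Z ⊆ S ∧ Z.card = k)) : t S Z = 0 := by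
  have := polySpan_induction (p := LinearMap.ker (flagPairing.flip (flagSingle S Z)))
    (fun u hu => ?_) ht
  · rwa [LinearMap.mem_ker, LinearMap.flip_apply, flagPairing_flagSingle] at this
  · rw [LinearMap.mem_ker, LinearMap.flip_apply, flagPairing_flagSingle, polyFun_eq_zero hu h]

theorem sum_polySpan_insert {m k : ℕ} {t : FlagSpace F ι} (ht : t ∈ polySpan F ι m (k + 1))
    {S Y : Finset ι} (hS : S.card = m + 2 * (k + 1)) (hY : Y.card = k) (hYS : Y ⊆ S) :
    ∑ z ∈ S \ Y, t S (insert z Y) = 0 := by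
  have h1 : ∀ t : FlagSpace F ι, ∑ z ∈ S \ Y, t S (insert z Y) =
      flagPairing (∑ z ∈ S \ Y, flagSingle S (insert z Y)) t := fun t => by
    rw [map_sum, LinearMap.sum_apply]
    refine Finset.sum_congr rfl fun z _ => ?_
    rw [flagPairing_comm, flagPairing_flagSingle]
  rw [h1]
  refine polySpan_induction
    (p := LinearMap.ker (flagPairing (∑ z ∈ S \ Y, flagSingle S (insert z Y)))) (fun u hu => ?_) ht
  rw [LinearMap.mem_ker, ← flagPairing_properSubsetSum hu (flagSingle S Y)]
  refine flagPairing_polyFun_congr hu fun S' Z _ hS' hZ hk => ?_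
  simp only [Finset.sum_apply, flagSingle, properSubsetSum]
  have hZY : Z ≠ Y := by
    rintro rfl
    omega
  by_cases hSS : S' = S
  · subst hSS
    simp only [true_and, hZY, if_false, sub_zero, Finset.sum_ite_eq', Finset.mem_powerset]
    by_cases hYZ : Y ⊆ Z
    · obtain ⟨z, hz⟩ := Finset.card_eq_one.1 (show (Z \ Y).card = 1 by
        rw [Finset.card_sdiff_of_subset hYZ]
        omega)
      have hzZ : z ∈ Z \ Y := hz ▸ Finset.mem_singleton_self z
      have hZz : Z = insert z Y := by
        rw [Finset.insert_eq, ← hz, Finset.sdiff_union_of_subset hYZ]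
      rw [Finset.mem_sdiff] at hzZ
      rw [if_pos hYZ, Finset.sum_eq_single z, if_pos hZz]
      · intro z' hz' hne
        refine if_neg fun h => hne ?_
        have : z' ∈ insert z Y := hZz ▸ h ▸ Finset.mem_insert_self z' Y
        exact (Finset.mem_insert.1 this).resolve_right (Finset.mem_sdiff.1 hz').2
      · exact fun h => absurd (Finset.mem_sdiff.2 ⟨hZ hzZ.1, hzZ.2⟩) h
    · rw [if_neg hYZ]
      refine Finset.sum_eq_zero fun z _ => if_neg ?_
      rintro rfl
      exact hYZ (Finset.subset_insert _ _)
  · simp [hSS]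

end FlagFunctions

section LiftedFunctions

open scoped Pointwise

variable {F ι : Type} [Field F] [DecidableEq ι]

theorem sum_properSubsetSum (p : ℕ) [hp : Fact p.Prime] [CharP F p] {m k : ℕ} (hk : k < p)
    (hmk : m + k + 1 = p) (f : FlagSpace F ι) {S : Finset ι} (hS : S.card = m + 2 * k) :
    ∑ Z ∈ S.powersetCard k, properSubsetSum f S Z = 0 := by
  have h1 : ∀ Z ∈ S.powersetCard k, properSubsetSum f S Z =
      ∑ Y ∈ S.powerset with Y.card < k, if Y ⊆ Z then f S Y else 0 := fun Z hZ => by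
    rw [Finset.mem_powersetCard] at hZ
    rw [properSubsetSum, ← Finset.sum_erase_eq_sub (Finset.mem_powerset_self Z),
      ← Finset.sum_filter]
    refine Finset.sum_congr (Finset.ext fun Y => ?_) fun _ _ => rfl
    simp only [Finset.mem_erase, Finset.mem_powerset, Finset.mem_filter]
    constructor
    · rintro ⟨h, h'⟩
      exact ⟨⟨h'.trans hZ.1, hZ.2 ▸ Finset.card_lt_card (h'.ssubset_of_ne h)⟩, h'⟩
    · rintro ⟨⟨-, h⟩, h'⟩
      refine ⟨?_, h'⟩
      rintro rfl
      omega
  rw [Finset.sum_congr rfl h1, Finset.sum_comm]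
  refine Finset.sum_eq_zero fun Y hY => ?_
  rw [Finset.mem_filter, Finset.mem_powerset] at hY
  rw [← Finset.sum_filter, Finset.sum_const, card_filter_superset hY.1 hY.2.le, hS, nsmul_eq_mul,
    (CharP.cast_eq_zero_iff F p _).2 (hp.out.dvd_choose (by omega) (by omega) (by omega)), zero_mul]

/-- A function on `k`-subsets which does not change when exchanging one element is constant. -/
theorem eq_of_exchange {α : Type} {k : ℕ} {S : Finset ι} {h : Finset ι → α}
    (hex : ∀ Y ⊆ S, Y.card + 1 = k → ∀ z ∈ S \ Y, ∀ z' ∈ S \ Y, h (insert z Y) = h (insert z' Y))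
    {Z Z' : Finset ι} (hZ : Z ⊆ S) (hZ' : Z' ⊆ S) (hk : Z.card = k) (hk' : Z'.card = k) :
    h Z = h Z' := by
  induction hn : (Z' \ Z).card generalizing Z with
  | zero =>
    rw [Finset.card_eq_zero, Finset.sdiff_eq_empty_iff_subset] at hn
    rw [Finset.eq_of_subset_of_card_le hn (by omega)]
  | succ n ih =>
    obtain ⟨z, hz⟩ := Finset.card_pos.1 (show 0 < (Z' \ Z).card by omega)
    obtain ⟨y, hy⟩ := Finset.card_pos.1 (show 0 < (Z \ Z').card by
      have := Finset.card_sdiff_add_card_inter Z Z'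
      have := Finset.card_sdiff_add_card_inter Z' Z
      rw [Finset.inter_comm] at this
      omega)
    rw [Finset.mem_sdiff] at hz hy
    have hzY : z ∉ Z.erase y := fun h => hz.2 (Finset.mem_of_mem_erase h)
    have hYS : Z.erase y ⊆ S := (Finset.erase_subset _ _).trans hZ
    have hYc : (Z.erase y).card + 1 = k := by rw [Finset.card_erase_add_one hy.1, hk]
    have h1 := hex (Z.erase y) hYS hYc y (by simp [hZ hy.1]) z
      (Finset.mem_sdiff.2 ⟨hZ' hz.1, hzY⟩)
    rw [Finset.insert_erase hy.1] at h1
    rw [h1]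
    refine ih (Finset.insert_subset (hZ' hz.1) hYS)
      (by rw [Finset.card_insert_of_notMem hzY, hYc]) ?_
    have h3 : Z' \ insert z (Z.erase y) = (Z' \ Z).erase z := by
      ext x
      simp only [Finset.mem_sdiff, Finset.mem_insert, Finset.mem_erase, not_or, not_and]
      constructor
      · rintro ⟨h4, h5, h6⟩
        exact ⟨h5, h4, h6 fun h => hy.2 (h ▸ h4)⟩
      · rintro ⟨h4, h5, h6⟩
        exact ⟨h5, h4, fun _ => h6⟩
    rw [h3, Finset.card_erase_of_mem (Finset.mem_sdiff.2 hz), hn]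
    rfl

variable [Fintype ι]

theorem flagPairing_liftFun (k : ℕ) (t w : FlagSpace F ι) : flagPairing t (liftFun k w) =
    ∑ S, ∑ Z ∈ S.powersetCard k, t S Z * w S ∅ := by
  rw [flagPairing_apply]
  refine Finset.sum_congr rfl fun S _ => ?_
  have : S.powersetCard k = Finset.univ.filter fun Z => Z ⊆ S ∧ Z.card = k := by
    ext Z
    simp
  rw [this, Finset.sum_filter]
  refine Finset.sum_congr rfl fun Z _ => ?_
  rw [liftFun_apply, mul_ite, mul_zero]

theorem flagPairing_intermediateSum_liftFun {q k : ℕ} (y : FlagSpace F ι) {w : FlagSpace F ι}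
    (hw : w ∈ subsetFunctions F ι q)
    (h : ∀ K : Finset ι, k ≤ K.card → K.card < q → flagPairing (upFun F q K) w = 0) :
    flagPairing (intermediateSum y) (liftFun k w) = 0 := by
  have h1 : ∀ S Z, intermediateSum y S Z * liftFun k w S Z =
      ∑ K, if Z.card = k ∧ Z ⊆ K ∧ K.card < q then y K Z * (if K ⊆ S then w S ∅ else 0) else 0 := by
    intro S Z
    by_cases hS : S.card = q
    · rw [intermediateSum, liftFun_apply]
      have e1 : ∑ K ∈ S.powerset, (if Z ⊆ K then y K Z else 0) - y S Z =
          ∑ K ∈ S.powerset.erase S, (if Z ⊆ K then y K Z else 0) +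
            ((if Z ⊆ S then y S Z else 0) - y S Z) := by
        rw [← Finset.sum_erase_add _ _ (Finset.mem_powerset_self S)]
        ring
      rw [e1]
      have e2 : S.powerset.erase S = Finset.univ.filter fun K => K ⊆ S ∧ K.card < q := by
        ext K
        simp only [Finset.mem_erase, Finset.mem_powerset, Finset.mem_filter, Finset.mem_univ,
          true_and]
        constructor
        · rintro ⟨h, h'⟩
          exact ⟨h', hS ▸ Finset.card_lt_card (h'.ssubset_of_ne h)⟩
        · rintro ⟨h, h'⟩
          refine ⟨?_, h⟩
          rintro rfl
          omega
      rw [e2, Finset.sum_filter]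
      by_cases hZ : Z ⊆ S ∧ Z.card = k
      · rw [if_pos hZ, if_pos hZ.1, sub_self, add_zero, Finset.sum_mul]
        refine Finset.sum_congr rfl fun K _ => ?_
        by_cases hKS : K ⊆ S <;> by_cases hK : K.card < q <;> by_cases hZK : Z ⊆ K <;>
          simp [hKS, hK, hZK, hZ.2]
      · rw [if_neg hZ, mul_zero]
        refine (Finset.sum_eq_zero fun K _ => ?_).symm
        by_cases hKS : K ⊆ S
        · exact if_neg fun h => hZ ⟨h.2.1.trans hKS, h.1⟩
        · simp [hKS]
    · have hw0 : w S ∅ = 0 := hw S ∅ fun h => hS h.1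
      simp [liftFun_apply, hw0]
  rw [flagPairing_apply]
  simp only [h1]
  rw [Finset.sum_comm]
  refine Finset.sum_eq_zero fun Z _ => ?_
  rw [Finset.sum_comm]
  refine Finset.sum_eq_zero fun K _ => ?_
  by_cases hK : Z.card = k ∧ Z ⊆ K ∧ K.card < q
  · simp only [if_pos hK]
    rw [← Finset.mul_sum, ← Finset.sum_filter, ← flagPairing_upFun hw,
      h K (hK.1 ▸ Finset.card_le_card hK.2.1) hK.2.2, mul_zero]
  · simp [hK]

theorem liftFun_mem_polySpan (p : ℕ) [hp : Fact p.Prime] [CharP F p] (h2 : (2 : F) ≠ 0)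
    [Nonempty ι] {m k : ℕ} (hk : k < p) (hmk : m + k + 1 = p)
    (hcard : 2 * m + 4 * k ≤ Fintype.card ι) {w : FlagSpace F ι}
    (hw : w ∈ subsetFunctions F ι (m + 2 * k))
    (h : ∀ K : Finset ι, k ≤ K.card → K.card < m + 2 * k →
      flagPairing (upFun F (m + 2 * k) K) w = 0) : liftFun k w ∈ polySpan F ι m k := by
  by_contra hcon
  obtain ⟨φ, hφ, hφ'⟩ := Submodule.exists_le_ker_of_notMem hcon
  refine hφ ?_
  rw [eq_flagPairing φ]
  set t : FlagSpace F ι := fun S Z => φ (flagSingle S Z) with ht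
  obtain ⟨f, y, hfy⟩ := (killed_of_flagEval_polytabloid (t := t) h2 hcard fun u hu => by
    rw [← flagPairing_polyFun, ← eq_flagPairing φ]
    exact hφ' (polyFun_mem_polySpan hu)).representable
  have h1 : flagPairing t (liftFun k w) =
      flagPairing (properSubsetSum f + intermediateSum y) (liftFun k w) := by
    rw [flagPairing_liftFun, flagPairing_liftFun]
    refine Finset.sum_congr rfl fun S _ => Finset.sum_congr rfl fun Z hZ => ?_
    rw [Finset.mem_powersetCard] at hZ
    by_cases hS : S.card = m + 2 * k
    · rw [hfy S Z (Finset.subset_univ _) hS hZ.1 hZ.2]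
    · rw [hw S ∅ fun h => hS h.1, mul_zero, mul_zero]
  rw [h1, map_add, LinearMap.add_apply, flagPairing_intermediateSum_liftFun y hw h, add_zero,
    flagPairing_liftFun]
  refine Finset.sum_eq_zero fun S _ => ?_
  rw [← Finset.sum_mul]
  by_cases hS : S.card = m + 2 * k
  · rw [sum_properSubsetSum p hk hmk f hS, zero_mul]
  · rw [hw S ∅ fun h => hS h.1, mul_zero]

theorem exists_eq_liftFun (p : ℕ) [CharP F p] (h2 : (2 : F) ≠ 0) {m k : ℕ}
    (hmk : m + (k + 1) + 1 = p) (S₀ : Finset ι) {t : FlagSpace F ι}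
    (ht : t ∈ polySpan F ι m (k + 1))
    (h : ∀ g : Equiv.Perm ι, g • S₀ = S₀ → ∃ w : FlagSpace F ι,
      flagRep F ι g t - t = liftFun (k + 1) w) :
    ∃ w ∈ subsetFunctions F ι (m + 2 * (k + 1)), t = liftFun (k + 1) w := by
  have hstab : ∀ g : Equiv.Perm ι, g • S₀ = S₀ → g * g = 1 → ∀ S Z : Finset ι, g • S = S →
      t S (g • Z) = t S Z := by
    intro g hg hg2 S Z hS
    have hinv : g⁻¹ = g := inv_eq_of_mul_eq_one_right hg2
    obtain ⟨w, hw⟩ := h g hg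
    by_cases hZ : Z ⊆ S ∧ Z.card = k + 1
    · have hgZ : g • Z ⊆ S ∧ (g • Z).card = k + 1 := by
        rw [Finset.card_smul_finset]
        refine ⟨?_, hZ.2⟩
        have := Finset.smul_finset_subset_smul_finset (a := g) hZ.1
        rwa [hS] at this
      have e1 := congrFun (congrFun hw S) Z
      have e2 := congrFun (congrFun hw S) (g • Z)
      rw [Pi.sub_apply, Pi.sub_apply, flagRep_apply, liftFun_apply, hinv, hS] at e1 e2
      rw [if_pos hZ] at e1
      rw [if_pos hgZ, smul_smul, hg2, one_smul, ← e1] at e2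
      have e3 : 2 * (t S (g • Z) - t S Z) = 0 := by linear_combination -e2
      exact sub_eq_zero.1 ((mul_eq_zero.1 e3).resolve_left h2)
    · rw [polySpan_apply_eq_zero ht fun h => hZ h.2, polySpan_apply_eq_zero ht]
      rintro ⟨-, h1, h3⟩
      rw [Finset.card_smul_finset] at h3
      refine hZ ⟨?_, h3⟩
      rwa [← hS, Finset.smul_finset_subset_smul_finset_iff] at h1
  have hex : ∀ S : Finset ι, S.card = m + 2 * (k + 1) → ∀ Y ⊆ S, Y.card + 1 = k + 1 →
      ∀ z ∈ S \ Y, ∀ z' ∈ S \ Y, t S (insert z Y) = t S (insert z' Y) := by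
    intro S hS Y hY hYk
    have hsame : ∀ z ∈ S \ Y, ∀ z' ∈ S \ Y, (z ∈ S₀ ↔ z' ∈ S₀) →
        t S (insert z Y) = t S (insert z' Y) := by
      intro z hz z' hz' hzz
      rw [Finset.mem_sdiff] at hz hz'
      have h1 : Equiv.swap z z' • S₀ = S₀ := by
        by_cases h : z ∈ S₀
        · exact swap_smul_of_mem h (hzz.1 h)
        · exact swap_smul_of_notMem h fun h' => h (hzz.2 h')
      have h3 := hstab _ h1 (Equiv.swap_mul_self _ _) S (insert z Y) (swap_smul_of_mem hz.1 hz'.1)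
      rw [← h3, Finset.smul_finset_insert, swap_smul_of_notMem hz.2 hz'.2, Equiv.Perm.smul_def,
        Equiv.swap_apply_left]
    have hsum := sum_polySpan_insert ht hS (by omega) hY
    have hc : (S \ Y).card = p := by
      rw [Finset.card_sdiff_of_subset hY]
      omega
    have hmixed : ∀ z ∈ S \ Y, ∀ z' ∈ S \ Y, z ∈ S₀ → z' ∉ S₀ →
        t S (insert z Y) = t S (insert z' Y) := by
      intro z hz z' hz' hzS hzS'
      rw [← Finset.sum_filter_add_sum_filter_not _ (· ∈ S₀),
        Finset.sum_congr rfl fun x hx => hsame x (Finset.mem_filter.1 hx).1 z hz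
          (iff_of_true (Finset.mem_filter.1 hx).2 hzS),
        Finset.sum_congr rfl fun x hx => hsame x (Finset.mem_filter.1 hx).1 z' hz'
          (iff_of_false (Finset.mem_filter.1 hx).2 hzS'), Finset.sum_const, Finset.sum_const,
        nsmul_eq_mul, nsmul_eq_mul] at hsum
      have hadd := Finset.card_filter_add_card_filter_not (s := S \ Y) (· ∈ S₀)
      have hpos : 0 < ((S \ Y).filter (· ∈ S₀)).card :=
        Finset.card_pos.2 ⟨z, Finset.mem_filter.2 ⟨hz, hzS⟩⟩
      have hpos' : 0 < ((S \ Y).filter (· ∉ S₀)).card :=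
        Finset.card_pos.2 ⟨z', Finset.mem_filter.2 ⟨hz', hzS'⟩⟩
      generalize ((S \ Y).filter (· ∈ S₀)).card = i at *
      generalize ((S \ Y).filter (· ∉ S₀)).card = j at *
      have hij : (j : F) = -i := by
        have : ((i + j : ℕ) : F) = 0 := by rw [hadd, hc, CharP.cast_eq_zero]
        push_cast at this
        linear_combination this
      have hi : (i : F) ≠ 0 := fun h0 => by
        have := Nat.le_of_dvd hpos ((CharP.cast_eq_zero_iff F p i).1 h0)
        omega
      rw [hij] at hsum
      have : (i : F) * (t S (insert z Y) - t S (insert z' Y)) = 0 := by linear_combination hsum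
      exact sub_eq_zero.1 ((mul_eq_zero.1 this).resolve_left hi)
    intro z hz z' hz'
    by_cases h1 : z ∈ S₀ <;> by_cases h3 : z' ∈ S₀
    · exact hsame z hz z' hz' (iff_of_true h1 h3)
    · exact hmixed z hz z' hz' h1 h3
    · exact (hmixed z' hz' z hz h3 h1).symm
    · exact hsame z hz z' hz' (iff_of_false h1 h3)
  have hchoose : ∀ S : Finset ι, S.card = m + 2 * (k + 1) → ∃ Z ⊆ S, Z.card = k + 1 :=
    fun S hS => Finset.exists_subset_card_eq (by omega)
  choose! Z hZS hZk using hchoose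
  refine ⟨fun S Y => if S.card = m + 2 * (k + 1) ∧ Y = ∅ then t S (Z S) else 0,
    fun S Y h => if_neg h, ?_⟩
  funext S Y
  rw [liftFun_apply]
  by_cases hS : S.card = m + 2 * (k + 1)
  · by_cases hY : Y ⊆ S ∧ Y.card = k + 1
    · rw [if_pos hY, if_pos ⟨hS, rfl⟩]
      exact eq_of_exchange (h := t S) (hex S hS) hY.1 (hZS S hS) hY.2 (hZk S hS)
    · rw [if_neg hY, polySpan_apply_eq_zero ht fun h => hY h.2]
  · rw [polySpan_apply_eq_zero ht (S := S) (Z := Y) fun h' => hS h'.1]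
    simp [hS]

end LiftedFunctions

section StabilizerInvariants

open scoped Pointwise
open MonoidAlgebra (single)

variable {F ι : Type} [Field F] [DecidableEq ι] [Fintype ι]

theorem flagRep_swap_polyFun {q i : ℕ} {u : ℕ → ι} (hu : IsTuple (2 * q) Finset.univ u)
    (hi : i < q) : flagRep F ι (Equiv.swap (u (2 * i)) (u (2 * i + 1))) (polyFun F q 0 u) =
      -polyFun F q 0 u :=
  isSign_polyFun (m := q) (k := 0) hu _ (Or.inl ⟨i, hi, rfl⟩)

theorem flagPairing_polyFun_eq_zero_of_stabilizer (h2 : (2 : F) ≠ 0) {q a : ℕ} {u₀ : ℕ → ι}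
    (hu₀ : IsTuple (2 * q) Finset.univ u₀) {w : FlagSpace F ι}
    (hw : ∀ g : Equiv.Perm ι, g • firstPoints q u₀ = firstPoints q u₀ →
      flagRep F ι g w - w ∈ upSpan F ι q a)
    (h0 : flagPairing w (polyFun F q 0 u₀) = 0) {u : ℕ → ι} (hu : IsTuple (2 * q) Finset.univ u) :
    flagPairing w (polyFun F q 0 u) = 0 := by
  have hstab : ∀ g : Equiv.Perm ι, g • firstPoints q u₀ = firstPoints q u₀ →
      ∀ v, IsTuple (2 * q) Finset.univ v →
      flagPairing (flagRep F ι g w) (polyFun F q 0 v) = flagPairing w (polyFun F q 0 v) := by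
    intro g hg v hv
    have := flagPairing_upSpan_polyFun hv (hw g hg)
    rwa [map_sub, LinearMap.sub_apply, sub_eq_zero] at this
  induction hn : ((Finset.range q).filter fun i => u (2 * i) ∉ firstPoints q u₀).card
    using Nat.strong_induction_on generalizing u with
  | _ n ih =>
  by_cases hsame : ∃ i < q, (u (2 * i) ∈ firstPoints q u₀ ↔ u (2 * i + 1) ∈ firstPoints q u₀)
  · obtain ⟨i, hi, hiff⟩ := hsame
    have hg : Equiv.swap (u (2 * i)) (u (2 * i + 1)) • firstPoints q u₀ = firstPoints q u₀ := by
      by_cases h : u (2 * i) ∈ firstPoints q u₀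
      · exact swap_smul_of_mem h (hiff.1 h)
      · exact swap_smul_of_notMem h fun h' => h (hiff.2 h')
    have h1 := flagPairing_flagRep (Equiv.swap (u (2 * i)) (u (2 * i + 1))) w (polyFun F q 0 u)
    rw [flagRep_swap_polyFun hu hi, map_neg, hstab _ hg u hu, neg_eq_iff_add_eq_zero,
      ← two_mul] at h1
    exact (mul_eq_zero.1 h1).resolve_left h2
  push Not at hsame
  by_cases hout : ∃ i < q, u (2 * i) ∉ firstPoints q u₀
  · obtain ⟨i, hi, hnot⟩ := hout
    have hin : u (2 * i + 1) ∈ firstPoints q u₀ := by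
      have := hsame i hi
      tauto
    have hinj : Function.Injective (Equiv.swap (2 * i) (2 * i + 1)) := Equiv.injective _
    have hlt : ∀ j < 2 * q, Equiv.swap (2 * i) (2 * i + 1) j < 2 * q := fun j hj => by
      rw [Equiv.swap_apply_def]
      split_ifs <;> omega
    have hu' : IsTuple (2 * q) Finset.univ fun j => u (Equiv.swap (2 * i) (2 * i + 1) j) :=
      ⟨fun j hj l hl h => hinj (hu.1 (hlt j hj) (hlt l hl) h), fun _ _ => Finset.mem_univ _⟩
    have hswap : (polyFun F q 0 fun j => u (Equiv.swap (2 * i) (2 * i + 1) j)) =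
        -polyFun F q 0 u := by
      rw [polyFun, polytabloid_swap hi, map_neg, polyFun]
    have h1 := ih _ ?_ hu' rfl
    · rwa [hswap, map_neg, neg_eq_zero] at h1
    · rw [← hn]
      refine Finset.card_lt_card (Finset.ssubset_iff_of_subset (fun j => ?_) |>.2 ⟨i, ?_, ?_⟩)
      · simp only [Finset.mem_filter, Finset.mem_range]
        rintro ⟨hj, h⟩
        refine ⟨hj, ?_⟩
        by_cases hij : j = i
        · rwa [hij]
        · rwa [Equiv.swap_apply_of_ne_of_ne (by omega) (by omega)] at h
      · simpa using ⟨hi, hnot⟩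
      · simpa using fun _ => hin
  push Not at hout
  obtain ⟨g, hg⟩ := exists_perm_comp hu₀ hu
  have hgS : g⁻¹ • firstPoints q u₀ = firstPoints q u₀ := by
    rw [inv_smul_eq_iff]
    refine (Finset.eq_of_subset_of_card_le (fun z hz => ?_) ?_).symm
    · obtain ⟨y, hy, rfl⟩ := Finset.mem_smul_finset.1 hz
      obtain ⟨i, hi, rfl⟩ := Finset.mem_image.1 hy
      rw [Finset.mem_range] at hi
      rw [Equiv.Perm.smul_def, hg _ (by omega)]
      exact hout i hi
    · rw [Finset.card_smul_finset]
  have hpoly : polyFun F q 0 u = flagRep F ι g (polyFun F q 0 u₀) := by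
    rw [flagRep_polyFun, polyFun, polyFun]
    exact congrArg _ (polytabloid_congr fun i hi => (hg i hi).symm)
  have hw' : w = flagRep F ι g (flagRep F ι g⁻¹ w) := by
    rw [← Module.End.mul_apply, ← map_mul, mul_inv_cancel, map_one, Module.End.one_apply]
  rw [hpoly, hw', flagPairing_flagRep, hstab _ hgS u₀ hu₀, h0]

theorem exists_stabilizer_eq_sum_upFun (h2 : (2 : F) ≠ 0) {q a : ℕ}
    (hq : 2 * q ≤ Fintype.card ι) {u₀ : ℕ → ι} (hu₀ : IsTuple (2 * q) Finset.univ u₀)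
    {w : FlagSpace F ι} (hwM : w ∈ subsetFunctions F ι q)
    (hw : ∀ g : Equiv.Perm ι, g • firstPoints q u₀ = firstPoints q u₀ →
      flagRep F ι g w - w ∈ upSpan F ι q a)
    (h0 : flagPairing w (polyFun F q 0 u₀) = 0) :
    ∃ y : Finset ι → F,
      w - ∑ K ∈ Finset.univ.powersetCard a, y K • upFun F q K ∈ upSpan F ι q a := by
  have : Nonempty ι := ⟨u₀ 0⟩
  obtain ⟨y, hy⟩ := exists_eq_sum_upFun h2 hq hwM fun u hu =>
    flagPairing_polyFun_eq_zero_of_stabilizer h2 hu₀ hw h0 hu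
  refine ⟨fun K => if K.card < q then y K else 0, ?_⟩
  have h1 : ∑ K ∈ Finset.univ.powersetCard a, (if K.card < q then y K else 0) • upFun F q K =
      ∑ K with K.card < q, if K.card = a then y K • upFun F q K else 0 := by
    have : (Finset.univ : Finset ι).powersetCard a = Finset.univ.filter fun K => K.card = a := by
      ext K
      simp
    rw [this, Finset.sum_filter, Finset.sum_filter]
    refine Finset.sum_congr rfl fun K _ => ?_
    by_cases hK : K.card = a <;> by_cases hK' : K.card < q <;> simp [hK, hK']
  rw [h1, hy, ← Finset.sum_sub_distrib]
  refine Submodule.sum_mem _ fun K hK => ?_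
  rw [Finset.mem_filter] at hK
  by_cases hKa : K.card = a
  · rw [if_pos hKa, sub_self]
    exact Submodule.zero_mem _
  · rw [if_neg hKa, sub_zero]
    exact Submodule.smul_mem _ _ (upFun_mem_upSpan hK.2 hKa)

end StabilizerInvariants

section SymmetricGluing

open scoped Pointwise
open MonoidAlgebra (single)

variable {F ι : Type} [Field F] [DecidableEq ι]

theorem swap_smul_insert {x₀ x : ι} {K : Finset ι} (hx₀ : x₀ ∉ K) (hx : x ∉ K) :
    Equiv.swap x₀ x • insert x₀ K = insert x K := by
  rw [Finset.smul_finset_insert, Equiv.Perm.smul_def, Equiv.swap_apply_left,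
    swap_smul_of_notMem hx₀ hx]

variable [Fintype ι]

/-- The composition of the projection to functions of `a`-subsets with its adjoint. -/
def upProj (q a : ℕ) : FlagSpace F ι →ₗ[F] FlagSpace F ι :=
  ∑ K ∈ Finset.univ.powersetCard a, (flagPairing (upFun F q K)).smulRight (upFun F q K)

theorem upProj_apply (q a : ℕ) (t : FlagSpace F ι) : upProj q a t =
    ∑ K ∈ Finset.univ.powersetCard a, flagPairing (upFun F q K) t • upFun F q K := by
  simp [upProj]

theorem upProj_flagRep (q a : ℕ) (g : Equiv.Perm ι) (t : FlagSpace F ι) :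
    upProj q a (flagRep F ι g t) = flagRep F ι g (upProj q a t) := by
  rw [upProj_apply, upProj_apply, map_sum]
  refine (Finset.sum_equiv (MulAction.toPerm g) (fun K => ?_) fun K _ => ?_).symm
  · simp [Finset.card_smul_finset]
  · rw [map_smul, MulAction.toPerm_apply, ← flagRep_upFun, flagPairing_flagRep]

theorem upProj_mem (q a : ℕ) (t : FlagSpace F ι) : upProj q a t ∈ subsetFunctions F ι q := by
  rw [upProj_apply]
  exact Submodule.sum_mem _ fun K _ => Submodule.smul_mem _ _ (upFun_mem_subsetFunctions q K)

theorem exists_smul_finset_eq {S S' : Finset ι} (h : S.card = S'.card) :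
    ∃ g : Equiv.Perm ι, g • S = S' := by
  refine ⟨(Finset.equivOfCardEq h).extendSubtype, ?_⟩
  refine Finset.eq_of_subset_of_card_le (fun z hz => ?_) (by rw [Finset.card_smul_finset, h])
  obtain ⟨y, hy, rfl⟩ := Finset.mem_smul_finset.1 hz
  exact Equiv.extendSubtype_mem _ y hy

/-- The sum of the transpositions of `x₀` with the points outside `K`. -/
def sumSwap (F : Type) [Field F] (x₀ : ι) (K : Finset ι) : MonoidAlgebra F (Equiv.Perm ι) :=
  ∑ x ∈ Kᶜ, single (Equiv.swap x₀ x) 1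

theorem sumSwap_smul (x₀ : ι) (K : Finset ι) (t : FlagSpace F ι) :
    sumSwap F x₀ K • t = ∑ x ∈ Kᶜ, flagRep F ι (Equiv.swap x₀ x) t := by
  simp only [sumSwap, Finset.sum_smul, single_smul_flag, one_smul]

theorem sum_flagSingle_insert {q : ℕ} {K : Finset ι} (hK : K.card + 1 = q) :
    ∑ x ∈ Kᶜ, flagSingle (insert x K) ∅ = upFun F q K := by
  funext S Z
  simp only [Finset.sum_apply, flagSingle, upFun]
  by_cases h : S.card = q ∧ Z = ∅ ∧ K ⊆ S
  · obtain ⟨hS, rfl, hKS⟩ := h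
    obtain ⟨x, hx⟩ := Finset.card_eq_one.1 (show (S \ K).card = 1 by
      rw [Finset.card_sdiff_of_subset hKS]
      omega)
    have hSx : S = insert x K := by
      rw [Finset.insert_eq, ← hx, Finset.sdiff_union_of_subset hKS]
    have hxK : x ∉ K := (Finset.mem_sdiff.1 (hx ▸ Finset.mem_singleton_self x : x ∈ S \ K)).2
    rw [if_pos ⟨hS, rfl, hKS⟩, Finset.sum_eq_single x, if_pos ⟨hSx, rfl⟩]
    · intro y hy hne
      refine if_neg fun h => hne ?_
      have : y ∈ insert x K := hSx ▸ h.1 ▸ Finset.mem_insert_self y K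
      exact (Finset.mem_insert.1 this).resolve_right (Finset.mem_compl.1 hy)
    · exact fun h => absurd (Finset.mem_compl.2 hxK) h
  · rw [if_neg h]
    refine Finset.sum_eq_zero fun x hx => if_neg ?_
    rintro ⟨rfl, rfl⟩
    refine h ⟨?_, rfl, Finset.subset_insert _ _⟩
    rw [Finset.card_insert_of_notMem (Finset.mem_compl.1 hx), hK]

theorem sumSwap_smul_flagSingle {q : ℕ} {x₀ : ι} {K : Finset ι} (hx₀ : x₀ ∉ K)
    (hK : K.card + 1 = q) :
    sumSwap F x₀ K • (flagSingle (insert x₀ K) ∅ : FlagSpace F ι) = upFun F q K := by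
  rw [sumSwap_smul, ← sum_flagSingle_insert hK]
  refine Finset.sum_congr rfl fun x hx => ?_
  rw [flagRep_flagSingle, swap_smul_insert hx₀ (Finset.mem_compl.1 hx), Finset.smul_finset_empty]

/-- The gluing data given by the functions of `q`-subsets and the span of the functions
`polyFun F m k u`, where `q = m + 2 * k`. -/
def flagGluing (F : Type) [Field F] (m k a : ℕ) {u : ℕ → ι}
    (hu : IsTuple (2 * (m + 2 * k)) Finset.univ u) :
    GluingData F (MonoidAlgebra F (Equiv.Perm ι)) (FlagSpace F ι) where
  M := flagSubmodule (subsetFunctions F ι (m + 2 * k)) flagRep_mem_subsetFunctions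
  T := flagSubmodule (polySpan F ι m k) flagRep_mem_polySpan
  I := flagSubmodule (upSpan F ι (m + 2 * k) a) flagRep_mem_upSpan
  ι := flagHom (liftFun k) fun g t => liftFun_flagRep k g t
  θ := flagHom (upProj (m + 2 * k) a) fun g t => upProj_flagRep _ _ g t
  P := flagSingle (firstPoints (m + 2 * k) u) ∅
  δ := polyFun F m k u
  I_le := upSpan_le _ _
  P_mem := flagSingle_mem_subsetFunctions (card_firstPoints hu)
  δ_mem := polyFun_mem_polySpan (by rwa [show 2 * m + 4 * k = 2 * (m + 2 * k) by ring])
  M_le := fun t ht => by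
    have ht' : t ∈ subsetFunctions F ι (m + 2 * k) := ht
    rw [sum_smul_flagSingle t]
    refine Submodule.sum_mem _ fun S _ => Submodule.sum_mem _ fun Z _ => ?_
    by_cases h : S.card = m + 2 * k ∧ Z = ∅
    · obtain ⟨hS, rfl⟩ := h
      obtain ⟨g, hg⟩ := exists_smul_finset_eq ((card_firstPoints hu).trans hS.symm)
      rw [show t S ∅ • (flagSingle S ∅ : FlagSpace F ι) =
        single g (t S ∅) • flagSingle (firstPoints (m + 2 * k) u) ∅ by
          rw [single_smul_flag, flagRep_flagSingle, hg, Finset.smul_finset_empty]]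
      exact Submodule.smul_mem _ _ (Submodule.mem_span_singleton_self _)
    · rw [ht' S Z h, zero_smul]
      exact Submodule.zero_mem _
  T_le := fun t ht => by
    have hu' : IsTuple (2 * m + 4 * k) Finset.univ u := by
      rwa [show 2 * m + 4 * k = 2 * (m + 2 * k) by ring]
    refine polySpan_induction (p := (Submodule.span (MonoidAlgebra F (Equiv.Perm ι))
      {polyFun F m k u}).restrictScalars F) (fun v hv => ?_) ht
    obtain ⟨g, hg⟩ := exists_perm_comp hu' hv
    rw [Submodule.restrictScalars_mem]
    have : polyFun F m k v = single g (1 : F) • polyFun F m k u := by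
      rw [single_smul_flag, one_smul, flagRep_polyFun, polyFun, polyFun]
      exact congrArg _ (polytabloid_congr fun i hi => (hg i hi).symm)
    rw [this]
    exact Submodule.smul_mem _ _ (Submodule.mem_span_singleton_self _)
  θ_mem := fun w _ => upProj_mem _ _ w
  ι_inj := fun _ hw h => eq_zero_of_liftFun_eq_zero (by omega) hw h

theorem flagPairing_upSpan_eq_zero {q a : ℕ} {v : FlagSpace F ι}
    (hv : ∀ K : Finset ι, K.card < q → K.card ≠ a → flagPairing (upFun F q K) v = 0)
    {t : FlagSpace F ι} (ht : t ∈ upSpan F ι q a) : flagPairing t v = 0 := by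
  refine Submodule.span_le (p := LinearMap.ker (flagPairing.flip v)) |>.2 ?_ ht
  rintro _ ⟨K, hK, rfl⟩
  exact hv K hK.1 hK.2

theorem flagGluing_isRigid (p : ℕ) [Fact p.Prime] [CharP F p] (h2 : (2 : F) ≠ 0) {m a : ℕ}
    (hm : m + a + 2 = p) (ha : a + 1 < p) {u : ℕ → ι}
    (hu : IsTuple (2 * (m + 2 * (a + 1))) Finset.univ u)
    (hr : ∀ y : Finset ι → F, ∀ L : FlagSpace F ι,
      L = ∑ K ∈ Finset.univ.powersetCard a, y K • upFun F (m + 2 * (a + 1)) K →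
      (∀ g : Equiv.Perm ι, g • firstPoints (m + 2 * (a + 1)) u = firstPoints (m + 2 * (a + 1)) u →
        flagRep F ι g L - L ∈ upSpan F ι (m + 2 * (a + 1)) a) →
      sumSwap F (u 0) ((firstPoints (m + 2 * (a + 1)) u).erase (u 0)) • L ∈
        upSpan F ι (m + 2 * (a + 1)) a → L ∈ upSpan F ι (m + 2 * (a + 1)) a)
    {v : FlagSpace F ι} (hvM : v ∈ subsetFunctions F ι (m + 2 * (a + 1)))
    (hv : ∀ K : Finset ι, K.card < m + 2 * (a + 1) → K.card ≠ a →
      flagPairing (upFun F (m + 2 * (a + 1)) K) v = 0)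
    (hva : ∑ K ∈ Finset.univ.powersetCard a,
      flagPairing (upFun F (m + 2 * (a + 1)) K) v ^ 2 ≠ 0) :
    ∃ K π, (flagGluing F m (a + 1) a hu).IsRigid K
      (sumSwap F (u 0) ((firstPoints (m + 2 * (a + 1)) u).erase (u 0))) π
      (polyFun F (m + 2 * (a + 1)) 0 u) v := by
  set q := m + 2 * (a + 1) with hq
  set r := sumSwap F (u 0) ((firstPoints q u).erase (u 0)) with hrdef
  have hne : Nonempty ι := ⟨u 0⟩
  have hu' : IsTuple (2 * m + 4 * (a + 1)) Finset.univ u := by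
    rwa [show 2 * m + 4 * (a + 1) = 2 * q by omega]
  have hcard : 2 * q ≤ Fintype.card ι := by
    have := Fintype.card_le_of_injective (fun i : Fin (2 * q) => u i)
      fun i j h => Fin.ext (hu.1 i.2 j.2 h)
    rwa [Fintype.card_fin] at this
  have hmem : u 0 ∈ firstPoints q u := (mem_firstPoints hu (by omega)).2 (by simp)
  have herase : ((firstPoints q u).erase (u 0)).card + 1 = q := by
    rw [Finset.card_erase_add_one hmem, card_firstPoints hu]
  have hrP : r • (flagSingle (firstPoints q u) ∅ : FlagSpace F ι) ∈ upSpan F ι q a := by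
    have := sumSwap_smul_flagSingle (F := F) (Finset.notMem_erase (u 0) _) herase
    rw [Finset.insert_erase hmem] at this
    rw [this]
    exact upFun_mem_upSpan (by omega) (by omega)
  have hsingle : ∀ (g : Equiv.Perm ι) (t : FlagSpace F ι),
      single g (1 : F) • t = flagRep F ι g t := fun g t => by rw [single_smul_flag, one_smul]
  have hPe : flagPairing (flagSingle (firstPoints q u) ∅) (polyFun F q 0 u) = 1 := by
    have h := polyFun_firstPoints_blockPoints (F := F) (m := q) (k := 0) hu
    simp only [blockPoints, Finset.range_zero, Finset.image_empty, mul_zero, add_zero] at h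
    rw [flagPairing_comm, flagPairing_flagSingle, h]
  have hlift : ∀ w ∈ subsetFunctions F ι q, (∀ K : Finset ι, K.card < q → K.card ≠ a →
      flagPairing (upFun F q K) w = 0) → liftFun (a + 1) w ∈ polySpan F ι m (a + 1) :=
    fun w hw h => liftFun_mem_polySpan p h2 ha (by omega) (by omega) hw
      fun K hK hK' => h K hK' (by omega)
  obtain ⟨π, hπ, hπM, hπT⟩ := exists_smul_polyFun_eq (F := F) h2 (Nat.succ_pos a) hu'
  refine ⟨{x | ∃ g : Equiv.Perm ι, g • firstPoints q u = firstPoints q u ∧ x = single g 1}, π, ?_⟩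
  constructor
  case fixes =>
    rintro _ ⟨g, hg, rfl⟩
    change single g (1 : F) • (flagSingle (firstPoints q u) ∅ : FlagSpace F ι) = flagSingle _ ∅
    rw [hsingle, flagRep_flagSingle, hg, Finset.smul_finset_empty]
  case mem_range =>
    intro t ht h
    refine exists_eq_liftFun p h2 (by omega) (firstPoints q u) ht fun g hg => ?_
    obtain ⟨w, -, hw⟩ := h _ ⟨g, hg, rfl⟩
    exact ⟨w, by rw [← hsingle, hw]; rfl⟩
  case smul_P_mem => exact hrP
  case eq_smul_P =>
    intro z hz hK hrz
    refine ⟨flagPairing z (polyFun F q 0 u), ?_⟩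
    set c := flagPairing z (polyFun F q 0 u) with hc
    have hK' : ∀ g : Equiv.Perm ι, g • firstPoints q u = firstPoints q u →
        flagRep F ι g (z - c • flagSingle (firstPoints q u) ∅) -
          (z - c • flagSingle (firstPoints q u) ∅) ∈ upSpan F ι q a := fun g hg => by
      have h1 : flagRep F ι g z - z ∈ upSpan F ι q a := hsingle g z ▸ hK _ ⟨g, hg, rfl⟩
      rw [map_sub, map_smul, flagRep_flagSingle, hg, Finset.smul_finset_empty,
        sub_sub_sub_cancel_right]
      exact h1
    have hw : z - c • flagSingle (firstPoints q u) ∅ ∈ subsetFunctions F ι q :=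
      Submodule.sub_mem _ hz (Submodule.smul_mem _ _
        (flagSingle_mem_subsetFunctions (card_firstPoints hu)))
    change z - c • flagSingle (firstPoints q u) ∅ ∈ upSpan F ι q a
    have hrw : r • (z - c • flagSingle (firstPoints q u) ∅) ∈ upSpan F ι q a := by
      rw [smul_sub, smul_comm]
      exact Submodule.sub_mem _ hrz (Submodule.smul_mem _ _ hrP)
    have h0 : flagPairing (z - c • flagSingle (firstPoints q u) ∅) (polyFun F q 0 u) = 0 := by
      rw [map_sub, LinearMap.sub_apply, map_smul, LinearMap.smul_apply, hPe, smul_eq_mul, mul_one,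
        sub_self]
    generalize z - c • flagSingle (firstPoints q u) ∅ = w at hK' hw hrw h0 ⊢
    obtain ⟨y, hy⟩ := exists_stabilizer_eq_sum_upFun h2 hcard hu hw hK' h0
    have hL := hr y _ rfl
    generalize ∑ K ∈ Finset.univ.powersetCard a, y K • upFun F q K = L at hy hL
    have hrL : r • (w - L) ∈ upSpan F ι q a :=
      (flagSubmodule (upSpan F ι q a) flagRep_mem_upSpan).smul_mem r hy
    have hLmem : L ∈ upSpan F ι q a := by
      refine hL (fun g hg => ?_) ?_
      · have h1 := Submodule.sub_mem _ (hK' g hg)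
          (Submodule.sub_mem _ (flagRep_mem_upSpan g _ hy) hy)
        rwa [map_sub, show flagRep F ι g w - w - (flagRep F ι g w - flagRep F ι g L - (w - L)) =
          flagRep F ι g L - L by abel] at h1
      · have h1 := Submodule.sub_mem _ hrw hrL
        rwa [smul_sub, sub_sub_cancel] at h1
    have h1 := Submodule.add_mem _ hy hLmem
    rwa [sub_add_cancel] at h1
  case smul_δ => exact hπ
  case smul_M =>
    intro t ht
    refine hπM t fun S Z h => ?_
    by_contra hcon
    exact h ((flagGluing F m (a + 1) a hu).M.smul_mem π ht S Z hcon)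
  case smul_T =>
    intro t ht
    refine hπT t fun S Z h => ?_
    by_contra hcon
    exact h (polySpan_apply_eq_zero ((flagGluing F m (a + 1) a hu).T.smul_mem π ht) hcon)
  case e_mem => exact polyFun_mem_subsetFunctions hu
  case ι_e_mem =>
    exact hlift _ (polyFun_mem_subsetFunctions hu) fun K hK _ => flagPairing_upFun_polyFun hu hK
  case θ_e =>
    change upProj q a (polyFun F q 0 u) = 0
    rw [upProj_apply]
    refine Finset.sum_eq_zero fun K hK => ?_
    rw [flagPairing_upFun_polyFun hu (by rw [(Finset.mem_powersetCard.1 hK).2]; omega), zero_smul]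
  case e_notMem =>
    intro h
    have h1 := flagPairing_upSpan_polyFun hu h
    rw [flagPairing_polyFun_self hu] at h1
    exact pow_ne_zero _ h2 h1
  case v_mem => exact hvM
  case ι_v_mem => exact hlift v hvM hv
  case θ_v_notMem =>
    intro h
    have h1 := flagPairing_upSpan_eq_zero hv (show upProj q a v ∈ upSpan F ι q a from h)
    rw [upProj_apply, map_sum, LinearMap.sum_apply] at h1
    refine hva (Eq.trans (Finset.sum_congr rfl fun K _ => ?_) h1)
    rw [map_smul, LinearMap.smul_apply, smul_eq_mul, sq]

end SymmetricGluing

section TestFunctions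

variable {F ι : Type} [Field F] [DecidableEq ι]

theorem cast_card_filter_superset (p : ℕ) [hp : Fact p.Prime] [CharP F p] {C K : Finset ι}
    (hC : C.card + 1 = 2 * p) (hK : K.card < p) :
    (((C.powersetCard p).filter fun S => K ⊆ S).card : F) = if K = ∅ then 1 else 0 := by
  have hp2 := hp.out.two_le
  by_cases hKC : K ⊆ C
  · rw [card_filter_superset hKC hK.le]
    split_ifs with h
    · rw [h, Finset.card_empty, Nat.sub_zero, Nat.sub_zero, ← Nat.cast_one,
        CharP.natCast_eq_natCast F p]
      have h1 := Choose.choose_modEq_choose_mod_mul_choose_div_nat (n := C.card) (k := p) (p := p)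
      have h3 : C.card = (p - 1) + p := by omega
      rwa [h3, Nat.add_mod_right, Nat.mod_self,
        Nat.choose_zero_right, one_mul, Nat.add_div_right _ hp.out.pos, Nat.div_self hp.out.pos,
        Nat.div_eq_of_lt (by omega), zero_add, Nat.choose_self, ← h3] at h1
    · have := Finset.card_pos.2 (Finset.nonempty_iff_ne_empty.2 h)
      exact (CharP.cast_eq_zero_iff F p _).2
        (hp.out.dvd_choose (by omega) (by omega) (by omega))
  · rw [if_neg fun h => hKC (by simp [h]), Finset.filter_false_of_mem,
      Finset.card_empty, Nat.cast_zero]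
    exact fun S hS h => hKC (h.trans (Finset.mem_powersetCard.1 hS).1)

theorem cast_card_filter_superset_of_notMem (p : ℕ) {C K : Finset ι} {x : ι} (hx : x ∉ C)
    (hxK : x ∈ K) : (((C.powersetCard p).filter fun S => K ⊆ S).card : F) = 0 := by
  rw [Finset.filter_false_of_mem, Finset.card_empty, Nat.cast_zero]
  exact fun S hS h => hx ((Finset.mem_powersetCard.1 hS).1 (h hxK))

/-- The sum of the `p`-subsets of `C`. -/
def subsetSum (F : Type) [Field F] (p : ℕ) (C : Finset ι) : FlagSpace F ι :=
  ∑ S ∈ C.powersetCard p, flagSingle S ∅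

/-- The sum of the sets `insert x S`, where `S` runs through the `p`-subsets of `C`. -/
def insertSum (F : Type) [Field F] (p : ℕ) (C : Finset ι) (x : ι) : FlagSpace F ι :=
  ∑ S ∈ C.powersetCard p, flagSingle (insert x S) ∅

theorem subsetSum_mem (p : ℕ) (C : Finset ι) : subsetSum F p C ∈ subsetFunctions F ι p :=
  Submodule.sum_mem _ fun _ hS => flagSingle_mem_subsetFunctions (Finset.mem_powersetCard.1 hS).2

theorem insertSum_mem (p : ℕ) {C : Finset ι} {x : ι} (hx : x ∉ C) :
    insertSum F p C x ∈ subsetFunctions F ι (p + 1) :=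
  Submodule.sum_mem _ fun S hS => flagSingle_mem_subsetFunctions (by
    rw [Finset.mem_powersetCard] at hS
    rw [Finset.card_insert_of_notMem fun h => hx (hS.1 h), hS.2])

variable [Fintype ι]

theorem flagPairing_upFun_subsetSum (p : ℕ) (C K : Finset ι) :
    flagPairing (upFun F p K) (subsetSum F p C) =
      ((C.powersetCard p).filter fun S => K ⊆ S).card := by
  rw [subsetSum, map_sum, Finset.card_filter, Nat.cast_sum]
  refine Finset.sum_congr rfl fun S hS => ?_
  simp [flagPairing_flagSingle, upFun, (Finset.mem_powersetCard.1 hS).2]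

theorem flagPairing_upFun_insertSum (p : ℕ) {C : Finset ι} {x : ι} (hx : x ∉ C) (K : Finset ι) :
    flagPairing (upFun F (p + 1) K) (insertSum F p C x) =
      ((C.powersetCard p).filter fun S => K.erase x ⊆ S).card := by
  rw [insertSum, map_sum, Finset.card_filter, Nat.cast_sum]
  refine Finset.sum_congr rfl fun S hS => ?_
  rw [Finset.mem_powersetCard] at hS
  have hcard : (insert x S).card = p + 1 := by
    rw [Finset.card_insert_of_notMem fun h => hx (hS.1 h), hS.2]
  simp [flagPairing_flagSingle, upFun, hcard, Finset.subset_insert_iff]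

theorem exists_subsetFunctions_pairing (p : ℕ) [hp : Fact p.Prime] [CharP F p]
    (hn : 2 * p ≤ Fintype.card ι) : ∃ v ∈ subsetFunctions F ι p, ∀ K : Finset ι, K.card < p →
      flagPairing (upFun F p K) v = if K = ∅ then 1 else 0 := by
  obtain ⟨C, -, hC⟩ := Finset.exists_subset_card_eq
    (show 2 * p - 1 ≤ (Finset.univ : Finset ι).card by rw [Finset.card_univ]; omega)
  have := hp.out.pos
  refine ⟨subsetSum F p C, subsetSum_mem p C, fun K hK => ?_⟩
  rw [flagPairing_upFun_subsetSum, cast_card_filter_superset p (by omega) hK]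

theorem exists_subsetFunctions_pairing_of_ne (p : ℕ) [hp : Fact p.Prime] [CharP F p]
    (hn : 2 * p + 1 ≤ Fintype.card ι) {x y : ι} (hxy : x ≠ y) :
    ∃ v ∈ subsetFunctions F ι (p + 1), ∀ K : Finset ι, K.card < p + 1 →
      flagPairing (upFun F (p + 1) K) v =
        (if K = {x} then 1 else 0) - if K = {y} then 1 else 0 := by
  have hpos := hp.out.pos
  obtain ⟨C, hCsub, hC⟩ := Finset.exists_subset_card_eq
    (show 2 * p - 1 ≤ ((Finset.univ.erase x).erase y : Finset ι).card by
      rw [Finset.card_erase_of_mem (by simp [hxy.symm]), Finset.card_erase_of_mem (by simp),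
        Finset.card_univ]
      omega)
  have hx : x ∉ C := fun h => by simpa using hCsub h
  have hy : y ∉ C := fun h => by simpa using hCsub h
  have key : ∀ z : ι, ∀ K : Finset ι, K.card < p + 1 → z ∈ K →
      (((C.powersetCard p).filter fun S => K.erase z ⊆ S).card : F) =
        if K = {z} then 1 else 0 := fun z K hK hzK => by
    rw [cast_card_filter_superset p (by omega) (by rw [Finset.card_erase_of_mem hzK]; omega)]
    refine if_congr ?_ rfl rfl
    rw [Finset.erase_eq_empty_iff]
    refine ⟨fun h => h.resolve_left fun h0 => ?_, Or.inr⟩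
    simp [h0] at hzK
  refine ⟨insertSum F p C x - insertSum F p C y,
    Submodule.sub_mem _ (insertSum_mem p hx) (insertSum_mem p hy), fun K hK => ?_⟩
  rw [map_sub, flagPairing_upFun_insertSum p hx, flagPairing_upFun_insertSum p hy]
  have hne : ∀ {z : ι}, z ∉ K → K ≠ {z} := fun hz h => hz (h ▸ Finset.mem_singleton_self _)
  by_cases hxK : x ∈ K
  · rw [key x K hK hxK]
    by_cases hyK : y ∈ K
    · rw [key y K hK hyK]
    · rw [Finset.erase_eq_of_notMem hyK, cast_card_filter_superset_of_notMem p hx hxK,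
        if_neg (hne hyK)]
  · rw [Finset.erase_eq_of_notMem hxK, if_neg (hne hxK)]
    by_cases hyK : y ∈ K
    · rw [key y K hK hyK, cast_card_filter_superset_of_notMem p hy hyK]
    · rw [Finset.erase_eq_of_notMem hyK, if_neg (hne hyK), sub_self, sub_self]

end TestFunctions

section SchurianInfinite

open scoped Pointwise

variable {F ι : Type} [Field F] [DecidableEq ι] [Fintype ι]

theorem sum_smul_eq_zero_of_sumSwap {q : ℕ} {x₀ : ι} {K₀ : Finset ι} {c : F}
    (hcard : ((K₀ᶜ.card : ℕ) : F) ≠ 0) {v : FlagSpace F ι}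
    (hv : ∀ K : Finset ι, K.card < q → K.card ≠ 0 → flagPairing (upFun F q K) v = 0)
    (hv₀ : flagPairing (upFun F q ∅) v ≠ 0)
    (h : sumSwap F x₀ K₀ • (c • upFun F q ∅ : FlagSpace F ι) ∈ upSpan F ι q 0) : c = 0 := by
  have h1 := flagPairing_upSpan_eq_zero hv h
  rw [sumSwap_smul] at h1
  simp only [map_smul, flagRep_upFun, Finset.smul_finset_empty, Finset.sum_const] at h1
  rw [← Nat.cast_smul_eq_nsmul F, map_smul, map_smul, LinearMap.smul_apply, LinearMap.smul_apply,
    smul_eq_mul, smul_eq_mul] at h1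
  exact (mul_eq_zero.1 ((mul_eq_zero.1 h1).resolve_left hcard)).resolve_right hv₀

theorem sum_upFun_singleton (q : ℕ) : ∑ i : ι, upFun F q {i} = (q : F) • upFun F q ∅ := by
  funext S Z
  simp only [Finset.sum_apply, upFun, Pi.smul_apply, Finset.singleton_subset_iff,
    Finset.empty_subset, and_true, smul_eq_mul, mul_ite, mul_one, mul_zero]
  by_cases h : S.card = q ∧ Z = ∅
  · simp [h.1, h.2]
  · rw [if_neg h]
    exact Finset.sum_eq_zero fun i _ => if_neg fun h' => h ⟨h'.1, h'.2.1⟩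

theorem flagPairing_sum_upFun_singleton {q : ℕ} (hq : 1 < q) {v : FlagSpace F ι} {x y : ι}
    (hv : ∀ K : Finset ι, K.card < q →
      flagPairing (upFun F q K) v = (if K = {x} then 1 else 0) - if K = {y} then 1 else 0)
    (c : ι → F) : flagPairing (∑ i, c i • upFun F q {i}) v = c x - c y := by
  rw [map_sum, LinearMap.sum_apply]
  have : ∀ i : ι, flagPairing (c i • upFun F q {i}) v =
      (if i = x then c i else 0) - if i = y then c i else 0 := fun i => by
    rw [map_smul, LinearMap.smul_apply, hv _ (by simpa using hq), smul_eq_mul, mul_sub]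
    simp
  rw [Finset.sum_congr rfl fun i _ => this i]
  simp

theorem sum_smul_upFun_singleton_mem (h2 : (2 : F) ≠ 0) {q : ℕ} (hq : 1 < q) {u : ℕ → ι}
    (hu : IsTuple (2 * q) Finset.univ u)
    (hv : ∀ x y : ι, x ≠ y → ∃ v ∈ subsetFunctions F ι q, ∀ K : Finset ι, K.card < q →
      flagPairing (upFun F q K) v = (if K = {x} then 1 else 0) - if K = {y} then 1 else 0)
    (hcard : ((((firstPoints q u)ᶜ).card : ℕ) : F) ≠ 0) {c : ι → F} {L : FlagSpace F ι}
    (hL : L = ∑ i, c i • upFun F q {i})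
    (hg : ∀ g : Equiv.Perm ι, g • firstPoints q u = firstPoints q u →
      flagRep F ι g L - L ∈ upSpan F ι q 1)
    (hr : sumSwap F (u 0) ((firstPoints q u).erase (u 0)) • L ∈ upSpan F ι q 1) :
    L ∈ upSpan F ι q 1 := by
  have hflag : ∀ g : Equiv.Perm ι, flagRep F ι g L = ∑ i, c (g⁻¹ i) • upFun F q {i} := fun g => by
    rw [hL, map_sum]
    refine Finset.sum_equiv g (by simp) fun i _ => ?_
    rw [map_smul, flagRep_upFun, Finset.smul_finset_singleton, Equiv.Perm.smul_def,
      ← Equiv.Perm.mul_apply, inv_mul_cancel, Equiv.Perm.one_apply]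
  have hpair : ∀ x y : ι, x ≠ y → ∀ d : ι → F, ∑ i, d i • upFun F q {i} ∈ upSpan F ι q 1 →
      d x = d y := fun x y hxy d hd => by
    obtain ⟨v, -, hvK⟩ := hv x y hxy
    have h := flagPairing_upSpan_eq_zero (v := v) (fun K hK hK' => ?_) hd
    · rw [flagPairing_sum_upFun_singleton hq hvK] at h
      exact sub_eq_zero.1 h
    · rw [hvK K hK, if_neg, if_neg, sub_self] <;>
      · rintro rfl
        exact hK' (Finset.card_singleton _)
  have hsame : ∀ i j : ι, (i ∈ firstPoints q u ↔ j ∈ firstPoints q u) → c i = c j := fun i j h => by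
    by_cases hij : i = j
    · rw [hij]
    have hswap : Equiv.swap i j • firstPoints q u = firstPoints q u := by
      by_cases hi : i ∈ firstPoints q u
      · exact swap_smul_of_mem hi (h.1 hi)
      · exact swap_smul_of_notMem hi fun hj => hi (h.2 hj)
    have h1 := hg _ hswap
    rw [hflag, hL, ← Finset.sum_sub_distrib] at h1
    simp only [← sub_smul] at h1
    have h3 := hpair i j hij _ h1
    rw [Equiv.swap_inv, Equiv.swap_apply_left, Equiv.swap_apply_right] at h3
    have h4 : (2 : F) * (c i - c j) = 0 := by linear_combination -h3
    exact sub_eq_zero.1 ((mul_eq_zero.1 h4).resolve_left h2)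
  have hu0 : u 0 ∈ firstPoints q u := (mem_firstPoints hu (by omega)).2 (by simp)
  have hu1 : u 1 ∉ firstPoints q u := fun h => by
    simpa using (mem_firstPoints hu (by omega)).1 h
  have hu2 : u 2 ∈ firstPoints q u := (mem_firstPoints hu (by omega)).2 (by simp)
  have hu02 : u 0 ≠ u 2 := fun h => by
    have := hu.1 (show 0 < 2 * q by omega) (show 2 < 2 * q by omega) h
    omega
  have hu01 : u 0 ≠ u 1 := fun h => hu1 (h ▸ hu0)
  have hu12 : u 2 ≠ u 1 := fun h => hu1 (h ▸ hu2)
  have hcompl : ((firstPoints q u).erase (u 0))ᶜ = insert (u 0) (firstPoints q u)ᶜ := by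
    rw [Finset.compl_erase]
  have heq : c (u 0) = c (u 1) := by
    rw [sumSwap_smul] at hr
    simp only [hflag] at hr
    rw [Finset.sum_comm] at hr
    simp only [← Finset.sum_smul] at hr
    have h := hpair _ _ hu12 _ hr
    rw [hcompl, Finset.sum_insert (by simpa using hu0), Finset.sum_insert (by simpa using hu0)] at h
    have hrefl : ∀ i : ι, (Equiv.swap (u 0) (u 0))⁻¹ i = i := fun i => by
      rw [Equiv.swap_self]
      rfl
    rw [hrefl, hrefl] at h
    simp only [Equiv.swap_inv] at h
    have hl : ∑ x ∈ (firstPoints q u)ᶜ, c (Equiv.swap (u 0) x (u 2)) =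
        ((firstPoints q u)ᶜ.card : F) * c (u 0) := by
      rw [← nsmul_eq_mul, ← Finset.sum_const]
      refine Finset.sum_congr rfl fun x hx => ?_
      rw [Equiv.swap_apply_of_ne_of_ne hu02.symm, hsame _ _ (iff_of_true hu2 hu0)]
      rintro rfl
      exact Finset.mem_compl.1 hx hu2
    have hrt : ∑ x ∈ (firstPoints q u)ᶜ, c (Equiv.swap (u 0) x (u 1)) =
        ((firstPoints q u)ᶜ.card : F) * c (u 1) + (c (u 0) - c (u 1)) := by
      have : ∀ x ∈ (firstPoints q u)ᶜ, c (Equiv.swap (u 0) x (u 1)) =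
          c (u 1) + if x = u 1 then c (u 0) - c (u 1) else 0 := fun x _ => by
        split_ifs with hx
        · rw [hx, Equiv.swap_apply_right]
          ring
        · rw [Equiv.swap_apply_of_ne_of_ne hu01.symm (Ne.symm hx), add_zero]
      rw [Finset.sum_congr rfl this, Finset.sum_add_distrib, Finset.sum_const, nsmul_eq_mul,
        Finset.sum_ite_eq', if_pos (Finset.mem_compl.2 hu1)]
    rw [hl, hrt, hsame _ _ (iff_of_true hu2 hu0)] at h
    have h5 : ((firstPoints q u)ᶜ.card : F) * (c (u 0) - c (u 1)) = 0 := by linear_combination h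
    exact sub_eq_zero.1 ((mul_eq_zero.1 h5).resolve_left hcard)
  have hconst : ∀ i, c i = c (u 1) := fun i => by
    by_cases hi : i ∈ firstPoints q u
    · rw [← heq]
      exact hsame _ _ (iff_of_true hi hu0)
    · exact hsame _ _ (iff_of_false hi hu1)
  rw [hL]
  simp only [hconst]
  rw [← Finset.smul_sum, sum_upFun_singleton]
  exact Submodule.smul_mem _ _ (Submodule.smul_mem _ _
    (upFun_mem_upSpan (by simp; omega) (by simp)))

theorem exists_isTuple {n N : ℕ} (h : N ≤ n) (hn : 0 < n) :
    ∃ u : ℕ → Fin n, IsTuple N Finset.univ u := by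
  refine ⟨fun i => ⟨i % n, Nat.mod_lt _ hn⟩, fun i hi j hj hij => ?_, fun _ _ => Finset.mem_univ _⟩
  rw [Set.mem_Iio] at hi hj
  have := Fin.mk.inj hij
  rwa [Nat.mod_eq_of_lt (by omega), Nat.mod_eq_of_lt (by omega)] at this

theorem not_isSchurianFinite_perm_of_cast_ne [IsAlgClosed F] (p : ℕ) [hp : Fact p.Prime]
    [CharP F p] (h2 : (2 : F) ≠ 0) {n : ℕ} (hn : 2 * p ≤ n) (hcast : ((n + 1 : ℕ) : F) ≠ 0) :
    ¬ IsSchurianFinite F (MonoidAlgebra F (Equiv.Perm (Fin n))) := by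
  obtain ⟨m, hm⟩ := Nat.exists_eq_add_of_le hp.out.two_le
  have hq : m + 2 * (0 + 1) = p := by omega
  obtain ⟨u, hu⟩ := exists_isTuple (show 2 * (m + 2 * (0 + 1)) ≤ n by omega) (by omega)
  obtain ⟨v, hvM, hv⟩ := exists_subsetFunctions_pairing (F := F) (ι := Fin n) p (by simpa using hn)
  rw [← hq] at hvM
  have hv' : ∀ K : Finset (Fin n), K.card < m + 2 * (0 + 1) →
      flagPairing (upFun F (m + 2 * (0 + 1)) K) v = if K = ∅ then 1 else 0 := by
    rwa [hq]
  have hv₀ : flagPairing (upFun F (m + 2 * (0 + 1)) ∅) v = 1 := by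
    rw [hv' ∅ (by simp), if_pos rfl]
  have hv₁ : ∀ K : Finset (Fin n), K.card < m + 2 * (0 + 1) → K.card ≠ 0 →
      flagPairing (upFun F (m + 2 * (0 + 1)) K) v = 0 := fun K hK hK' => by
    rw [hv' K hK, if_neg fun h => hK' (Finset.card_eq_zero.2 h)]
  refine (flagGluing_isRigid (F := F) p h2 (m := m) (a := 0) (by omega)
    hp.out.one_lt hu (fun y L hL _ hrL => ?_) hvM hv₁ ?_).elim
    fun K h => h.elim fun π h => h.not_isSchurianFinite
  · rw [Finset.powersetCard_zero, Finset.sum_singleton] at hL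
    subst hL
    rw [sum_smul_eq_zero_of_sumSwap ?_ hv₁ (by rw [hv₀]; exact one_ne_zero) hrL, zero_smul]
    · exact Submodule.zero_mem _
    · have hmem : u 0 ∈ firstPoints (m + 2 * (0 + 1)) u :=
        (mem_firstPoints hu (by omega)).2 (by simp)
      rw [Finset.card_compl, Finset.card_erase_of_mem hmem, card_firstPoints hu, Fintype.card_fin]
      intro h0
      refine hcast ?_
      rw [show n + 1 = n - (m + 2 * (0 + 1) - 1) + p by omega, Nat.cast_add, h0, CharP.cast_eq_zero,
        add_zero]
  · rw [Finset.powersetCard_zero, Finset.sum_singleton, hv₀, one_pow]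
    exact one_ne_zero

theorem not_isSchurianFinite_perm_of_cast_eq [IsAlgClosed F] (p : ℕ) [hp : Fact p.Prime]
    [CharP F p] (hp3 : 3 ≤ p) (h2 : (2 : F) ≠ 0) {n : ℕ} (hn : 2 * p ≤ n)
    (hcast : ((n + 1 : ℕ) : F) = 0) :
    ¬ IsSchurianFinite F (MonoidAlgebra F (Equiv.Perm (Fin n))) := by
  obtain ⟨m, hm⟩ := Nat.exists_eq_add_of_le hp3
  have hn3 : 3 * p ≤ n + 1 := by
    obtain ⟨d, hd⟩ := (CharP.cast_eq_zero_iff F p _).1 hcast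
    rw [hd, mul_comm 3]
    refine Nat.mul_le_mul_left p ?_
    by_contra hlt
    have : p * d ≤ p * 2 := Nat.mul_le_mul_left p (by omega)
    omega
  have hq : m + 2 * (1 + 1) = p + 1 := by omega
  obtain ⟨u, hu⟩ := exists_isTuple (show 2 * (m + 2 * (1 + 1)) ≤ n by omega) (by omega)
  have hv : ∀ x y : Fin n, x ≠ y → ∃ v ∈ subsetFunctions F (Fin n) (m + 2 * (1 + 1)),
      ∀ K : Finset (Fin n), K.card < m + 2 * (1 + 1) →
      flagPairing (upFun F (m + 2 * (1 + 1)) K) v =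
        (if K = {x} then 1 else 0) - if K = {y} then 1 else 0 := fun x y hxy => by
    rw [hq]
    exact exists_subsetFunctions_pairing_of_ne p (by rw [Fintype.card_fin]; omega) hxy
  have hpow : (Finset.univ : Finset (Fin n)).powersetCard 1 =
      Finset.univ.map ⟨singleton, Finset.singleton_injective⟩ := Finset.powersetCard_one _
  have hu01 : u 0 ≠ u 1 := fun h => by
    have := hu.1 (show 0 < 2 * (m + 2 * (1 + 1)) by omega)
      (show 1 < 2 * (m + 2 * (1 + 1)) by omega) h
    omega
  obtain ⟨v, hvM, hvK⟩ := hv _ _ hu01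
  refine (flagGluing_isRigid (F := F) p h2 (m := m) (a := 1) (by omega)
    (by omega) hu (fun y L hL hg hrL => ?_) hvM (fun K hK hK' => ?_) ?_).elim
    fun K h => h.elim fun π h => h.not_isSchurianFinite
  · rw [hpow, Finset.sum_map] at hL
    refine sum_smul_upFun_singleton_mem h2 (by omega) hu hv ?_ hL hg hrL
    rw [Finset.card_compl, card_firstPoints hu, Fintype.card_fin]
    intro h0
    refine h2 ?_
    have h1 : ((n - (m + 2 * (1 + 1)) + p + 2 : ℕ) : F) = 0 := by
      rw [show n - (m + 2 * (1 + 1)) + p + 2 = n + 1 by omega, hcast]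
    rwa [Nat.cast_add, Nat.cast_add, h0, CharP.cast_eq_zero, zero_add, zero_add,
      Nat.cast_ofNat] at h1
  · rw [hvK K hK, if_neg, if_neg, sub_self] <;>
    · rintro rfl
      exact hK' (Finset.card_singleton _)
  · rw [hpow, Finset.sum_map]
    have : ∀ i : Fin n, flagPairing (upFun F (m + 2 * (1 + 1)) {i}) v ^ 2 =
        (if i = u 0 then 1 else 0) + if i = u 1 then 1 else 0 := fun i => by
      rw [hvK _ (by simp)]
      by_cases hi : i = u 0
      · simp [hi, hu01]
      · by_cases hi' : i = u 1 <;> simp [hi, hi', hu01.symm]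
    simp only [Function.Embedding.coeFn_mk, this]
    simpa [Finset.sum_add_distrib, one_add_one_eq_two] using h2

end SchurianInfinite

/-- Let `F` be an algebraically closed field of characteristic `p ≥ 3`.
Then for every `n ≥ 1`, the group algebra `F[S_n]` of the symmetric group `S_n` is
Schurian-finite if and only if `n < 2p`. -/
theorem groupAlgebra_schurianFinite_iff_lt_two_mul_char
    (F : Type) [Field F] [IsAlgClosed F] (p : ℕ) (hp : CharP F p) (hp3 : 3 ≤ p)
    (n : ℕ) (hn : 1 ≤ n) :
    IsSchurianFinite F (MonoidAlgebra F (Equiv.Perm (Fin n))) ↔ n < 2 * p := by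
  have : Fact p.Prime := ⟨(CharP.char_is_prime_or_zero F p).resolve_right (by omega)⟩
  have h2 : (2 : F) ≠ 0 := fun h => by
    have := Nat.le_of_dvd two_pos ((CharP.cast_eq_zero_iff F p 2).1 (by exact_mod_cast h))
    omega
  refine ⟨fun h => ?_, isSchurianFinite_perm_of_lt p⟩
  by_contra hlt
  by_cases hcast : ((n + 1 : ℕ) : F) = 0
  · exact not_isSchurianFinite_perm_of_cast_eq p hp3 h2 (not_lt.1 hlt) hcast h
  · exact not_isSchurianFinite_perm_of_cast_ne p h2 (not_lt.1 hlt) hcast h
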